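/- There exist absolute constants C, c > 0 such that the following holds. Let δ > 0 and let f, g, h : ℤ → ℂ be 1-bounded functions supported in [N]. Suppose that |∑_{x∈ℤ} ∑_{y∈ℕ} f(x) g(x+y) h(x+y²)| ≥ δ N^{3/2}. Then either N ≤ C δ^{-C}, or there is a 1-bounded local function φ of resolution M ≥ c δ^C N and modulus q ≤ C δ^{-C} such that |∑_{x∈ℤ} h(x) φ(x)| ≥ c δ^C N. -/

import Mathlib

/-- `φ : ℤ → ℂ` is a *local function of resolution `M` and modulus `q`*: there is a
partition of `ℝ` (hence of `ℤ`) into intervals of length `M` (the intervals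
`[r + kM, r + (k+1)M)`) such that `φ` is constant on the intersection of every such
interval with every congruence class mod `q`. -/
def IsLocalFunction (φ : ℤ → ℂ) (M : ℝ) (q : ℕ) : Prop :=
  ∃ r : ℝ, ∀ x y : ℤ,
    ⌊((x : ℝ) - r) / M⌋ = ⌊((y : ℝ) - r) / M⌋ → x % (q : ℤ) = y % (q : ℤ) → φ x = φ y

open Finset

local notation "conj" => starRingEnd ℂ
local notation "IC" => Icc (1:ℤ)
local notation "IZ" => Ico (0:ℤ)
local notation "zc" M:max x:max => ((x : ℤ) : ZMod M)
local notation "mL" => mul_le_mul_of_nonneg_left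
local notation "mR" => mul_le_mul_of_nonneg_right
local notation "npR" => Nat.pow_le_pow_right
local notation "npL" => Nat.pow_le_pow_left
local notation "nsp" => Nat.le_self_pow
local notation "cL" => le_of_mul_le_mul_left
local notation "nmR" => Nat.mul_le_mul_right
local notation "nmL" => Nat.mul_le_mul_left
local notation "slc" => sum_le_card_nsmul
local notation "pL" => pow_le_pow_left₀

noncomputable def ee (t : ℝ) : ℂ := Complex.exp (Complex.I * ((2 * Real.pi * t : ℝ) : ℂ))
noncomputable def nd (t : ℝ) : ℝ := |t - round t|

lemma norm_ee (t : ℝ) : ‖ee t‖ = 1 := by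
  unfold ee; rw [mul_comm]; exact Complex.norm_exp_ofReal_mul_I _

lemma ee_add (s t : ℝ) : ee (s + t) = ee s * ee t := by
  unfold ee; rw [← Complex.exp_add]; congr 1; push_cast; ring

lemma ee_int (n : ℤ) : ee n = 1 := by
  unfold ee; rw [Complex.exp_eq_one_iff]; exact ⟨n, by push_cast; ring⟩

lemma ee_zero : ee 0 = 1 := by simpa using ee_int 0

lemma ee_neg (t : ℝ) : ee (-t) = (starRingEnd ℂ) (ee t) := by
  unfold ee; rw [← Complex.exp_conj]; congr 1
  rw [map_mul, Complex.conj_I, Complex.conj_ofReal]; push_cast; ring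

lemma ee_mul_neg (t : ℝ) : ee t * ee (-t) = 1 := by rw [← ee_add]; simp [ee_zero]

lemma ee_add_int (t : ℝ) (n : ℤ) : ee (t + n) = ee t := by rw [ee_add, ee_int, mul_one]

lemma nd_nonneg (t : ℝ) : 0 ≤ nd t := abs_nonneg _
lemma nd_le_half (t : ℝ) : nd t ≤ 1 / 2 := abs_sub_round t
lemma nd_le (t : ℝ) (n : ℤ) : nd t ≤ |t - n| := round_le t n
lemma nd_le_abs (t : ℝ) : nd t ≤ |t| := by simpa using nd_le t 0
lemma nd_add (s t : ℝ) : nd (s + t) ≤ nd s + nd t := by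
  refine (nd_le _ (round s + round t)).trans ?_
  unfold nd; push_cast
  calc _ = |(s - round s) + (t - round t)| := by ring_nf
    _ ≤ _ := abs_add_le _ _
lemma nd_neg (t : ℝ) : nd (-t) = nd t := by
  have h : ∀ t, nd (-t) ≤ nd t := fun t => by
    refine (nd_le _ (-round t)).trans (le_of_eq ?_)
    unfold nd; push_cast; rw [← abs_neg]; ring_nf
  refine le_antisymm (h t) ?_
  simpa using h (-t)
lemma nd_sub (s t : ℝ) : nd (s - t) ≤ nd s + nd t := by
  rw [sub_eq_add_neg, ← nd_neg t]; exact nd_add _ _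
lemma nd_int_mul (n : ℤ) (t : ℝ) : nd (n * t) ≤ |(n:ℝ)| * nd t := by
  refine (nd_le _ (n * round t)).trans ?_
  unfold nd; push_cast; rw [← mul_sub, abs_mul]
lemma nd_nat_mul (n : ℕ) (t : ℝ) : nd (n * t) ≤ n * nd t := by
  simpa using nd_int_mul n t
lemma nd_add_int (t : ℝ) (n : ℤ) : nd (t + n) = nd t := by
  unfold nd; rw [round_add_intCast]; push_cast; ring_nf

lemma ee_sub_one_le (t : ℝ) : ‖ee t - 1‖ ≤ 7 * nd t := by
  have h1 : ee t = ee (t - round t) := by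
    rw [← ee_add_int (t - round t) (round t)]; congr 1; ring
  rw [h1]
  refine (Real.norm_exp_I_mul_ofReal_sub_one_le).trans ?_
  rw [Real.norm_eq_abs, abs_mul, abs_of_pos Real.two_pi_pos]
  unfold nd
  have := Real.pi_lt_d2
  nlinarith [abs_nonneg (t - round t)]

lemma ee_sub_le (s t : ℝ) : ‖ee s - ee t‖ ≤ 7 * nd (s - t) := by
  have : ee s - ee t = ee t * (ee (s - t) - 1) := by
    rw [mul_sub, ← ee_add]; simp
  rw [this, norm_mul, norm_ee, one_mul]; exact ee_sub_one_le _

lemma ee_sub_one_ge (t : ℝ) : 4 * nd t ≤ ‖ee t - 1‖ := by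
  have h1 : ee t = ee (t - round t) := by
    rw [← ee_add_int (t - round t) (round t)]; congr 1; ring
  rw [h1]; unfold ee
  rw [Complex.norm_exp_I_mul_ofReal_sub_one, Real.norm_eq_abs, abs_mul, abs_two]
  have h2 := nd_le_half t
  unfold nd at *
  set u := t - round t
  have h3 : |Real.sin (2 * Real.pi * u / 2)| = Real.sin (Real.pi * |u|) := by
    rw [show 2 * Real.pi * u / 2 = Real.pi * u by ring]
    have hp := Real.pi_pos
    rcases le_or_gt 0 u with h | h
    · rw [abs_of_nonneg h] at *
      rw [abs_of_nonneg]
      exact Real.sin_nonneg_of_nonneg_of_le_pi (by positivity) (by nlinarith)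
    · rw [abs_of_neg h] at *
      rw [mul_neg, Real.sin_neg, abs_of_nonpos]
      exact Real.sin_nonpos_of_nonpos_of_neg_pi_le (by nlinarith) (by nlinarith)
  rw [h3]
  have h4 := Real.mul_le_sin (x := Real.pi * |u|) (by positivity) (by nlinarith [Real.pi_pos])
  have h5 : 2 / Real.pi * (Real.pi * |u|) = 2 * |u| := by field_simp
  linarith

lemma tele_Ico (F : ℤ → ℂ) (a b : ℤ) (h : a ≤ b) :
    ∑ t ∈ Ico a b, (F (t + 1) - F t) = F b - F a := by
  induction b, h using Int.leInduction with
  | base => simp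
  | succ n hn ih =>
    have : Ico a (n + 1) = insert n (Ico a n) := by ext x; simp; omega
    rw [this, sum_insert (by simp), ih]; ring

lemma geo_Ico (φ l : ℝ) (a b : ℤ) : ‖∑ t ∈ Ico a b, ee (φ * t + l)‖ * (2 * nd φ) ≤ 1 := by
  rcases le_or_gt a b with h | h
  · have h1 : (ee φ - 1) * ∑ t ∈ Ico a b, ee (φ * t + l) = ee (φ * b + l) - ee (φ * a + l) := by
      rw [← tele_Ico (fun t => ee (φ * t + l)) a b h, mul_sum]
      refine sum_congr rfl fun t _ => ?_
      rw [sub_mul, one_mul, ← ee_add]; congr 2; push_cast; ring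
    have h2 := congrArg norm h1
    rw [norm_mul] at h2
    have h3 : ‖ee (φ * b + l) - ee (φ * a + l)‖ ≤ 2 := by
      refine (norm_sub_le _ _).trans ?_
      rw [norm_ee, norm_ee]; norm_num
    have h4 := ee_sub_one_ge φ
    have := mR h4 (norm_nonneg (∑ t ∈ Ico a b, ee (φ * t + l)))
    nlinarith
  · rw [Ico_eq_empty (by omega)]; simp

/-- order-connected finite sets of integers are intervals -/
lemma ordc_Ico (S : Finset ℤ) (hS : ∀ x ∈ S, ∀ z ∈ S, ∀ y, x ≤ y → y ≤ z → y ∈ S) :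
    ∃ a b, S = Ico a b := by
  rcases S.eq_empty_or_nonempty with h | h
  · exact ⟨0, 0, by simp [h]⟩
  · refine ⟨S.min' h, S.max' h + 1, ?_⟩
    ext x; simp only [mem_Ico]
    constructor
    · intro hx; exact ⟨S.min'_le x hx, Int.lt_add_one_of_le (S.le_max' x hx)⟩
    · rintro ⟨h1, h2⟩
      exact hS _ (S.min'_mem h) _ (S.max'_mem h) x h1 (by omega)

/-- shifting a sum over `[1,K]` of a 1-bounded function -/
lemma shift_sum (F : ℤ → ℂ) (hF : ∀ x, ‖F x‖ ≤ 1) (K : ℕ) (s : ℤ) :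
    ‖∑ y ∈ IC K, F y - ∑ y ∈ IC K, F (y + s)‖ ≤ 2 * |(s:ℝ)| := by
  have step : ∀ s : ℤ, ‖∑ y ∈ IC K, F (y + s) - ∑ y ∈ IC K, F (y + (s + 1))‖ ≤ 2 := by
    intro s
    have : IC K = Ico (1:ℤ) (K + 1) := by ext x; simp
    rw [this, ← norm_neg, neg_sub, ← sum_sub_distrib]
    have := tele_Ico (fun t => F (t + s)) 1 (K + 1) (by omega)
    simp only [add_assoc, add_comm (1:ℤ) s] at this ⊢
    rw [this]
    refine (norm_sub_le _ _).trans ?_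
    linarith [hF ((K:ℤ) + (s + 1)), hF (s + 1)]
  have key : ∀ n : ℕ, ∀ s : ℤ, ‖∑ y ∈ IC K, F (y + s) - ∑ y ∈ IC K, F (y + (s + n))‖ ≤ 2 * n := by
    intro n
    induction n with
    | zero => intro s; simp
    | succ n ih =>
      intro s
      have h1 := ih s
      have h2 := step (s + n)
      push_cast
      rw [← add_assoc s]
      refine (norm_sub_le_norm_sub_add_norm_sub _ (∑ y ∈ IC K, F (y + (s + n))) _).trans ?_
      linarith
  rcases le_total 0 s with h | h
  · have := key s.toNat 0
    rw [Int.toNat_of_nonneg h] at this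
    have e : ((s.toNat : ℕ) : ℝ) = |(s:ℝ)| := by
      rw [abs_of_nonneg (by exact_mod_cast h)]; exact_mod_cast Int.toNat_of_nonneg h
    rw [e] at this
    simpa using this
  · have := key (-s).toNat s
    rw [Int.toNat_of_nonneg (by omega)] at this
    have e : (((-s).toNat : ℕ) : ℝ) = |(s:ℝ)| := by
      rw [abs_of_nonpos (by exact_mod_cast h)]; exact_mod_cast Int.toNat_of_nonneg (by omega : 0 ≤ -s)
    rw [e, norm_sub_rev] at this
    simpa using this

lemma norm_sq_sum_eq {ι : Type*} (T : Finset ι) (b : ι → ℂ) :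
    ((‖∑ i ∈ T, b i‖ ^ 2 : ℝ) : ℂ) = ∑ i ∈ T, ∑ i' ∈ T, b i * (starRingEnd ℂ) (b i') := by
  rw [← sum_mul_sum, ← map_sum]
  push_cast; rw [Complex.mul_conj']

lemma swap22 {a b c d : Type*} (s : Finset a) (t : Finset b) (u : Finset c) (v : Finset d)
    (F : a → b → c → d → ℂ) : ∑ y ∈ s, ∑ x ∈ t, ∑ i ∈ u, ∑ j ∈ v, F y x i j =
      ∑ i ∈ u, ∑ j ∈ v, ∑ y ∈ s, ∑ x ∈ t, F y x i j := by
  calc _ = ∑ y ∈ s, ∑ i ∈ u, ∑ x ∈ t, ∑ j ∈ v, F y x i j := sum_congr rfl fun _ _ => sum_comm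
    _ = ∑ i ∈ u, ∑ y ∈ s, ∑ x ∈ t, ∑ j ∈ v, F y x i j := sum_comm
    _ = ∑ i ∈ u, ∑ y ∈ s, ∑ j ∈ v, ∑ x ∈ t, F y x i j :=
      sum_congr rfl fun _ _ => sum_congr rfl fun _ _ => sum_comm
    _ = _ := sum_congr rfl fun _ _ => sum_comm

/-- Cauchy-Schwarz in counting form -/
lemma cs_card {ι : Type*} (s : Finset ι) (F : ι → ℝ) (a b : ℝ) (ha : a ≤ ∑ i ∈ s, F i) (h0 : 0 ≤ a)
    (hb : (s.card : ℝ) ≤ b) : a ^ 2 ≤ b * ∑ i ∈ s, F i ^ 2 := by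
  have h1 := sq_sum_le_card_mul_sum_sq (s := s) (f := F)
  have h2 : a ^ 2 ≤ (∑ i ∈ s, F i) ^ 2 := by gcongr
  have h3 : (0:ℝ) ≤ ∑ i ∈ s, F i ^ 2 := by positivity
  nlinarith

lemma vdc {ι X P : Type*} [Fintype X] (K : ℕ) (Q E : ℝ) (Ps : Finset P) (T : Finset ι) (s : ι → ℤ)
    (hs : ∀ i ∈ T, |(s i : ℝ)| ≤ E) (A : P → X → ℂ) (B : P → X → ℤ → ℂ)
    (hA : ∀ p x, ‖A p x‖ ≤ 1) (hB : ∀ p x y, ‖B p x y‖ ≤ 1) (hQ : 0 < Q) (hE : 4 * E * Q ≤ K)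
    (H : (Fintype.card X : ℝ) * K * Ps.card ≤ Q * ∑ p ∈ Ps, ‖∑ y ∈ IC K, ∑ x, A p x * B p x y‖) :
    (Fintype.card X : ℝ) * K * Ps.card * T.card ^ 2 ≤
      4 * Q ^ 2 * ∑ p ∈ Ps, ∑ y ∈ IC K, ∑ x, ‖∑ i ∈ T, B p x (y + s i)‖ ^ 2 := by
  set n : ℝ := (Ps.card : ℝ)
  set c : ℝ := (Fintype.card X : ℝ)
  set t : ℝ := (T.card : ℝ)
  have hn : 0 ≤ n := by positivity
  have hc : 0 ≤ c := by positivity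
  have ht : 0 ≤ t := by positivity
  have h1 : ∀ p, t * ‖∑ y ∈ IC K, ∑ x, A p x * B p x y‖ ≤
      2 * E * c * t + ∑ y ∈ IC K, ∑ x, ‖∑ i ∈ T, B p x (y + s i)‖ := by
    intro p
    set S := ∑ y ∈ IC K, ∑ x, A p x * B p x y
    have h2 : ∀ i ∈ T, ‖S - ∑ y ∈ IC K, ∑ x, A p x * B p x (y + s i)‖ ≤ 2 * E * c := by
      intro i hi
      simp only [S]
      rw [sum_comm, sum_comm (s := IC K), ← sum_sub_distrib]
      refine (norm_sum_le _ _).trans ?_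
      have : ∀ x ∈ (univ : Finset X), ‖∑ y ∈ IC K, A p x * B p x y -
          ∑ y ∈ IC K, A p x * B p x (y + s i)‖ ≤ 2 * E := by
        intro x _
        refine (shift_sum (fun y => A p x * B p x y) (fun y => ?_) K (s i)).trans ?_
        · rw [norm_mul]; exact mul_le_one₀ (hA p x) (norm_nonneg _) (hB p x y)
        · linarith [hs i hi]
      refine (sum_le_sum this).trans (le_of_eq ?_)
      simp [c]; ring
    have h3 : (t : ℂ) * S = ∑ i ∈ T, (S - ∑ y ∈ IC K, ∑ x, A p x * B p x (y + s i)) +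
        ∑ y ∈ IC K, ∑ x, A p x * ∑ i ∈ T, B p x (y + s i) := by
      rw [sum_sub_distrib]; simp only [sum_const, nsmul_eq_mul, mul_sum]
      rw [sum_comm (s := T)]
      simp only [sum_comm (s := T)]
      simp [t]
    have h4 : t * ‖S‖ = ‖(t : ℂ) * S‖ := by
      rw [norm_mul, Complex.norm_real, Real.norm_of_nonneg ht]
    rw [h4, h3]
    refine (norm_add_le _ _).trans (add_le_add ?_ ?_)
    · refine (norm_sum_le _ _).trans ((sum_le_sum h2).trans (le_of_eq ?_))
      simp [t]; ring
    · refine (norm_sum_le _ _).trans (sum_le_sum fun y _ => ?_)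
      refine (norm_sum_le _ _).trans (sum_le_sum fun x _ => ?_)
      rw [norm_mul]
      exact mul_le_of_le_one_left (norm_nonneg _) (hA p x)
  have h5 := sum_le_sum (s := Ps) fun p _ => h1 p
  rw [← mul_sum, sum_add_distrib] at h5
  simp only [sum_const, nsmul_eq_mul] at h5
  set W := ∑ p ∈ Ps, ‖∑ y ∈ IC K, ∑ x, A p x * B p x y‖
  set Z := ∑ p ∈ Ps, ∑ y ∈ IC K, ∑ x, ‖∑ i ∈ T, B p x (y + s i)‖ with hZ
  set R := ∑ p ∈ Ps, ∑ y ∈ IC K, ∑ x, ‖∑ i ∈ T, B p x (y + s i)‖ ^ 2 with hR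
  have hR0 : 0 ≤ R := by positivity
  have h6 : c * K * n * t ≤ 2 * Q * Z := by
    have h7 : c * K * n * t ≤ Q * (t * W) := by nlinarith
    have h8 : Q * (t * W) ≤ Q * (n * (2 * E * c * t) + Z) := by gcongr
    have h9 : (4 * E * Q) * (n * c * t) ≤ K * (n * c * t) := by gcongr
    nlinarith
  have h7 : (c * K * n * t / (2 * Q)) ^ 2 ≤ (n * K * c) * R := by
    have hZ' : Z = ∑ a ∈ Ps ×ˢ ((IC K) ×ˢ univ), ‖∑ i ∈ T, B a.1 a.2.2 (a.2.1 + s i)‖ := by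
      rw [sum_product, hZ]; refine sum_congr rfl fun p _ => ?_; rw [sum_product]
    have hR' : R = ∑ a ∈ Ps ×ˢ ((IC K) ×ˢ univ), ‖∑ i ∈ T, B a.1 a.2.2 (a.2.1 + s i)‖ ^ 2 := by
      rw [sum_product, hR]; refine sum_congr rfl fun p _ => ?_; rw [sum_product]
    rw [hR']
    apply cs_card
    · rw [← hZ', div_le_iff₀ (by positivity)]; linarith
    · positivity
    · simp [n, c]; ring_nf; rfl
  rw [div_pow, div_le_iff₀ (by positivity)] at h7
  rcases (show 0 ≤ c * K * n by positivity).eq_or_lt with h | h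
  · rw [← h]; simp; positivity
  · have : (c * K * n) * (c * K * n * t ^ 2) ≤ (c * K * n) * (4 * Q ^ 2 * R) := by nlinarith
    exact cL this h

lemma vdc_pair {ι X P : Type*} [Fintype X] (K : ℕ) (Q E : ℝ) (Ps : Finset P) (T : Finset ι) (s : ι → ℤ)
    (hs : ∀ i ∈ T, |(s i : ℝ)| ≤ E) (A : P → X → ℂ) (B : P → X → ℤ → ℂ)
    (hA : ∀ p x, ‖A p x‖ ≤ 1) (hB : ∀ p x y, ‖B p x y‖ ≤ 1) (hQ : 0 < Q) (hE : 4 * E * Q ≤ K)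
    (H : (Fintype.card X : ℝ) * K * Ps.card ≤ Q * ∑ p ∈ Ps, ‖∑ y ∈ IC K, ∑ x, A p x * B p x y‖) :
    (Fintype.card X : ℝ) * K * (Ps ×ˢ (T ×ˢ T)).card ≤
      (4 * Q ^ 2) * ∑ p ∈ Ps ×ˢ (T ×ˢ T), ‖∑ y ∈ IC K, ∑ x,
        B p.1 x (y + s p.2.1) * (starRingEnd ℂ) (B p.1 x (y + s p.2.2))‖ := by
  have h := vdc K Q E Ps T s hs A B hA hB hQ hE H
  rw [card_product, card_product]; push_cast
  refine (le_of_eq (by ring)).trans (h.trans ?_)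
  gcongr
  rw [sum_product]
  refine sum_le_sum fun p _ => ?_
  rw [sum_product]; dsimp only
  have h1 : ((∑ y ∈ IC K, ∑ x, ‖∑ i ∈ T, B p x (y + s i)‖ ^ 2 : ℝ) : ℂ) =
      ∑ i ∈ T, ∑ i' ∈ T, ∑ y ∈ IC K, ∑ x, B p x (y + s i) * (starRingEnd ℂ) (B p x (y + s i')) := by
    rw [Complex.ofReal_sum]
    simp only [Complex.ofReal_sum, norm_sq_sum_eq]
    exact swap22 _ _ _ _ _
  have h2 : (0:ℝ) ≤ ∑ y ∈ IC K, ∑ x, ‖∑ i ∈ T, B p x (y + s i)‖ ^ 2 := by positivity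
  rw [← Real.norm_of_nonneg h2, ← Complex.norm_real, h1]
  refine (norm_sum_le _ _).trans (sum_le_sum fun i _ => norm_sum_le _ _)

noncomputable def ch {n : ℕ} [NeZero n] (j x : ZMod n) : ℂ := ZMod.stdAddChar (j * x)

section
variable {n : ℕ} [NeZero n]

lemma ch_add (j x y : ZMod n) : ch j (x + y) = ch j x * ch j y := by
  unfold ch; rw [mul_add, AddChar.map_add_eq_mul]

lemma ch_int (j : ZMod n) (m : ℤ) : ch j (m : ZMod n) = ee (j.val / n * m) := by
  unfold ch
  have : j * (m : ZMod n) = (((j.val : ℤ) * m : ℤ) : ZMod n) := by push_cast; simp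
  rw [this, ZMod.stdAddChar_coe]; unfold ee; congr 1; push_cast; ring

lemma ch_eq (j x : ZMod n) : ch j x = ee (j.val / n * x.val) := by
  have := ch_int j (x.val : ℤ)
  simpa using this

lemma norm_ch (j x : ZMod n) : ‖ch j x‖ = 1 := by rw [ch_eq, norm_ee]

lemma ch_neg (j x : ZMod n) : ch j (-x) = (starRingEnd ℂ) (ch j x) := by
  have h : ch j x * ch j (-x) = 1 := by rw [← ch_add]; simp [ch]
  have h2 : ch j x * (starRingEnd ℂ) (ch j x) = 1 := by
    rw [Complex.mul_conj', norm_ch]; norm_num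
  have h3 : ch j x ≠ 0 := by intro h0; simp [h0] at h
  exact mul_left_cancel₀ h3 (h.trans h2.symm)

lemma sum_ch (x : ZMod n) : ∑ j, ch j x = if x = 0 then (n : ℂ) else 0 := by
  have := AddChar.sum_mulShift x (ZMod.isPrimitive_stdAddChar n)
  simpa [ch, ZMod.card] using this

/-- Parseval -/
lemma parseval (G : ZMod n → ℂ) : ∑ j, ‖∑ x, G x * ch j x‖ ^ 2 = n * ∑ x, ‖G x‖ ^ 2 := by
  have h : ((∑ j, ‖∑ x, G x * ch j x‖ ^ 2 : ℝ) : ℂ) = ((n * ∑ x, ‖G x‖ ^ 2 : ℝ) : ℂ) := by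
    rw [Complex.ofReal_sum]
    simp only [norm_sq_sum_eq]
    rw [sum_comm]
    have : ∀ x : ZMod n, ∑ j : ZMod n, ∑ i', G x * ch j x * (starRingEnd ℂ) (G i' * ch j i') =
        n * (‖G x‖ ^ 2 : ℝ) := by
      intro x
      rw [sum_comm]
      have : ∀ i' : ZMod n, ∑ j : ZMod n, G x * ch j x * (starRingEnd ℂ) (G i' * ch j i') =
          if i' = x then (n * (‖G x‖ ^ 2 : ℝ) : ℂ) else 0 := by
        intro i'
        have e : ∀ j : ZMod n, G x * ch j x * (starRingEnd ℂ) (G i' * ch j i') =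
            (G x * (starRingEnd ℂ) (G i')) * ch j (x - i') := by
          intro j; rw [map_mul, ← ch_neg, sub_eq_add_neg, ch_add]; ring
        simp only [e]
        rw [← mul_sum, sum_ch]
        by_cases hx : i' = x
        · subst hx; simp; rw [Complex.mul_conj']; ring
        · rw [if_neg hx, if_neg (fun h0 => hx (sub_eq_zero.1 h0).symm), mul_zero]
      rw [sum_congr rfl fun i' _ => this i']; simp
    rw [sum_congr rfl fun x _ => this x]
    push_cast; rw [mul_sum]
  exact_mod_cast h

/-- L2 convolution bound -/
lemma conv_bound (A B : ZMod n → ℂ) (m : ℝ) (hm : ∀ j, ‖∑ x, A x * ch j x‖ ≤ m) :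
    ∑ w, ‖∑ x, A (w + x) * B x‖ ^ 2 ≤ m ^ 2 * ∑ x, ‖B x‖ ^ 2 := by
  have hn : (0:ℝ) < n := by exact_mod_cast NeZero.pos n
  have key : ∀ j : ZMod n, ∑ w, (∑ x, A (w + x) * B x) * ch j w =
      (∑ x, A x * ch j x) * ∑ x, B (-x) * ch j x := by
    intro j
    simp only [sum_mul]
    rw [sum_comm]
    have : ∀ x : ZMod n, ∑ w, A (w + x) * B x * ch j w = (∑ w, A w * ch j w) * (B x * ch j (-x)) := by
      intro x
      rw [← Equiv.sum_comp (Equiv.subRight x), sum_mul]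
      refine sum_congr rfl fun w _ => ?_
      simp only [Equiv.subRight_apply, sub_add_cancel]
      rw [sub_eq_add_neg, ch_add]; ring
    simp only [this]
    rw [← mul_sum, sum_mul, ← Equiv.sum_comp (Equiv.neg (ZMod n)) (fun x => B x * ch j (-x)), ← sum_mul, ← sum_mul]
    simp
  have h1 := parseval (fun w => ∑ x, A (w + x) * B x)
  have h2 := parseval (fun x => B (-x))
  have h3 : ∑ x, ‖B (-x)‖ ^ 2 = ∑ x, ‖B x‖ ^ 2 := Equiv.sum_comp (Equiv.neg (ZMod n)) (fun x => ‖B x‖ ^ 2)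
  have h4 : ∑ j : ZMod n, ‖∑ w, (∑ x, A (w + x) * B x) * ch j w‖ ^ 2 ≤
      m ^ 2 * ∑ j : ZMod n, ‖∑ x, B (-x) * ch j x‖ ^ 2 := by
    rw [mul_sum]
    refine sum_le_sum fun j _ => ?_
    rw [key, norm_mul, mul_pow]
    gcongr; exact hm j
  rw [h1, h2, h3] at h4
  nlinarith
end

/-- embedding of a finite sequence -/
lemma sum_zmod_range (n : ℕ) [NeZero n] (F : ZMod n → ℂ) : ∑ x, F x = ∑ t ∈ range n, F (t : ZMod n) := by
  symm
  refine sum_bij' (fun (t : ℕ) _ => (t : ZMod n)) (fun x _ => x.val) ?_ ?_ ?_ ?_ ?_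
  · simp
  · intro x _; simpa using ZMod.val_lt x
  · intro t ht; exact ZMod.val_cast_of_lt (by simpa using ht)
  · intro x _; simp
  · simp

lemma sum_zmod_rangeR (n : ℕ) [NeZero n] (F : ZMod n → ℝ) : ∑ x, F x = ∑ t ∈ range n, F (t : ZMod n) := by
  have := sum_zmod_range n (fun x => (F x : ℂ))
  exact_mod_cast this

lemma PLint (L R : ℕ) (hL : 0 < L) (A B : ℕ → ℂ) (m : ℝ)
    (hm : ∀ j ∈ range (L + R), ‖∑ t ∈ range L, A t * ee ((j:ℝ) / (L + R : ℕ) * t)‖ ≤ m) :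
    ∑ w ∈ range R, ‖∑ t ∈ range L, A t * B (t + w)‖ ^ 2 ≤ m ^ 2 * ∑ u ∈ range (L + R), ‖B u‖ ^ 2 := by
  set n := L + R with hn
  have : NeZero n := ⟨by omega⟩
  set A' : ZMod n → ℂ := fun x => if x.val < L then A x.val else 0
  set B' : ZMod n → ℂ := fun x => B x.val
  have hsub : range L ⊆ range n := range_subset_range.2 (by omega)
  have red : ∀ G : ZMod n → ℂ, ∑ x, A' x * G x = ∑ t ∈ range L, A t * G t := by
    intro G
    rw [sum_zmod_range]
    rw [← sum_subset hsub]
    · refine sum_congr rfl fun t ht => ?_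
      have : t < L := by simpa using ht
      simp only [A', ZMod.val_cast_of_lt (show t < n by omega), if_pos this]
    · intro t ht ht'
      have h1 : t < n := by simpa using ht
      have h2 : ¬ t < L := by simpa using ht'
      simp only [A', ZMod.val_cast_of_lt h1, if_neg h2, zero_mul]
  have h1 := conv_bound A' B' m (fun j => by
    rw [red]
    refine le_trans (le_of_eq ?_) (hm j.val (mem_range.2 (ZMod.val_lt j)))
    congr 1
    refine sum_congr rfl fun t _ => ?_
    have := ch_int j (t : ℤ)
    push_cast at this; rw [this])
  rw [← Equiv.sum_comp (Equiv.neg (ZMod n)), sum_zmod_rangeR, sum_zmod_rangeR] at h1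
  have h2 : ∑ u ∈ range n, ‖B' (u : ZMod n)‖ ^ 2 = ∑ u ∈ range n, ‖B u‖ ^ 2 := by
    refine sum_congr rfl fun u hu => ?_
    simp only [B', ZMod.val_cast_of_lt (show u < n by simpa using hu)]
  rw [h2] at h1
  refine le_trans ?_ h1
  refine le_trans (sum_le_sum (g := fun w : ℕ => ‖∑ x, A' (-(w : ZMod n) + x) * B' x‖ ^ 2) ?_)
    (sum_le_sum_of_subset_of_nonneg (range_subset_range.2 (by omega)) fun _ _ _ => by positivity)
  intro w hw
  have hw' : w < R := by simpa using hw
  refine le_of_eq ?_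
  congr 2
  rw [← Equiv.sum_comp (Equiv.addRight (w : ZMod n))]
  simp only [Equiv.coe_addRight]
  have : ∀ x : ZMod n, A' (-(w : ZMod n) + (x + w)) * B' (x + w) = A' x * B' (x + w) := by
    intro x; congr 2; ring
  simp only [this]
  rw [red]
  refine sum_congr rfl fun t ht => ?_
  have ht' : t < L := by simpa using ht
  have : ((t : ZMod n) + w).val = t + w := by
    rw [← Nat.cast_add]; exact ZMod.val_cast_of_lt (by omega)
  simp only [B', this]

lemma PLex (L R : ℕ) (hL : 0 < L) (A B : ℕ → ℂ) : ∃ θ : ℝ,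
    ∑ w ∈ range R, ‖∑ t ∈ range L, A t * B (t + w)‖ ^ 2 ≤ ‖∑ t ∈ range L, A t * ee (θ * t)‖ ^ 2 * ∑ u ∈ range (L + R), ‖B u‖ ^ 2 := by
  obtain ⟨j, -, hj⟩ := exists_max_image (range (L + R)) (fun j : ℕ => ‖∑ t ∈ range L, A t * ee ((j:ℝ) / (L + R : ℕ) * t)‖)
    ⟨0, mem_range.2 (by omega)⟩
  exact ⟨_, PLint L R hL A B _ hj⟩

lemma AL (I Q : ℕ) (hQ : 2 ≤ Q) (hI : Q ^ 9 ≤ I) (θ : ℝ) (S : Finset ℕ) (hSI : ∀ n ∈ S, n ≤ I)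
    (hS : I ≤ Q * S.card) (hn : ∀ n ∈ S, nd (θ * n) ≤ Q / I) :
    ∃ v : ℕ, 1 ≤ v ∧ v ≤ 2 * Q ∧ nd (v * θ) ≤ Q ^ 12 / I ^ 2 := by
  have hQ9 : 256 * Q ≤ Q ^ 9 := by
    calc 256 * Q = 2 ^ 8 * Q := by norm_num
      _ ≤ Q ^ 8 * Q := by gcongr
      _ = Q ^ 9 := by ring
  have hIpos : 0 < I := by omega
  have hQR : (2:ℝ) ≤ Q := by exact_mod_cast hQ
  have hIR : (0:ℝ) < I := by exact_mod_cast hIpos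
  have hQI : (Q:ℝ) / I ≤ 1 := by
    rw [div_le_one hIR]; exact_mod_cast (show Q ≤ I by omega)
  -- step 1
  obtain ⟨v, hv1, hv2, hv3⟩ : ∃ v : ℕ, 1 ≤ v ∧ v ≤ 2 * Q ∧ nd (v * θ) ≤ 2 * Q / I := by
    obtain ⟨x, hx, y, hy, hne, hxy⟩ := exists_ne_map_eq_of_card_lt_of_maps_to
      (s := S) (t := range (I / (2 * Q) + 1)) (f := fun n => n / (2 * Q)) (by
        rw [card_range]
        have h1 : 2 * Q * (I / (2 * Q)) ≤ I := Nat.mul_div_le _ _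
        by_contra hlt
        push Not at hlt
        have : 2 * (Q * S.card) ≤ 2 * Q * (I / (2 * Q)) + 2 * Q := by
          calc 2 * (Q * S.card) = 2 * Q * S.card := by ring
            _ ≤ 2 * Q * (I / (2 * Q) + 1) := by gcongr
            _ = _ := by ring
        omega) (by
        intro n hn'
        simp only [coe_range, Set.mem_Iio]
        exact Nat.lt_succ_of_le (Nat.div_le_div_right (hSI n hn')))
    wlog hlt : x < y generalizing x y
    · exact this y hy x hx hne.symm hxy.symm (by omega)
    refine ⟨y - x, by omega, ?_, ?_⟩
    · have h1 := Nat.div_add_mod x (2 * Q)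
      have h2 := Nat.div_add_mod y (2 * Q)
      have h3 := Nat.mod_lt y (show 0 < 2 * Q by omega)
      rw [hxy] at h1
      omega
    · rw [Nat.cast_sub hlt.le, sub_mul]
      refine (nd_sub _ _).trans ?_
      have := hn x hx
      have := hn y hy
      rw [mul_comm _ θ, mul_comm _ θ]
      have e : 2 * (Q:ℝ) / I = Q / I + Q / I := by ring
      linarith
  refine ⟨v, hv1, hv2, ?_⟩
  set ψ := (v:ℝ) * θ - round ((v:ℝ) * θ) with hψ
  have hψa : |ψ| = nd (v * θ) := rfl
  rw [← hψa] at hv3 ⊢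
  -- key relation
  have hrel : ∀ n : ℕ, nd (θ * (n % v : ℕ) + (n / v : ℕ) * ψ) = nd (θ * n) := by
    intro n
    have h : (n:ℝ) = v * (n / v : ℕ) + (n % v : ℕ) := by exact_mod_cast (Nat.div_add_mod n v).symm
    generalize n / v = k at *
    generalize n % v = r at *
    rw [← nd_add_int (θ * r + k * ψ) (k * round ((v:ℝ) * θ))]
    congr 1; rw [hψ, h]; push_cast; ring
  set m : ℕ → ℤ := fun n => round (θ * (n % v : ℕ) + (n / v : ℕ) * ψ)
  have hm : ∀ n ∈ S, |θ * (n % v : ℕ) + (n / v : ℕ) * ψ - m n| ≤ Q / I := by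
    intro n hnS
    have := hn n hnS
    rw [← hrel n] at this; exact this
  have hmr : ∀ n ∈ S, m n - round (θ * (n % v : ℕ)) ∈ Icc (-(2 * Q + 2) : ℤ) (2 * Q + 2) := by
    intro n hnS
    have h1 := abs_le.1 (hm n hnS)
    have h2 := abs_le.1 (abs_sub_round (θ * (n % v : ℕ)))
    have h3 : |((n / v : ℕ) : ℝ) * ψ| ≤ 2 * Q := by
      rw [abs_mul, abs_of_nonneg (by positivity)]
      have : ((n / v : ℕ) : ℝ) ≤ I := by exact_mod_cast (Nat.div_le_self n v).trans (hSI n hnS)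
      calc ((n / v : ℕ) : ℝ) * |ψ| ≤ I * (2 * Q / I) := by gcongr
        _ = 2 * Q := by field_simp
    have h4 := abs_le.1 h3
    rw [mem_Icc]
    constructor
    · have : (-(2 * Q + 2) : ℝ) ≤ ((m n - round (θ * (n % v : ℕ)) : ℤ) : ℝ) := by push_cast at *; linarith
      exact_mod_cast this
    · have : ((m n - round (θ * (n % v : ℕ)) : ℤ) : ℝ) ≤ (2 * Q + 2 : ℝ) := by push_cast at *; linarith
      exact_mod_cast this
  -- pigeonhole
  set n0 := I / Q ^ 7 with hn0
  obtain ⟨p, hp, hpc⟩ := exists_le_card_fiber_of_mul_le_card_of_maps_to (n := n0) (s := S)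
    (t := range v ×ˢ Icc (-(2 * Q + 2) : ℤ) (2 * Q + 2))
    (f := fun n => (n % v, m n - round (θ * (n % v : ℕ)))) (by
      intro n hnS
      rw [mem_product]
      exact ⟨by simpa using Nat.mod_lt n hv1, hmr n hnS⟩)
    (⟨(0, 0), by simp; omega⟩) (by
      rw [card_product, card_range, Int.card_Icc]
      have e : ((2 * Q + 2 : ℤ) + 1 - -(2 * Q + 2)).toNat = 4 * Q + 5 := by omega
      rw [e]
      have h1 : v * (4 * Q + 5) ≤ Q ^ 6 := by
        calc v * (4 * Q + 5) ≤ (2 * Q) * (4 * Q + 5) := by gcongr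
          _ ≤ 2 ^ 4 * Q ^ 2 := by nlinarith
          _ ≤ Q ^ 4 * Q ^ 2 := by gcongr
          _ = Q ^ 6 := by ring
      have h2 : Q ^ 7 * n0 ≤ I := Nat.mul_div_le _ _
      have h3 : Q * (v * (4 * Q + 5) * n0) ≤ Q * S.card := by
        calc Q * (v * (4 * Q + 5) * n0) ≤ Q * (Q ^ 6 * n0) := by gcongr
          _ = Q ^ 7 * n0 := by ring
          _ ≤ _ := h2.trans hS
      exact cL h3 (by omega))
  set W := {x ∈ S | (fun n => (n % v, m n - round (θ * (n % v : ℕ)))) x = p}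
  have hQ7 : 0 < Q ^ 7 := by positivity
  have hn0lt : I < Q ^ 7 * (n0 + 1) := Nat.lt_mul_div_succ I hQ7
  have hn02 : 4 ≤ n0 := by
    rw [hn0, Nat.le_div_iff_mul_le hQ7]
    calc 4 * Q ^ 7 = 2 ^ 2 * Q ^ 7 := by norm_num
      _ ≤ Q ^ 2 * Q ^ 7 := by gcongr
      _ = Q ^ 9 := by ring
      _ ≤ I := hI
  have hWne : W.Nonempty := card_pos.1 (by omega)
  set x := W.min' hWne
  set y := W.max' hWne
  have hxW := W.min'_mem hWne
  have hyW := W.max'_mem hWne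
  have hWsub : W ⊆ Icc x y := fun z hz => mem_Icc.2 ⟨W.min'_le z hz, W.le_max' z hz⟩
  have hxy : n0 ≤ y + 1 - x := by
    have := card_le_card hWsub
    rw [Nat.card_Icc] at this; omega
  have hx := mem_filter.1 hxW
  have hy := mem_filter.1 hyW
  have he : x % v = y % v := by
    have h1 := congrArg Prod.fst hx.2; have h2 := congrArg Prod.fst hy.2; exact h1.trans h2.symm
  have he2 : m x = m y := by
    have h1 := congrArg Prod.snd hx.2; have h2 := congrArg Prod.snd hy.2
    have h3 := h1.trans h2.symm
    simp only [x, y] at he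
    simp only [he] at h3
    simpa using h3
  have h1 := abs_le.1 (hm x hx.1)
  have h2 := abs_le.1 (hm y hy.1)
  rw [he, he2] at h1
  have h3 : |((y / v : ℕ) - (x / v : ℕ) : ℝ) * ψ| ≤ 2 * Q / I := by
    have e : 2 * (Q:ℝ) / I = Q / I + Q / I := by ring
    rw [abs_le, e]; constructor <;> linarith
  have hk : ((n0:ℝ) - 1) ≤ v * (((y / v : ℕ) - (x / v : ℕ) : ℝ)) := by
    have e1 : (x:ℝ) = v * (x / v : ℕ) + (x % v : ℕ) := by exact_mod_cast (Nat.div_add_mod x v).symm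
    have e2 : (y:ℝ) = v * (y / v : ℕ) + (y % v : ℕ) := by exact_mod_cast (Nat.div_add_mod y v).symm
    have e3 : (n0:ℝ) + x ≤ y + 1 := by
      have : n0 + x ≤ y + 1 := by omega
      exact_mod_cast this
    rw [he] at e1
    linarith
  have hn0R : (I:ℝ) ≤ Q ^ 8 * (n0 - 1) := by
    have a1 : (I:ℝ) ≤ Q ^ 7 * (n0 + 1) := by exact_mod_cast hn0lt.le
    have a2 : (4:ℝ) ≤ n0 := by exact_mod_cast hn02
    have a3 : ((n0:ℝ) + 1) ≤ Q * (n0 - 1) := by nlinarith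
    calc (I:ℝ) ≤ Q ^ 7 * (n0 + 1) := a1
      _ ≤ Q ^ 7 * (Q * (n0 - 1)) := by gcongr
      _ = _ := by ring
  have hvR : (v:ℝ) ≤ 2 * Q := by exact_mod_cast hv2
  have hv0 : (0:ℝ) < v := by exact_mod_cast hv1
  set k : ℝ := ((y / v : ℕ) - (x / v : ℕ) : ℝ)
  have hk0 : 0 ≤ k := by
    have a2 : (4:ℝ) ≤ n0 := by exact_mod_cast hn02
    by_contra hneg
    nlinarith
  rw [abs_mul, abs_of_nonneg hk0] at h3
  rw [le_div_iff₀ (by positivity)] at h3 ⊢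
  have hψ0 := abs_nonneg ψ
  calc |ψ| * (I:ℝ) ^ 2 = (|ψ| * I) * I := by ring
    _ ≤ (|ψ| * I) * (Q ^ 8 * (v * k)) := by
      gcongr; exact hn0R.trans (by gcongr)
    _ = Q ^ 8 * v * (k * |ψ| * I) := by ring
    _ ≤ Q ^ 8 * (2 * Q) * (2 * Q) := by gcongr
    _ = 2 ^ 2 * Q ^ 10 := by ring
    _ ≤ (Q:ℝ) ^ 2 * Q ^ 10 := by gcongr
    _ = Q ^ 12 := by ring

lemma AL2 (K A Q : ℕ) (hQ : 2 ≤ Q) (hK : Q ^ 50 ≤ K) (hA : K ≤ Q * A) (hAK : A ≤ K) (φ : ℝ) (b : ℕ → ℕ → ℝ)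
    (hb : ∀ a a', b a a' ≤ K) (hb2 : ∀ a a' : ℕ, b a a' * (2 * nd (φ * (a' - a))) ≤ 1)
    (H : (K:ℝ) * A ^ 2 ≤ Q * ∑ a ∈ range A, ∑ a' ∈ range A, b a a') :
    ∃ v : ℕ, 1 ≤ v ∧ v ≤ Q ^ 50 ∧ nd (v * φ) ≤ Q ^ 50 / K ^ 2 := by
  have hQR : (2:ℝ) ≤ Q := by exact_mod_cast hQ
  have hA49 : Q ^ 49 ≤ A := by
    have : Q * Q ^ 49 ≤ Q * A := by
      calc Q * Q ^ 49 = Q ^ 50 := by ring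
        _ ≤ _ := hK.trans hA
    exact cL this (by omega)
  have hQA : 2 ^ 48 * Q ≤ A := by
    calc 2 ^ 48 * Q ≤ Q ^ 48 * Q := by gcongr
      _ = Q ^ 49 := by ring
      _ ≤ A := hA49
  have hApos : (0:ℝ) < A := by exact_mod_cast (show 0 < A by omega)
  have hKpos : (0:ℝ) < K := by exact_mod_cast (show 0 < K by omega)
  obtain ⟨a, ha, hS1⟩ : ∃ a ∈ range A, (K:ℝ) * A / Q ≤ ∑ a' ∈ range A, b a a' := by
    apply exists_le_of_sum_le (by simp; omega)
    rw [sum_const, card_range, nsmul_eq_mul]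
    have : (A:ℝ) * (K * A / Q) = (K * A ^ 2) / Q := by ring
    rw [this, div_le_iff₀ (by positivity)]; linarith
  set G := {a' ∈ range A | (K:ℝ) / (2 * Q) ≤ b a a'} with hG
  have hGc : (A:ℝ) ≤ 2 * Q * G.card := by
    have h1 : ∑ a' ∈ range A, b a a' ≤ ∑ a' ∈ range A, ((if (K:ℝ) / (2 * Q) ≤ b a a' then (K:ℝ) else 0) + K / (2 * Q)) := by
      refine sum_le_sum fun a' _ => ?_
      split_ifs with h
      · have : (0:ℝ) ≤ K / (2 * Q) := by positivity
        linarith [hb a a']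
      · push Not at h; linarith
    rw [sum_add_distrib, ← sum_filter, sum_const, sum_const, card_range, nsmul_eq_mul, nsmul_eq_mul] at h1
    have h2 := hS1.trans h1
    have h3 : (K:ℝ) * A / Q = 2 * (A * (K / (2 * Q))) := by field_simp
    rw [h3] at h2
    have h4 : (A * (K / (2 * Q)) : ℝ) ≤ G.card * K := by linarith
    have h5 : (A * (K / (2 * Q)) : ℝ) = A / (2 * Q) * K := by ring
    rw [h5] at h4
    have h6 := le_of_mul_le_mul_right h4 hKpos
    rw [div_le_iff₀ (by positivity)] at h6; linarith
  set S := {n ∈ Icc (1:ℕ) A | nd (φ * (n:ℕ)) ≤ Q / K} with hSdef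
  have hGS : G ⊆ insert a (S.image (a + ·) ∪ S.image (a - ·)) := by
    intro a' ha'
    rw [hG, mem_filter, mem_range] at ha'
    rw [mem_range] at ha
    have hnd : nd (φ * ((a':ℝ) - a)) ≤ Q / K := by
      rw [le_div_iff₀ hKpos]
      have h1 := hb2 a a'
      have h2 : (K:ℝ) / (2 * Q) * (2 * nd (φ * (a' - a))) ≤ 1 :=
        (mR ha'.2 (by linarith [nd_nonneg (φ * ((a':ℝ) - a))])).trans h1
      have h3 : (K:ℝ) / (2 * Q) * (2 * nd (φ * (a' - a))) = nd (φ * (a' - a)) * K / Q := by field_simp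
      rw [h3, div_le_one (by positivity)] at h2
      exact h2
    simp only [mem_insert, mem_union, mem_image]
    rcases lt_trichotomy a' a with h | h | h
    · right; right
      refine ⟨a - a', ?_, by omega⟩
      rw [hSdef, mem_filter, mem_Icc]
      refine ⟨by omega, ?_⟩
      rw [Nat.cast_sub h.le, ← nd_neg]
      convert hnd using 2; ring
    · left; exact h
    · right; left
      refine ⟨a' - a, ?_, by omega⟩
      rw [hSdef, mem_filter, mem_Icc]
      refine ⟨by omega, ?_⟩
      rw [Nat.cast_sub h.le]; exact hnd
  have hGS2 : G.card ≤ 2 * S.card + 1 := by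
    refine (card_le_card hGS).trans ((card_insert_le _ _).trans ?_)
    have := card_union_le (S.image (a + ·)) (S.image (a - ·))
    have := card_image_le (s := S) (f := (a + ·))
    have := card_image_le (s := S) (f := (a - ·))
    omega
  have hGc' : A ≤ 2 * Q * G.card := by exact_mod_cast hGc
  have hSc : A ≤ Q ^ 4 * S.card := by
    have h1 : A ≤ 2 * Q * (2 * S.card + 1) := hGc'.trans (by gcongr)
    have h2 : A ≤ 8 * (Q * S.card) := by nlinarith
    calc A ≤ 8 * (Q * S.card) := h2
      _ = 2 ^ 3 * Q * S.card := by ring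
      _ ≤ Q ^ 3 * Q * S.card := by gcongr
      _ = _ := by ring
  have hQ4 : Q ≤ Q ^ 4 := nsp (by norm_num) Q
  obtain ⟨v, hv1, hv2, hv3⟩ := AL A (Q ^ 4) (by omega) (by
      rw [← pow_mul]; exact (npR (by omega) (by norm_num)).trans hA49) φ S
    (fun n hn => (mem_Icc.1 (mem_filter.1 hn).1).2) hSc (fun n hn => by
      refine (mem_filter.1 hn).2.trans ?_
      push_cast
      have : (Q:ℝ) ≤ Q ^ 4 := by exact_mod_cast hQ4
      have : (A:ℝ) ≤ K := by exact_mod_cast hAK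
      gcongr)
  refine ⟨v, hv1, hv2.trans ?_, hv3.trans ?_⟩
  · calc 2 * Q ^ 4 ≤ Q ^ 46 * Q ^ 4 := by
          gcongr
          exact hQ.trans (nsp (by norm_num) Q)
      _ = Q ^ 50 := by ring
  · have h1 : (K:ℝ) ≤ Q * A := by exact_mod_cast hA
    push_cast
    rw [div_le_div_iff₀ (by positivity) (by positivity)]
    calc ((Q:ℝ) ^ 4) ^ 12 * K ^ 2 ≤ ((Q:ℝ) ^ 4) ^ 12 * (Q * A) ^ 2 := by gcongr
      _ = _ := by ring

section
variable {M : ℕ} [NeZero M]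

noncomputable def Lam (K : ℕ) (f g h : ZMod M → ℂ) : ℂ :=
  ∑ y ∈ IC K, ∑ x, f x * g (x + (y : ZMod M)) * h (x + (y : ZMod M) ^ 2)

noncomputable def Q4 (h : ZMod M → ℂ) (U V W : ZMod M) : ℂ :=
  ∑ x, h x * conj (h (x + U)) * conj (h (x + V)) * h (x + U + V + W)

lemma shiftZ (F : ZMod M → ℂ) (a : ZMod M) : ∑ x, F (x + a) = ∑ x, F x :=
  Equiv.sum_comp (Equiv.addRight a) F

lemma bd_mul {a b : ℂ} (ha : ‖a‖ ≤ 1) (hb : ‖b‖ ≤ 1) : ‖a * b‖ ≤ 1 := by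
  rw [norm_mul]; exact mul_le_one₀ ha (norm_nonneg _) hb

lemma bd_conj {a : ℂ} (ha : ‖a‖ ≤ 1) : ‖conj a‖ ≤ 1 := by rwa [RCLike.norm_conj]

lemma first_vdc {ι : Type*} (K : ℕ) (Q E : ℝ) (f g h : ZMod M → ℂ) (hf : ∀ x, ‖f x‖ ≤ 1) (hg : ∀ x, ‖g x‖ ≤ 1)
    (hh : ∀ x, ‖h x‖ ≤ 1) (T : Finset ι) (s : ι → ℤ) (hs : ∀ i ∈ T, |(s i : ℝ)| ≤ E) (hQ : 0 < Q)
    (hE : 4 * E * Q ≤ K) (H : (M:ℝ) * K ≤ Q * ‖Lam K f g h‖) :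
    (M:ℝ) * K * (T ×ˢ T).card ≤ (4 * Q ^ 2) * ∑ p ∈ T ×ˢ T, ‖∑ y ∈ IC K, ∑ x,
      (g x * conj (g (x + (zc M (s p.2 - s p.1))))) *
      (h (x - (zc M (y + s p.1)) + (zc M (y + s p.1)) ^ 2) *
        conj (h (x - (zc M (y + s p.1)) + (zc M (y + s p.2)) ^ 2)))‖ := by
  have h1 := vdc_pair (X := ZMod M) K Q E ({()} : Finset Unit) T s hs (fun _ x => f x)
    (fun _ x y => g (x + (y : ZMod M)) * h (x + (y : ZMod M) ^ 2)) (fun _ x => hf x)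
    (fun _ x y => bd_mul (hg _) (hh _)) hQ hE (by
      rw [ZMod.card]; simpa [Lam, mul_assoc] using H)
  rw [ZMod.card, sum_product] at h1
  simp only [card_product, card_singleton, one_mul, sum_singleton] at h1 ⊢
  refine h1.trans (le_of_eq ?_)
  congr 1
  refine sum_congr rfl fun p _ => ?_
  congr 1
  refine sum_congr rfl fun y _ => ?_
  rw [← shiftZ _ (-(zc M (y + s p.1)))]
  refine sum_congr rfl fun x _ => ?_
  rw [map_mul]
  have e1 : x + -(zc M (y + s p.1)) + (zc M (y + s p.1)) = x := by ring
  have e2 : x + -(zc M (y + s p.1)) + (zc M (y + s p.2)) =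
    x + (zc M (s p.2 - s p.1)) := by push_cast; ring
  rw [e1, e2, ← sub_eq_add_neg]; ring

lemma T4 {ι κ : Type*} (K : ℕ) (Q E : ℝ) (f g h : ZMod M → ℂ) (hf : ∀ x, ‖f x‖ ≤ 1) (hg : ∀ x, ‖g x‖ ≤ 1)
    (hh : ∀ x, ‖h x‖ ≤ 1) (T : Finset ι) (s : ι → ℤ) (hs : ∀ i ∈ T, |(s i : ℝ)| ≤ E)
    (T' : Finset κ) (s' : κ → ℤ) (hs' : ∀ i ∈ T', |(s' i : ℝ)| ≤ E) (hQ : 1 ≤ Q)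
    (hE0 : 0 ≤ E) (hE : 16 * E * Q ^ 2 ≤ K) (H : (M:ℝ) * K ≤ Q * ‖Lam K f g h‖) :
    (M:ℝ) * K * ((T ×ˢ T) ×ˢ (T' ×ˢ T')).card ≤ (64 * Q ^ 4) *
      ∑ p ∈ (T ×ˢ T) ×ˢ (T' ×ˢ T'), ‖∑ y ∈ IC K,
        Q4 h (zc M (2 * (s p.1.2 - s p.1.1) * (y + s p.1.1 + s' p.2.1) + (s p.1.2 - s p.1.1) ^ 2))
          (zc M (2 * (s' p.2.2 - s' p.2.1) * (y + s p.1.1 + s' p.2.1) + (s' p.2.2 - s' p.2.1) ^ 2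
            - (s' p.2.2 - s' p.2.1)))
          (zc M (2 * (s p.1.2 - s p.1.1) * (s' p.2.2 - s' p.2.1)))‖ := by
  have h1 := first_vdc K Q E f g h hf hg hh T s hs (by linarith) (by nlinarith) H
  have h2 := vdc_pair (X := ZMod M) K (4 * Q ^ 2) E (T ×ˢ T) T' s' hs'
    (fun p x => g x * conj (g (x + (zc M (s p.2 - s p.1)))))
    (fun p x y => h (x - (zc M (y + s p.1)) + (zc M (y + s p.1)) ^ 2) *
        conj (h (x - (zc M (y + s p.1)) + (zc M (y + s p.2)) ^ 2)))
    (fun p x => bd_mul (hg _) (bd_conj (hg _))) (fun p x y => bd_mul (hh _) (bd_conj (hh _)))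
    (by positivity) (by linarith) (by rw [ZMod.card]; exact h1)
  rw [ZMod.card] at h2
  refine h2.trans (le_of_eq ?_)
  have e : 4 * (4 * Q ^ 2) ^ 2 = 64 * Q ^ 4 := by ring
  rw [e]; congr 1
  refine sum_congr rfl fun p _ => ?_
  congr 1
  refine sum_congr rfl fun y _ => ?_
  unfold Q4
  set z : ZMod M := (zc M (y + s p.1.1 + s' p.2.1)) with hz
  rw [← shiftZ _ (z - z ^ 2)]
  refine sum_congr rfl fun x _ => ?_
  rw [map_mul, Complex.conj_conj]
  have e1 : x + (z - z ^ 2) - (zc M (y + s' p.2.1 + s p.1.1)) + (zc M (y + s' p.2.1 + s p.1.1)) ^ 2 = x := by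
    rw [hz]; push_cast; ring
  rw [e1]
  have e2 : x + (z - z ^ 2) - (zc M (y + s' p.2.1 + s p.1.1)) + (zc M (y + s' p.2.1 + s p.1.2)) ^ 2 =
    x + (zc M (2 * (s p.1.2 - s p.1.1) * (y + s p.1.1 + s' p.2.1) + (s p.1.2 - s p.1.1) ^ 2)) := by
    rw [hz]; push_cast; ring
  have e3 : x + (z - z ^ 2) - (zc M (y + s' p.2.2 + s p.1.1)) + (zc M (y + s' p.2.2 + s p.1.1)) ^ 2 =
    x + (zc M (2 * (s' p.2.2 - s' p.2.1) * (y + s p.1.1 + s' p.2.1) + (s' p.2.2 - s' p.2.1) ^ 2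
            - (s' p.2.2 - s' p.2.1))) := by
    rw [hz]; push_cast; ring
  have e4 : x + (z - z ^ 2) - (zc M (y + s' p.2.2 + s p.1.1)) + (zc M (y + s' p.2.2 + s p.1.2)) ^ 2 =
    x + (zc M (2 * (s p.1.2 - s p.1.1) * (y + s p.1.1 + s' p.2.1) + (s p.1.2 - s p.1.1) ^ 2)) +
    (zc M (2 * (s' p.2.2 - s' p.2.1) * (y + s p.1.1 + s' p.2.1) + (s' p.2.2 - s' p.2.1) ^ 2
            - (s' p.2.2 - s' p.2.1))) +
    (zc M (2 * (s p.1.2 - s p.1.1) * (s' p.2.2 - s' p.2.1))) := by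
    rw [hz]; push_cast; ring
  rw [e2, e3, e4]; ring

lemma norm_Q4_le (h : ZMod M → ℂ) (hh : ∀ x, ‖h x‖ ≤ 1) (U V W : ZMod M) : ‖Q4 h U V W‖ ≤ M := by
  unfold Q4
  refine (norm_sum_le _ _).trans ?_
  refine (slc _ _ 1 fun x _ => ?_).trans (by simp [ZMod.card])
  exact bd_mul (bd_mul (bd_mul (hh _) (bd_conj (hh _))) (bd_conj (hh _))) (hh _)

/-- periodic extension of a function on the integers -/
noncomputable def cyc (M : ℕ) (H : ℤ → ℂ) : ZMod M → ℂ := fun x => H x.val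

lemma cyc_int (H : ℤ → ℂ) (P : ℤ) (hH : ∀ x, H x ≠ 0 → 0 ≤ x ∧ x < P) (m : ℤ) (h1 : P ≤ m + M) (h2 : m < M) :
    cyc M H (m : ZMod M) = H m := by
  unfold cyc
  rw [ZMod.val_intCast]
  rcases le_or_gt 0 m with h | h
  · rw [Int.emod_eq_of_lt h h2]
  · have a1 : H m = 0 := by by_contra hc; have := hH m hc; omega
    have a2 : m % (M:ℤ) = m + M ∨ H (m % M) = 0 := by
      by_cases hc : H (m % M) = 0
      · right; exact hc
      · left
        by_cases hm : 0 ≤ m + M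
        · rw [← Int.add_emod_right, Int.emod_eq_of_lt hm (by omega)]
        · have := hH _ hc; have := Int.emod_nonneg m (show (M:ℤ) ≠ 0 by exact_mod_cast NeZero.ne M); omega
    rcases a2 with a2 | a2
    · rw [a1, a2]; by_contra hc; have := hH _ hc; omega
    · rw [a1, a2]

lemma sum_zmod_Ico {α : Type*} [AddCommMonoid α] (F : ZMod M → α) (a : ℤ) :
    ∑ x, F x = ∑ n ∈ Ico a (a + M), F (n : ZMod M) := by
  have hM : (0:ℤ) < M := by exact_mod_cast NeZero.pos M
  symm
  refine sum_bij' (fun (t : ℤ) _ => (t : ZMod M)) (fun x _ => a + ((x - (a : ZMod M)).val : ℤ)) ?_ ?_ ?_ ?_ ?_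
  · simp
  · intro x _
    rw [mem_Ico]
    have := ZMod.val_lt (x - (a : ZMod M))
    omega
  · intro t ht
    rw [mem_Ico] at ht
    rw [← Int.cast_sub, ZMod.val_intCast, Int.emod_eq_of_lt (by omega) (by omega)]; ring
  · intro x _; simp
  · intro t _; rfl
end

lemma quad_roots {F : Type*} [Field F] [Fintype F] [DecidableEq F] (a b c : F) (hb : b ≠ 0) :
    (univ.filter fun e : F => a * e ^ 2 + b * e + c = 0).card ≤ 2 := by
  classical
  set p : Polynomial F := Polynomial.C a * Polynomial.X ^ 2 + Polynomial.C b * Polynomial.X + Polynomial.C c with hp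
  have hp0 : p ≠ 0 := by
    intro h
    have : p.coeff 1 = b := by simp [hp, Polynomial.coeff_C]
    rw [h] at this; simp at this; exact hb this.symm
  have h1 : (univ.filter fun e : F => a * e ^ 2 + b * e + c = 0) ⊆ p.roots.toFinset := by
    intro e he
    simp only [mem_filter, mem_univ, true_and] at he
    rw [Multiset.mem_toFinset, Polynomial.mem_roots hp0, Polynomial.IsRoot, hp]
    simpa using he
  refine (card_le_card h1).trans ((Multiset.toFinset_card_le _).trans ((Polynomial.card_roots' p).trans ?_))
  rw [hp]; exact Polynomial.natDegree_quadratic_le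

lemma zinj {l A : ℕ} (hA : A ≤ l) {a b c : ℕ} (ha : a < A) (hb : b < A)
    (h : ((a:ℤ) - c : ZMod l) = ((b:ℤ) - c : ZMod l)) : a = b := by
  have h1 : (a : ZMod l) = (b : ZMod l) := by
    have := congrArg (fun t => t + ((c:ℕ) : ZMod l)) h
    simpa using this
  rw [ZMod.natCast_eq_natCast_iff] at h1
  exact Nat.ModEq.eq_of_lt_of_lt h1 (by omega) (by omega)

lemma fiber_card (l q K A : ℕ) [Fact l.Prime] (hl2 : l ≠ 2) (hlq : l ∣ q) (hA : A ≤ l) (a b : ℕ) (ha : a < A) (hb : b < A)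
    (U V W : ZMod q) :
    ((((range A).filter (· ≠ a)) ×ˢ ((range A).filter (· ≠ b)) ×ˢ IC K).filter fun p =>
      ((2 * ((p.1:ℤ) - a) * (p.2.2 + a + b) + ((p.1:ℤ) - a) ^ 2 : ℤ) : ZMod q) = U ∧
      ((2 * ((p.2.1:ℤ) - b) * (p.2.2 + a + b) + ((p.2.1:ℤ) - b) ^ 2 - ((p.2.1:ℤ) - b) : ℤ) : ZMod q) = V ∧
      ((2 * ((p.1:ℤ) - a) * ((p.2.1:ℤ) - b) : ℤ) : ZMod q) = W).card ≤ 2 * (K / l + 1) := by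
  classical
  have lp : l.Prime := Fact.out
  set φ := ZMod.castHom hlq (ZMod l) with hφ
  set u := φ U with hu
  set v := φ V with hv
  set w := φ W with hw
  have h20 : (2 : ZMod l) ≠ 0 := by
    intro h
    have h2 : ((2:ℕ) : ZMod l) = 0 := by exact_mod_cast h
    rw [ZMod.natCast_eq_zero_iff] at h2
    exact hl2 ((Nat.prime_dvd_prime_iff_eq lp Nat.prime_two).1 h2)
  have key : ∀ p : ℕ × ℕ × ℤ, p.1 < A → p.2.1 < A → p.1 ≠ a → p.2.1 ≠ b →
      ((2 * ((p.1:ℤ) - a) * (p.2.2 + a + b) + ((p.1:ℤ) - a) ^ 2 : ℤ) : ZMod q) = U →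
      ((2 * ((p.2.1:ℤ) - b) * (p.2.2 + a + b) + ((p.2.1:ℤ) - b) ^ 2 - ((p.2.1:ℤ) - b) : ℤ) : ZMod q) = V →
      ((2 * ((p.1:ℤ) - a) * ((p.2.1:ℤ) - b) : ℤ) : ZMod q) = W →
      (((p.1:ℤ) - a : ZMod l) ≠ 0 ∧ ((p.2.1:ℤ) - b : ZMod l) ≠ 0 ∧
       2 * ((p.1:ℤ) - a : ZMod l) * ((p.2.2 : ZMod l) + a + b) + ((p.1:ℤ) - a : ZMod l) ^ 2 = u ∧
       2 * ((p.2.1:ℤ) - b : ZMod l) * ((p.2.2 : ZMod l) + a + b) + ((p.2.1:ℤ) - b : ZMod l) ^ 2 - ((p.2.1:ℤ) - b : ZMod l) = v ∧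
       2 * ((p.1:ℤ) - a : ZMod l) * ((p.2.1:ℤ) - b : ZMod l) = w) := by
    intro p h1 h2 h3 h4 h5 h6 h7
    refine ⟨?_, ?_, ?_, ?_, ?_⟩
    · intro h; exact h3 (zinj (c := a) hA h1 ha (by rw [h]; simp))
    · intro h; exact h4 (zinj (c := b) hA h2 hb (by rw [h]; simp))
    · rw [hu, ← h5, map_intCast]; push_cast; ring
    · rw [hv, ← h6, map_intCast]; push_cast; ring
    · rw [hw, ← h7, map_intCast]; push_cast; ring
  by_cases hw0 : w = 0
  · rw [card_eq_zero.2]; · omega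
    rw [filter_eq_empty_iff]
    rintro p hp ⟨h5, h6, h7⟩
    simp only [mem_product, mem_filter, mem_range] at hp
    obtain ⟨k1, k2, -, -, k5⟩ := key p hp.1.1 hp.2.1.1 hp.1.2 hp.2.1.2 h5 h6 h7
    rw [hw0] at k5
    rcases mul_eq_zero.1 k5 with k | k
    · rcases mul_eq_zero.1 k with k | k
      · exact h20 k
      · exact k1 k
    · exact k2 k
  · have hB : ((univ.filter fun e : ZMod l => (4 * u + 2 * w) * e ^ 2 + (-2 * w) * e + (-(2 * w * v + w ^ 2)) = 0) ×ˢ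
        range (K / l + 1)).card ≤ 2 * (K / l + 1) := by
      rw [card_product, card_range]
      refine nmR _ (quad_roots _ _ _ ?_)
      exact mul_ne_zero (neg_ne_zero.2 h20) hw0
    refine le_trans (card_le_card_of_injOn (fun p => (((p.2.1:ℤ) - b : ZMod l), (p.2.2 / l).toNat)) ?_ ?_) hB
    · intro p hp
      simp only [coe_filter, mem_product, mem_filter, mem_range, Set.mem_ofPred_eq, mem_Icc] at hp
      obtain ⟨⟨⟨p1, p2⟩, ⟨p3, p4⟩, p5, p6⟩, h5, h6, h7⟩ := hp
      obtain ⟨k1, k2, k3, k4, k5⟩ := key p p1 p3 p2 p4 h5 h6 h7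
      simp only [coe_product, Set.mem_prod, mem_coe, mem_filter, mem_univ, true_and, mem_range]
      constructor
      · rw [← k3, ← k4, ← k5]; ring
      · have : p.2.2 / (l:ℤ) ≤ (K / l : ℕ) := by
          push_cast; exact Int.ediv_le_ediv (by exact_mod_cast lp.pos) p6
        exact Nat.lt_succ_of_le (Int.toNat_le.2 this)
    · intro p hp p' hp' he
      simp only [coe_filter, mem_product, mem_filter, mem_range, Set.mem_ofPred_eq, mem_Icc] at hp hp'
      obtain ⟨⟨⟨p1, p2⟩, ⟨p3, p4⟩, p5, p6⟩, h5, h6, h7⟩ := hp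
      obtain ⟨k1, k2, k3, k4, k5⟩ := key p p1 p3 p2 p4 h5 h6 h7
      obtain ⟨⟨⟨p1', p2'⟩, ⟨p3', p4'⟩, p5', p6'⟩, h5', h6', h7'⟩ := hp'
      obtain ⟨k1', k2', k3', k4', k5'⟩ := key p' p1' p3' p2' p4' h5' h6' h7'
      simp only [Prod.mk.injEq] at he
      obtain ⟨he, hy⟩ := he
      have e1 : p.2.1 = p'.2.1 := zinj hA p3 p3' he
      have e2 : p.1 = p'.1 := by
        refine zinj (c := a) hA p1 p1' ?_
        rw [← he] at k5'
        have := k5.trans k5'.symm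
        have := mul_right_cancel₀ k2 this
        exact mul_left_cancel₀ h20 this
      have e3 : (p.2.2 : ZMod l) = (p'.2.2 : ZMod l) := by
        rw [← he] at k4'
        have h := k4.trans k4'.symm
        have h' : 2 * ((p.2.1:ℤ) - b : ZMod l) * (p.2.2 : ZMod l) = 2 * ((p.2.1:ℤ) - b : ZMod l) * (p'.2.2 : ZMod l) := by
          linear_combination h
        exact mul_left_cancel₀ (mul_ne_zero h20 k2) h'
      have e4 : p.2.2 = p'.2.2 := by
        rw [ZMod.intCast_eq_intCast_iff] at e3
        have e3 : p.2.2 % l = p'.2.2 % l := e3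
        have g1 := Int.mul_ediv_add_emod p.2.2 l
        have g2 := Int.mul_ediv_add_emod p'.2.2 l
        have g3 : p.2.2 / (l:ℤ) = p'.2.2 / l := by
          have := Int.ediv_nonneg (show 0 ≤ p.2.2 by omega) (show (0:ℤ) ≤ l by omega)
          have := Int.ediv_nonneg (show 0 ≤ p'.2.2 by omega) (show (0:ℤ) ≤ l by omega)
          omega
        rw [← g1, ← g2, g3, e3]
      exact Prod.ext e2 (Prod.ext e1 e4)

lemma sum_fiber {α β : Type*} [Fintype β] [DecidableEq β] (S : Finset α) (φ : α → β) (F : β → ℝ) (hF : ∀ b, 0 ≤ F b)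
    (B : ℝ) (hB : ∀ b, ((S.filter fun a => φ a = b).card : ℝ) ≤ B) : ∑ a ∈ S, F (φ a) ≤ B * ∑ b, F b := by
  rw [← sum_fiberwise S φ, mul_sum]
  refine sum_le_sum fun b _ => ?_
  rw [sum_congr rfl (g := fun _ => F b) (fun a ha => by rw [(mem_filter.1 ha).2]), sum_const, nsmul_eq_mul]
  exact mR (hB b) (hF b)

lemma size_bd {d e z A K : ℤ} (h1 : |d| ≤ A) (h2 : |e| ≤ A) (h3 : |z| ≤ 2 * K) (hA : 64 * A ≤ K) :
    |2 * d * z + d ^ 2| ≤ K ^ 2 ∧ |2 * e * z + e ^ 2 - e| ≤ K ^ 2 ∧ |2 * d * e| ≤ K ^ 2 := by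
  have hA0 : 0 ≤ A := (abs_nonneg _).trans h1
  have c1 : |d * z| ≤ A * (2 * K) := by rw [abs_mul]; gcongr
  have c2 : |e * z| ≤ A * (2 * K) := by rw [abs_mul]; gcongr
  have c3 : |d * e| ≤ A * A := by rw [abs_mul]; gcongr
  have c4 : |d * d| ≤ A * A := by rw [abs_mul]; gcongr
  have c5 : |e * e| ≤ A * A := by rw [abs_mul]; gcongr
  have c6 : 64 * (A * K) ≤ K * K := by nlinarith
  have c7 : A * A ≤ A * K := by nlinarith
  have c8 : A ≤ A * K := by
    rcases hA0.eq_or_lt with h | h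
    · rw [← h]; simp
    · nlinarith
  rw [abs_le] at h1 h2 h3 c1 c2 c3 c4 c5
  have e1 : 2 * d * z + d ^ 2 = 2 * (d * z) + d * d := by ring
  have e2 : 2 * e * z + e ^ 2 - e = 2 * (e * z) + e * e - e := by ring
  have e3 : 2 * d * e = 2 * (d * e) := by ring
  have e4 : K ^ 2 = K * K := by ring
  simp only [abs_le]
  rw [e1, e2, e3, e4]
  refine ⟨?_, ?_, ?_⟩ <;> constructor <;> linarith [h2.1, h2.2, c1.1, c1.2, c2.1, c2.2, c3.1, c3.2, c4.1, c4.2, c5.1, c5.2]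

set_option maxHeartbeats 1000000 in
lemma TC (Q K M l q : ℕ) [NeZero M] [NeZero q] (hQ : 2 ≤ Q) (hK : Q ^ 30 ≤ K) (hl : l.Prime) (hlq : l ∣ q)
    (hl2 : l ≠ 2) (hqQ : q ≤ Q * l) (hlK : l ≤ K) (hKl : K ≤ Q * l) (f g h : ZMod M → ℂ) (hf : ∀ x, ‖f x‖ ≤ 1)
    (hg : ∀ x, ‖g x‖ ≤ 1) (hh : ∀ x, ‖h x‖ ≤ 1) (Ψ : ZMod q → ZMod q → ZMod q → ℝ)
    (hΨ0 : ∀ u v w, 0 ≤ Ψ u v w)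
    (hΨ : ∀ U V W : ℤ, |U| ≤ (K:ℤ) ^ 2 → |V| ≤ (K:ℤ) ^ 2 → |W| ≤ (K:ℤ) ^ 2 → ‖Q4 h (U : ZMod M) (V : ZMod M) (W : ZMod M)‖ ≤ Ψ U V W)
    (H : (M:ℝ) * K ≤ Q * ‖Lam K f g h‖) :
    (M:ℝ) * q ^ 3 ≤ (Q:ℝ) ^ 40 * ∑ u, ∑ v, ∑ w, Ψ u v w := by
  have : Fact l.Prime := ⟨hl⟩
  set A := K / (64 * Q ^ 2) with hA
  have hQ2 : 0 < 64 * Q ^ 2 := by positivity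
  have hAK : A * (64 * Q ^ 2) ≤ K := Nat.div_mul_le_self _ _
  have hKA : K < (A + 1) * (64 * Q ^ 2) := by
    rw [hA]; have := Nat.lt_div_mul_add (a := K) hQ2; linarith
  have hAQ : 512 * Q ^ 4 ≤ A := by
    rw [hA, Nat.le_div_iff_mul_le hQ2]
    calc 512 * Q ^ 4 * (64 * Q ^ 2) = 2 ^ 15 * Q ^ 6 := by ring
      _ ≤ Q ^ 15 * Q ^ 6 := by gcongr
      _ ≤ Q ^ 30 := by rw [← pow_add]; exact npR (by omega) (by norm_num)
      _ ≤ K := hK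
  have hKA2 : K ≤ 128 * Q ^ 2 * A := by nlinarith [pow_pos (show 0 < Q by omega) 4]
  have hAl : A ≤ l := by
    by_contra hc
    push Not at hc
    have : Q * l < A * (64 * Q ^ 2) := by nlinarith
    omega
  have hA64 : 64 * A ≤ K := by nlinarith [pow_pos (show 0 < Q by omega) 2]
  have hAr : (A:ℝ) * (64 * Q ^ 2) ≤ K := by exact_mod_cast hAK
  have h4 := T4 K Q A f g h hf hg hh (range A) (fun i => (i:ℤ)) (fun i hi => by
    rw [mem_range] at hi; push_cast; rw [abs_of_nonneg (by positivity)]; exact_mod_cast hi.le) (range A) (fun i => (i:ℤ))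
    (fun i hi => by
    rw [mem_range] at hi; push_cast; rw [abs_of_nonneg (by positivity)]; exact_mod_cast hi.le) (by exact_mod_cast (by omega : 1 ≤ Q))
    (by positivity) (by nlinarith [show (0:ℝ) ≤ A * Q ^ 2 by positivity]) H
  set Sg := ∑ u, ∑ v, ∑ w, Ψ u v w with hSg
  have hSg0 : 0 ≤ Sg := sum_nonneg fun u _ => sum_nonneg fun v _ => sum_nonneg fun w _ => hΨ0 _ _ _
  have hMpos : (0:ℝ) < M := by exact_mod_cast NeZero.pos M
  -- the inner estimate
  have inner : ∀ a ∈ range A, ∀ b ∈ range A, ∑ a' ∈ range A, ∑ b' ∈ range A, ∑ y ∈ IC K,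
      ‖Q4 h (zc M (2 * ((a':ℤ) - a) * (y + a + b) + ((a':ℤ) - a) ^ 2))
          (zc M (2 * ((b':ℤ) - b) * (y + a + b) + ((b':ℤ) - b) ^ 2 - ((b':ℤ) - b)))
          (zc M (2 * ((a':ℤ) - a) * ((b':ℤ) - b)))‖ ≤ 4 * Q * Sg + 2 * A * K * M := by
    intro a ha b hb
    rw [mem_range] at ha hb
    set G : ℕ → ℕ → ℤ → ℝ := fun a' b' y => ‖Q4 h (zc M (2 * ((a':ℤ) - a) * (y + a + b) + ((a':ℤ) - a) ^ 2))
          (zc M (2 * ((b':ℤ) - b) * (y + a + b) + ((b':ℤ) - b) ^ 2 - ((b':ℤ) - b)))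
          (zc M (2 * ((a':ℤ) - a) * ((b':ℤ) - b)))‖ with hG
    have hG0 : ∀ a' b' y, G a' b' y ≤ M := fun a' b' y => norm_Q4_le h hh _ _ _
    change ∑ a' ∈ range A, ∑ b' ∈ range A, ∑ y ∈ IC K, G a' b' y ≤ _
    have hGK : ∀ a' b', ∑ y ∈ IC K, G a' b' y ≤ K * M := by
      intro a' b'
      refine (slc _ _ (M:ℝ) fun y _ => hG0 _ _ _).trans ?_
      simp
    have hsplit : ∀ (F : ℕ → ℝ) (c : ℕ), c < A → ∑ i ∈ range A, F i = F c + ∑ i ∈ (range A).filter (· ≠ c), F i := by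
      intro F c hc
      rw [filter_ne', add_sum_erase _ _ (mem_range.2 hc)]
    rw [hsplit _ a ha]
    have e1 : ∑ b' ∈ range A, ∑ y ∈ IC K, G a b' y ≤ A * (K * M) := by
      refine (slc _ _ (K * M:ℝ) fun y _ => hGK _ _).trans ?_
      simp
    have e2 : ∑ a' ∈ (range A).filter (· ≠ a), ∑ b' ∈ range A, ∑ y ∈ IC K, G a' b' y
        = ∑ a' ∈ (range A).filter (· ≠ a), ∑ y ∈ IC K, G a' b y +
          ∑ a' ∈ (range A).filter (· ≠ a), ∑ b' ∈ (range A).filter (· ≠ b), ∑ y ∈ IC K, G a' b' y := by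
      rw [← sum_add_distrib]
      exact sum_congr rfl fun a' _ => hsplit _ b hb
    have e3 : ∑ a' ∈ (range A).filter (· ≠ a), ∑ y ∈ IC K, G a' b y ≤ A * (K * M) := by
      refine (slc _ _ (K * M:ℝ) fun y _ => hGK _ _).trans ?_
      rw [nsmul_eq_mul]
      refine mR ?_ (by positivity)
      exact_mod_cast (card_filter_le _ _).trans (by simp)
    have e4 : ∑ a' ∈ (range A).filter (· ≠ a), ∑ b' ∈ (range A).filter (· ≠ b), ∑ y ∈ IC K, G a' b' y
        ≤ 4 * Q * Sg := by
      set S := ((range A).filter (· ≠ a)) ×ˢ ((range A).filter (· ≠ b)) ×ˢ IC K with hS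
      set φ : ℕ × ℕ × ℤ → ZMod q × ZMod q × ZMod q := fun p =>
        (((2 * ((p.1:ℤ) - a) * (p.2.2 + a + b) + ((p.1:ℤ) - a) ^ 2 : ℤ) : ZMod q),
        ((2 * ((p.2.1:ℤ) - b) * (p.2.2 + a + b) + ((p.2.1:ℤ) - b) ^ 2 - ((p.2.1:ℤ) - b) : ℤ) : ZMod q),
        ((2 * ((p.1:ℤ) - a) * ((p.2.1:ℤ) - b) : ℤ) : ZMod q)) with hφ
      have k1 : ∑ a' ∈ (range A).filter (· ≠ a), ∑ b' ∈ (range A).filter (· ≠ b), ∑ y ∈ IC K, G a' b' y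
          = ∑ p ∈ S, G p.1 p.2.1 p.2.2 := by
        rw [hS, sum_product]
        refine sum_congr rfl fun a' _ => ?_
        rw [sum_product]
      have k2 : ∀ p ∈ S, G p.1 p.2.1 p.2.2 ≤ (fun t : ZMod q × ZMod q × ZMod q => Ψ t.1 t.2.1 t.2.2) (φ p) := by
        rintro ⟨a', b', y⟩ hp
        simp only [hS, mem_product, mem_filter, mem_range, mem_Icc] at hp
        obtain ⟨⟨p1, -⟩, ⟨p2, -⟩, p3, p4⟩ := hp
        have b1 : |(a':ℤ) - a| ≤ A := by rw [abs_le]; omega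
        have b2 : |(b':ℤ) - b| ≤ A := by rw [abs_le]; omega
        have b3 : |y + a + b| ≤ 2 * K := by rw [abs_le]; omega
        have bA : (64 * A : ℤ) ≤ K := by exact_mod_cast hA64
        obtain ⟨r1, r2, r3⟩ := size_bd b1 b2 b3 bA
        exact hΨ _ _ _ r1 r2 r3
      have k3 : ∀ t, ((S.filter fun p => φ p = t).card : ℝ) ≤ 4 * Q := by
        rintro ⟨U, V, W⟩
        have := fiber_card l q K A hl2 hlq hAl a b ha hb U V W
        simp only [hφ, Prod.mk.injEq]
        have k4 : 2 * (K / l + 1) ≤ 4 * Q := by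
          have : K / l ≤ Q := Nat.div_le_of_le_mul (by linarith)
          omega
        exact_mod_cast this.trans k4
      rw [k1]
      refine (sum_le_sum k2).trans ((sum_fiber S φ (fun t : ZMod q × ZMod q × ZMod q => Ψ t.1 t.2.1 t.2.2) (fun b => hΨ0 _ _ _) _ k3).trans (le_of_eq ?_))
      rw [hSg, Fintype.sum_prod_type]
      simp only [Fintype.sum_prod_type]
    rw [e2]; linarith
  -- assemble
  have h5 : ∑ p ∈ (range A ×ˢ range A) ×ˢ (range A ×ˢ range A), ‖∑ y ∈ IC K,
        Q4 h (zc M (2 * ((p.1.2:ℤ) - p.1.1) * (y + p.1.1 + p.2.1) + ((p.1.2:ℤ) - p.1.1) ^ 2))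
          (zc M (2 * ((p.2.2:ℤ) - p.2.1) * (y + p.1.1 + p.2.1) + ((p.2.2:ℤ) - p.2.1) ^ 2
            - ((p.2.2:ℤ) - p.2.1)))
          (zc M (2 * ((p.1.2:ℤ) - p.1.1) * ((p.2.2:ℤ) - p.2.1)))‖ ≤ A * (A * (4 * Q * Sg + 2 * A * K * M)) := by
    simp only [sum_product]
    have : ∀ a ∈ range A, ∑ a' ∈ range A, ∑ b ∈ range A, ∑ b' ∈ range A, ‖∑ y ∈ IC K,
        Q4 h (zc M (2 * ((a':ℤ) - a) * (y + a + b) + ((a':ℤ) - a) ^ 2))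
          (zc M (2 * ((b':ℤ) - b) * (y + a + b) + ((b':ℤ) - b) ^ 2 - ((b':ℤ) - b)))
          (zc M (2 * ((a':ℤ) - a) * ((b':ℤ) - b)))‖ ≤ A * (4 * Q * Sg + 2 * A * K * M) := by
      intro a ha
      rw [sum_comm]
      refine (slc _ _ (4 * Q * Sg + 2 * A * K * M) fun b hb => ?_).trans (by rw [nsmul_eq_mul, card_range])
      refine le_trans ?_ (inner a ha b hb)
      exact sum_le_sum fun _ _ => sum_le_sum fun _ _ => norm_sum_le _ _
    refine (slc _ _ _ this).trans (by rw [nsmul_eq_mul, card_range])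
  have h6 := h4.trans (mL h5 (by positivity))
  simp only [card_product, card_range, Nat.cast_mul] at h6
  have hA0 : (0:ℝ) < A := by
    have : 0 < A := lt_of_lt_of_le (by positivity) hAQ
    exact_mod_cast this
  have h7 : (M:ℝ) * K * A ^ 2 ≤ 64 * Q ^ 4 * (4 * Q * Sg + 2 * A * K * M) := by
    have : (A:ℝ) ^ 2 * ((M:ℝ) * K * A ^ 2) ≤ A ^ 2 * (64 * Q ^ 4 * (4 * Q * Sg + 2 * A * K * M)) := by linarith
    exact cL this (by positivity)
  have hAQr : (512:ℝ) * Q ^ 4 ≤ A := by exact_mod_cast hAQ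
  have h8 : (M:ℝ) * K * A ^ 2 ≤ 512 * Q ^ 5 * Sg := by
    have : 512 * (Q:ℝ) ^ 4 * (A * K * M) ≤ A * (A * K * M) := by gcongr
    have e1 : (A:ℝ) * (A * K * M) = M * K * A ^ 2 := by ring
    have e2 : 64 * (Q:ℝ) ^ 4 * (4 * Q * Sg + 2 * A * K * M) = 256 * Q ^ 5 * Sg + 128 * Q ^ 4 * (A * K * M) := by ring
    rw [e1] at this; rw [e2] at h7
    have : 0 ≤ (Q:ℝ) ^ 4 * (A * K * M) := by positivity
    nlinarith
  have h9 : (q:ℝ) ^ 3 ≤ Q ^ 3 * (K * (128 * Q ^ 2 * A) ^ 2) := by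
    have i1 : (q:ℝ) ≤ Q * K := by
      have : q ≤ Q * K := hqQ.trans (nmL _ hlK)
      exact_mod_cast this
    have i2 : (K:ℝ) ≤ 128 * Q ^ 2 * A := by exact_mod_cast hKA2
    calc (q:ℝ) ^ 3 ≤ ((Q:ℝ) * K) ^ 3 := by gcongr
      _ = (Q:ℝ) ^ 3 * (K * K ^ 2) := by ring
      _ ≤ _ := by gcongr
  calc (M:ℝ) * q ^ 3 ≤ (M:ℝ) * (Q ^ 3 * (K * (128 * Q ^ 2 * A) ^ 2)) := by gcongr
    _ = (Q:ℝ) ^ 7 * 2 ^ 14 * (M * K * A ^ 2) := by ring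
    _ ≤ (Q:ℝ) ^ 7 * 2 ^ 14 * (512 * Q ^ 5 * Sg) := by gcongr
    _ = (2 ^ 23 * (Q:ℝ) ^ 12) * Sg := by ring
    _ ≤ ((Q:ℝ) ^ 23 * Q ^ 12) * Sg := by
      have : (2:ℝ) ≤ Q := by exact_mod_cast hQ
      gcongr
    _ = (Q:ℝ) ^ 35 * Sg := by ring
    _ ≤ (Q:ℝ) ^ 40 * Sg := by
      have : (1:ℝ) ≤ Q := by exact_mod_cast (by omega : 1 ≤ Q)
      gcongr
      norm_num

lemma sum_block {α : Type*} [AddCommMonoid α] (q L : ℕ) [NeZero q] (F : ℤ → α) :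
    ∑ n ∈ IZ (q * L), F n = ∑ r : ZMod q, ∑ t ∈ IZ L, F (r.val + q * t) := by
  have hq : (0:ℤ) < q := by exact_mod_cast NeZero.pos q
  rw [← sum_product']
  refine sum_bij' (fun n _ => ((n : ZMod q), n / (q:ℤ))) (fun p _ => (p.1.val : ℤ) + q * p.2) ?_ ?_ ?_ ?_ ?_
  · intro n hn
    rw [mem_Ico] at hn
    simp only [mem_product, mem_univ, true_and, mem_Ico]
    exact ⟨Int.ediv_nonneg hn.1 hq.le, Int.ediv_lt_of_lt_mul hq (by linarith)⟩
  · rintro ⟨r, t⟩ h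
    simp only [mem_product, mem_univ, true_and, mem_Ico] at h ⊢
    have := ZMod.val_lt r
    constructor
    · nlinarith
    · nlinarith
  · intro n hn
    simp only [ZMod.val_intCast]
    exact Int.emod_add_mul_ediv n q
  · rintro ⟨r, t⟩ h
    have := ZMod.val_lt r
    simp only [Int.cast_add, Int.cast_natCast, Int.cast_mul, CharP.cast_eq_zero, zero_mul, add_zero, ZMod.natCast_zmod_val,
      Prod.mk.injEq, true_and]
    rw [Int.add_mul_ediv_left _ _ hq.ne', Int.ediv_eq_zero_of_lt (by omega) (by omega), zero_add]
  · intro n hn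
    simp only [ZMod.val_intCast]
    rw [Int.emod_add_mul_ediv n q]

lemma Q4H (M K : ℕ) [NeZero M] (hM : 100 * K ^ 2 = M) (H : ℤ → ℂ) (P : ℤ) (hP : P ≤ (K:ℤ) ^ 2)
    (hH : ∀ x, H x ≠ 0 → 0 ≤ x ∧ x < P) (U V W : ℤ) (hU : |U| ≤ (K:ℤ) ^ 2) (hV : |V| ≤ (K:ℤ) ^ 2) (hW : |W| ≤ (K:ℤ) ^ 2) :
    Q4 (cyc M H) (U : ZMod M) (V : ZMod M) (W : ZMod M) =
      ∑ n ∈ IZ P, H n * conj (H (n + U)) * conj (H (n + V)) * H (n + U + V + W) := by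
  unfold Q4
  have hM' : 100 * (K:ℤ) ^ 2 = M := by exact_mod_cast hM
  have hMpos : (0:ℤ) < M := by exact_mod_cast NeZero.pos M
  rw [abs_le] at hU hV hW
  rw [sum_zmod_Ico _ 0, zero_add]
  have hsub : IZ P ⊆ IZ M := by
    intro n; simp only [mem_Ico]; intro h; constructor <;> omega
  rw [← sum_subset hsub]
  · refine sum_congr rfl fun n hn => ?_
    rw [mem_Ico] at hn
    have e : ∀ m : ℤ, P ≤ m + M → m < M → cyc M H (m : ZMod M) = H m := fun m h1 h2 => cyc_int H P hH m h1 h2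
    rw [← e n (by omega) (by omega), ← e (n + U) (by omega) (by omega), ← e (n + V) (by omega) (by omega),
      ← e (n + U + V + W) (by omega) (by omega)]
    push_cast; rfl
  · intro n hn hn'
    rw [mem_Ico] at hn hn'
    rw [cyc_int H P hH n (by omega) (by omega)]
    have : H n = 0 := by by_contra hc; exact hn' (hH n hc)
    rw [this]; simp

noncomputable def HH (q L : ℕ) (c : ZMod q → ℂ) (β : ZMod q → ℝ) : ℤ → ℂ :=
  fun x => if 0 ≤ x ∧ x < q * L then c (x : ZMod q) * ee (β (x : ZMod q) * (x / (q:ℤ) : ℤ)) else 0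

lemma HH_supp (q L : ℕ) (c : ZMod q → ℂ) (β : ZMod q → ℝ) (x : ℤ) (h : HH q L c β x ≠ 0) : 0 ≤ x ∧ x < q * L := by
  unfold HH at h; by_contra hc; exact h (if_neg hc)

lemma HH_bd (q L : ℕ) (c : ZMod q → ℂ) (β : ZMod q → ℝ) (hc : ∀ r, ‖c r‖ ≤ 1) (x : ℤ) : ‖HH q L c β x‖ ≤ 1 := by
  unfold HH; split_ifs
  · rw [norm_mul, norm_ee, mul_one]; exact hc _
  · simp

lemma ite4 (p0 p1 p2 p3 : Prop) [Decidable p0] [Decidable p1] [Decidable p2] [Decidable p3] (a b c d : ℂ) :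
    (if p0 then a else 0) * conj (if p1 then b else 0) * conj (if p2 then c else 0) * (if p3 then d else 0) =
    if p0 ∧ p1 ∧ p2 ∧ p3 then a * conj b * conj c * d else 0 := by
  by_cases h0 : p0 <;> by_cases h1 : p1 <;> by_cases h2 : p2 <;> by_cases h3 : p3 <;> simp [h0, h1, h2, h3]

/-- for fixed `r`, the inner sum over `t` -/
lemma HH_inner (q L : ℕ) [NeZero q] (c : ZMod q → ℂ) (β : ZMod q → ℝ) (hc : ∀ r, ‖c r‖ ≤ 1) (r : ZMod q) (U V W : ℤ)
    (φ : ℝ) (hφ : φ = β r - β (r + U) - β (r + V) + β (r + U + V + W)) :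
    ‖∑ t ∈ IZ L, HH q L c β (r.val + q * t) * conj (HH q L c β (r.val + q * t + U)) *
      conj (HH q L c β (r.val + q * t + V)) * HH q L c β (r.val + q * t + U + V + W)‖ * (2 * nd φ) ≤ 1 := by
  have hq : (0:ℤ) < q := by exact_mod_cast NeZero.pos q
  set S := (IZ L).filter fun t => (0 ≤ (r.val:ℤ) + q * t ∧ (r.val:ℤ) + q * t < q * L) ∧
    (0 ≤ (r.val:ℤ) + q * t + U ∧ (r.val:ℤ) + q * t + U < q * L) ∧ (0 ≤ (r.val:ℤ) + q * t + V ∧ (r.val:ℤ) + q * t + V < q * L) ∧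
    (0 ≤ (r.val:ℤ) + q * t + U + V + W ∧ (r.val:ℤ) + q * t + U + V + W < q * L) with hS
  have hval : ∀ (A t : ℤ), HH q L c β (r.val + q * t + A) = if 0 ≤ (r.val:ℤ) + q * t + A ∧ (r.val:ℤ) + q * t + A < q * L then
      c (r + A) * ee (β (r + A) * (t + ((r.val + A) / (q:ℤ) : ℤ))) else 0 := by
    intro A t
    unfold HH
    have e1 : (((r.val:ℤ) + q * t + A : ℤ) : ZMod q) = r + A := by push_cast; simp
    have e2 : ((r.val:ℤ) + q * t + A) / (q:ℤ) = t + (r.val + A) / (q:ℤ) := by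
      rw [show (r.val:ℤ) + q * t + A = (r.val + A) + q * t by ring, Int.add_mul_ediv_left _ _ hq.ne']; ring
    rw [e1, e2]; push_cast; rfl
  have e0 : ∀ t : ℤ, (r.val:ℤ) + q * t = r.val + q * t + 0 := fun t => by ring
  have e3 : ∀ t : ℤ, (r.val:ℤ) + q * t + U + V + W = r.val + q * t + (U + V + W) := fun t => by ring
  set l : ℝ := β r * ((r.val + 0) / (q:ℤ) : ℤ) - β (r + U) * ((r.val + U) / (q:ℤ) : ℤ) - β (r + V) * ((r.val + V) / (q:ℤ) : ℤ)
     + β (r + U + V + W) * ((r.val + (U + V + W)) / (q:ℤ) : ℤ) with hl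
  set C := c r * conj (c (r + U)) * conj (c (r + V)) * c (r + U + V + W) with hC
  have hC1 : ‖C‖ ≤ 1 := bd_mul (bd_mul (bd_mul (hc _) (bd_conj (hc _))) (bd_conj (hc _))) (hc _)
  have h1 : ∑ t ∈ IZ L, HH q L c β (r.val + q * t) * conj (HH q L c β (r.val + q * t + U)) *
      conj (HH q L c β (r.val + q * t + V)) * HH q L c β (r.val + q * t + U + V + W) = C * ∑ t ∈ S, ee (φ * t + l) := by
    rw [hS, sum_filter, mul_sum]
    refine sum_congr rfl fun t _ => ?_
    have g0 := hval 0 t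
    have g1 := hval U t
    have g2 := hval V t
    have g3 := hval (U + V + W) t
    rw [← e3] at g3
    rw [← e0] at g0
    simp only [Int.cast_zero, add_zero] at g0
    rw [g0, g1, g2, g3]
    rw [ite4, mul_ite, mul_zero]
    congr 1
    have e : φ * t + l = β r * (t + ((r.val + 0) / (q:ℤ) : ℤ)) + -(β (r + U) * (t + ((r.val + U) / (q:ℤ) : ℤ))) +
        -(β (r + V) * (t + ((r.val + V) / (q:ℤ) : ℤ))) + β (r + U + V + W) * (t + ((r.val + (U + V + W)) / (q:ℤ) : ℤ)) := by
        rw [hφ, hl]; ring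
    rw [e, ee_add, ee_add, ee_add, ee_neg, ee_neg, hC]
    push_cast
    simp only [map_mul, add_zero, ← add_assoc]
    ring
  rw [h1, norm_mul]
  obtain ⟨a, b, hab⟩ : ∃ a b, S = Ico a b := by
    apply ordc_Ico
    intro x hx z hz y h1 h2
    rw [hS, mem_filter, mem_Ico] at *
    have := mL h1 hq.le
    have := mL h2 hq.le
    refine ⟨?_, ⟨?_, ?_⟩, ⟨?_, ?_⟩, ⟨?_, ?_⟩, ?_, ?_⟩ <;> first | omega | linarith
  rw [hab]
  have := geo_Ico φ l a b
  have h2 := nd_nonneg φ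
  have h3 := norm_nonneg (∑ t ∈ Ico a b, ee (φ * t + l))
  nlinarith [mul_nonneg (mul_nonneg h3 h2) (sub_nonneg.2 hC1)]

lemma cov4 {q : ℕ} [NeZero q] (G : ZMod q → ZMod q → ZMod q → ZMod q → ℝ) :
    ∑ u, ∑ v, ∑ w, ∑ r, G r (r + u) (r + v) (r + u + v + w) = ∑ a, ∑ b, ∑ c, ∑ r, G r a b c := by
  have key : ∀ F : ZMod q → ZMod q → ZMod q → ZMod q → ℝ,
      ∑ u, ∑ v, ∑ w, ∑ r, F u v w r = ∑ r, ∑ u, ∑ v, ∑ w, F u v w r := by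
    intro F
    rw [sum_comm (s := (univ : Finset (ZMod q))) (f := fun r u => ∑ v, ∑ w, F u v w r)]
    refine sum_congr rfl fun u _ => ?_
    rw [sum_comm (s := (univ : Finset (ZMod q))) (f := fun r v => ∑ w, F u v w r)]
    refine sum_congr rfl fun v _ => ?_
    rw [sum_comm]
  rw [key, key (fun a b c r => G r a b c)]
  refine sum_congr rfl fun r _ => ?_
  rw [← Equiv.sum_comp (Equiv.addLeft r) (fun a => ∑ b, ∑ c, G r a b c)]
  refine sum_congr rfl fun u _ => ?_
  rw [← Equiv.sum_comp (Equiv.addLeft r) (fun b => ∑ c, G r _ b c)]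
  refine sum_congr rfl fun v _ => ?_
  rw [← Equiv.sum_comp (Equiv.addLeft (r + u + v)) (fun c => G r _ _ c)]
  rfl

lemma cyc_bd (M : ℕ) (H : ℤ → ℂ) (h : ∀ x, ‖H x‖ ≤ 1) (x : ZMod M) : ‖cyc M H x‖ ≤ 1 := h _

lemma TCi (Q K M l q L : ℕ) [NeZero M] [NeZero q] (hQ : 2 ≤ Q) (hK : Q ^ 30 ≤ K) (hM : 100 * K ^ 2 = M) (hl : l.Prime) (hlq : l ∣ q)
    (hl2 : l ≠ 2) (hqQ : q ≤ Q * l) (hlK : l ≤ K) (hKl : K ≤ Q * l) (hL : 0 < L) (hqL : q * L ≤ K ^ 2)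
    (f g : ZMod M → ℂ) (hf : ∀ x, ‖f x‖ ≤ 1)
    (hg : ∀ x, ‖g x‖ ≤ 1) (c : ZMod q → ℂ) (β : ZMod q → ℝ) (hc : ∀ r, ‖c r‖ ≤ 1)
    (H : (M:ℝ) * K ≤ Q * ‖Lam K f g (cyc M (HH q L c β))‖) :
    ∃ βs : ℝ, (q:ℝ) ≤ (Q:ℝ) ^ 44 * ((univ.filter fun r => c r ≠ 0 ∧ nd (β r - βs) ≤ (Q:ℝ) ^ 41 / L).card : ℝ) := by
  classical
  by_contra hcon
  push Not at hcon
  have hLr : (0:ℝ) < L := by exact_mod_cast hL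
  have hQr : (2:ℝ) ≤ Q := by exact_mod_cast hQ
  have hQ0 : (0:ℝ) < Q := by linarith
  have hqpos : (0:ℝ) < q := by exact_mod_cast NeZero.pos q
  set ρ : ℝ := (Q:ℝ) ^ 41 / L with hρ
  set G : ZMod q → ZMod q → ZMod q → ZMod q → ℝ := fun r a b d =>
    if c r ≠ 0 ∧ nd (β r - (β a + β b - β d)) ≤ ρ then (L:ℝ) else L / (2 * (Q:ℝ) ^ 41) with hG
  have hG0 : ∀ r a b d, 0 ≤ G r a b d := by
    intro r a b d; simp only [hG]; split_ifs <;> positivity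
  have hTC := TC Q K M l q hQ hK hl hlq hl2 hqQ hlK hKl f g (cyc M (HH q L c β)) hf hg
    (cyc_bd _ _ (HH_bd q L c β hc)) (fun u v w => ∑ r, G r (r + u) (r + v) (r + u + v + w))
    (fun u v w => sum_nonneg fun _ _ => hG0 _ _ _ _) ?_ H
  · rw [cov4] at hTC
    have h1 : ∑ a, ∑ b, ∑ d, ∑ r, G r a b d ≤ (q:ℝ) ^ 3 * (L * (q / Q ^ 44) + q * (L / (2 * Q ^ 41))) := by
      have : ∀ a b d, ∑ r, G r a b d ≤ L * (q / Q ^ 44) + q * (L / (2 * Q ^ 41)) := by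
        intro a b d
        simp only [hG]
        rw [← sum_filter_add_sum_filter_not univ (fun r => c r ≠ 0 ∧ nd (β r - (β a + β b - β d)) ≤ ρ)]
        refine add_le_add ?_ ?_
        · rw [sum_congr rfl (g := fun _ => (L:ℝ)) (fun r hr => if_pos (mem_filter.1 hr).2), sum_const, nsmul_eq_mul, mul_comm]
          refine mL ?_ hLr.le
          rw [le_div_iff₀ (by positivity), mul_comm]
          exact (hcon _).le
        · rw [sum_congr rfl (g := fun _ => (L:ℝ) / (2 * Q ^ 41)) (fun r hr => if_neg (mem_filter.1 hr).2), sum_const, nsmul_eq_mul]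
          refine mR ?_ (by positivity)
          exact_mod_cast (card_filter_le _ _).trans (by simp [ZMod.card])
      calc _ ≤ ∑ a : ZMod q, ∑ b : ZMod q, ∑ d : ZMod q, ((L:ℝ) * (q / Q ^ 44) + q * (L / (2 * Q ^ 41))) :=
            sum_le_sum fun a _ => sum_le_sum fun b _ => sum_le_sum fun d _ => this a b d
        _ = _ := by simp only [sum_const, card_univ, ZMod.card, nsmul_eq_mul]; ring
    have h2 : (Q:ℝ) ^ 40 * ((q:ℝ) ^ 3 * (L * (q / Q ^ 44) + q * (L / (2 * Q ^ 41)))) ≤ q ^ 3 * (q * L) := by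
      have : (Q:ℝ) ^ 40 * ((q:ℝ) ^ 3 * (L * (q / Q ^ 44) + q * (L / (2 * Q ^ 41)))) =
        q ^ 3 * (q * L) * (1 / Q ^ 4 + 1 / (2 * Q)) := by field_simp
      rw [this]
      have e1 : (1:ℝ) / Q ^ 4 ≤ 1 / 2 := by
        apply one_div_le_one_div_of_le (by norm_num)
        nlinarith [pL (by norm_num) hQr 4]
      have e2 : (1:ℝ) / (2 * Q) ≤ 1 / 2 := by
        apply one_div_le_one_div_of_le (by norm_num); linarith
      have e3 : (0:ℝ) ≤ q ^ 3 * (q * L) := by positivity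
      nlinarith
    have h3 : (q:ℝ) * L ≤ K ^ 2 := by exact_mod_cast hqL
    have h4 : (M:ℝ) = 100 * K ^ 2 := by rw [← hM]; push_cast; ring
    have h5 := hTC.trans ((mL h1 (by positivity)).trans h2)
    have h6 : (0:ℝ) < q ^ 3 := by positivity
    have h7 : (0:ℝ) < q * L := by positivity
    rw [h4] at h5
    nlinarith
  · intro U V W hU hV hW
    rw [Q4H M K hM (HH q L c β) (q * L) (by exact_mod_cast hqL) (fun x hx => HH_supp q L c β x hx) U V W hU hV hW, sum_block]
    refine (norm_sum_le _ _).trans (sum_le_sum fun r _ => ?_)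
    have hin := HH_inner q L c β hc r U V W _ rfl
    set X := ∑ t ∈ IZ L, HH q L c β (r.val + q * t) * conj (HH q L c β (r.val + q * t + U)) *
      conj (HH q L c β (r.val + q * t + V)) * HH q L c β (r.val + q * t + U + V + W) with hX
    simp only [hG]
    split_ifs with hcase
    · refine (norm_sum_le _ _).trans ((slc _ _ 1 fun t _ => ?_).trans (by simp))
      have hb := HH_bd q L c β hc
      exact bd_mul (bd_mul (bd_mul (hb _) (bd_conj (hb _))) (bd_conj (hb _))) (hb _)
    · by_cases hcr : c r = 0
      · have : X = 0 := by
          refine sum_eq_zero fun t _ => ?_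
          have : HH q L c β (r.val + q * t) = 0 := by
            unfold HH; split_ifs
            · have e1 : (((r.val:ℤ) + q * t : ℤ) : ZMod q) = r := by push_cast; simp
              rw [e1, hcr, zero_mul]
            · rfl
          rw [this]; simp
        rw [this, norm_zero]; positivity
      · have h1 : ρ < nd (β r - β (r + U) - β (r + V) + β (r + U + V + W)) := by
          by_contra hc'
          push Not at hc'
          exact hcase ⟨hcr, le_of_eq_of_le (congrArg nd (by ring)) hc'⟩
        rw [le_div_iff₀ (by positivity)]
        have h2 : ‖X‖ * (2 * ρ) ≤ 1 := le_trans (by gcongr) hin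
        rw [hρ] at h2
        have h3 : ‖X‖ * (2 * ((Q:ℝ) ^ 41 / L)) = ‖X‖ * (2 * Q ^ 41) / L := by ring
        rw [h3, div_le_one hLr] at h2
        exact h2

noncomputable def HR (q L : ℕ) (R : ZMod q → ℂ) (α : ℝ) : ℤ → ℂ :=
  fun x => if 0 ≤ x ∧ x < q * L then R (x : ZMod q) * ee (α * x) else 0

lemma HR_supp (q L : ℕ) (c : ZMod q → ℂ) (β : ℝ) (x : ℤ) (h : HR q L c β x ≠ 0) : 0 ≤ x ∧ x < q * L := by
  unfold HR at h; by_contra hc; exact h (if_neg hc)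

lemma HR_bd (q L : ℕ) (c : ZMod q → ℂ) (β : ℝ) (hc : ∀ r, ‖c r‖ ≤ 1) (x : ℤ) : ‖HR q L c β x‖ ≤ 1 := by
  unfold HR; split_ifs
  · rw [norm_mul, norm_ee, mul_one]; exact hc _
  · simp

lemma cnt_AP (q : ℤ) (hq : 0 < q) (r lo hi : ℤ) :
    |((Ico (-((r - lo) / q)) (-((r - hi) / q))).card : ℝ) - (((hi - lo) / q).toNat : ℝ)| ≤ 1 := by
  rw [Int.card_Ico]
  have a1 := Int.mul_ediv_add_emod (r - lo) q
  have a2 := Int.emod_nonneg (r - lo) hq.ne'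
  have a3 := Int.emod_lt_of_pos (r - lo) hq
  have b1 := Int.mul_ediv_add_emod (r - hi) q
  have b2 := Int.emod_nonneg (r - hi) hq.ne'
  have b3 := Int.emod_lt_of_pos (r - hi) hq
  have c1 := Int.mul_ediv_add_emod (hi - lo) q
  have c2 := Int.emod_nonneg (hi - lo) hq.ne'
  have c3 := Int.emod_lt_of_pos (hi - lo) hq
  set A := (r - lo) / q
  set B := (r - hi) / q
  set C := (hi - lo) / q
  have h1 : A - B - C < 2 := by
    by_contra h; push Not at h
    have := mL h hq.le
    nlinarith
  have h2 : -1 < A - B - C := by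
    by_contra h; push Not at h
    have := mL h hq.le
    nlinarith
  have h3 : (((-B - -A).toNat : ℤ) - (C.toNat : ℤ)) ≤ 1 ∧ -1 ≤ (((-B - -A).toNat : ℤ) - (C.toNat : ℤ)) := by omega
  rw [abs_le]
  exact ⟨by exact_mod_cast h3.2, by exact_mod_cast h3.1⟩

lemma HR_Q4 (q L : ℕ) [NeZero q] (R : ZMod q → ℂ) (α : ℝ) (hR : ∀ r, ‖R r‖ ≤ 1) (U V W : ℤ) :
    ‖∑ n ∈ IZ (q * L), HR q L R α n * conj (HR q L R α (n + U)) * conj (HR q L R α (n + V)) * HR q L R α (n + U + V + W)‖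
    ≤ L * ‖∑ r, R r * conj (R (r + U)) * conj (R (r + V)) * R (r + U + V + W)‖ + q := by
  have hq : (0:ℤ) < q := by exact_mod_cast NeZero.pos q
  set lo : ℤ := max (max 0 (-U)) (max (-V) (-(U + V + W))) with hlo
  set hi : ℤ := min (min (q * L) (q * L - U)) (min (q * L - V) (q * L - (U + V + W))) with hhi
  set R4 : ZMod q → ℂ := fun r => R r * conj (R (r + U)) * conj (R (r + V)) * R (r + U + V + W) with hR4
  have hR41 : ∀ r, ‖R4 r‖ ≤ 1 := fun r => bd_mul (bd_mul (bd_mul (hR _) (bd_conj (hR _))) (bd_conj (hR _))) (hR _)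
  set S : ZMod q → Finset ℤ := fun r => Ico (-((r.val - lo) / (q:ℤ))) (-((r.val - hi) / (q:ℤ))) with hS
  set n0 : ℕ := ((hi - lo) / (q:ℤ)).toNat with hn0
  have hn0L : n0 ≤ L := by
    have h1 : hi - lo ≤ q * L := by omega
    have h2 : (hi - lo) / (q:ℤ) ≤ L := Int.ediv_le_of_le_mul hq (by linarith)
    omega
  have hsum : ∑ n ∈ IZ (q * L), HR q L R α n * conj (HR q L R α (n + U)) * conj (HR q L R α (n + V)) * HR q L R α (n + U + V + W)
      = ee (α * W) * ∑ r, R4 r * ((S r).card : ℂ) := by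
    rw [sum_block, mul_sum]
    refine sum_congr rfl fun r _ => ?_
    have hSr : S r = (IZ L).filter fun t => (0 ≤ (r.val:ℤ) + q * t ∧ (r.val:ℤ) + q * t < q * L) ∧
      (0 ≤ (r.val:ℤ) + q * t + U ∧ (r.val:ℤ) + q * t + U < q * L) ∧ (0 ≤ (r.val:ℤ) + q * t + V ∧ (r.val:ℤ) + q * t + V < q * L) ∧
      (0 ≤ (r.val:ℤ) + q * t + U + V + W ∧ (r.val:ℤ) + q * t + U + V + W < q * L) := by
      ext t
      have hv := ZMod.val_lt r
      have e1 : -(((r.val:ℤ) - lo) / q) ≤ t ↔ lo ≤ r.val + q * t := by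
        rw [neg_le, Int.le_ediv_iff_mul_le hq]
        constructor <;> intro h <;> linarith
      have e2 : t < -(((r.val:ℤ) - hi) / q) ↔ r.val + q * t < hi := by
        rw [lt_neg, Int.ediv_lt_iff_lt_mul hq]
        constructor <;> intro h <;> linarith
      have e3 : (0 ≤ (r.val:ℤ) + q * t ∧ (r.val:ℤ) + q * t < q * L) → (0 ≤ t ∧ t < L) := by
        rintro ⟨h1, h2⟩
        constructor
        · by_contra hc; push Not at hc
          have : q * t ≤ q * (-1:ℤ) := mL (by omega) hq.le
          omega
        · by_contra hc; push Not at hc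
          have : (q:ℤ) * L ≤ q * t := mL (by omega) hq.le
          omega
      simp only [hS, mem_Ico, mem_filter]
      rw [e1, e2]
      constructor
      · rintro ⟨h1, h2⟩
        have h3 : (0 ≤ (r.val:ℤ) + q * t ∧ (r.val:ℤ) + q * t < q * L) := by omega
        exact ⟨e3 h3, h3, by omega, by omega, by omega⟩
      · rintro ⟨h0, h1, h2, h3, h4⟩
        constructor <;> omega
    have hc : ee (α * W) * (R4 r * ((S r).card : ℂ)) = ∑ t ∈ S r, ee (α * W) * R4 r := by
      rw [sum_const, nsmul_eq_mul]; ring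
    rw [hc, hSr, sum_filter]
    refine sum_congr rfl fun t _ => ?_
    unfold HR
    rw [ite4]
    congr 1
    have e1 : ∀ A : ℤ, (((r.val:ℤ) + q * t + A : ℤ) : ZMod q) = r + A := by intro A; push_cast; simp
    have e0 : (((r.val:ℤ) + q * t : ℤ) : ZMod q) = r := by push_cast; simp
    have e4 : (r.val:ℤ) + q * t + U + V + W = r.val + q * t + (U + V + W) := by ring
    rw [e4, e0, e1, e1, e1, hR4]
    have e5 : α * W = α * ((r.val:ℤ) + q * t : ℤ) + -(α * ((r.val:ℤ) + q * t + U : ℤ)) + -(α * ((r.val:ℤ) + q * t + V : ℤ)) +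
       α * ((r.val:ℤ) + q * t + (U + V + W) : ℤ) := by push_cast; ring
    rw [e5, ee_add, ee_add, ee_add, ee_neg, ee_neg]
    simp only [map_mul]
    push_cast
    simp only [← add_assoc]
    ring
  rw [hsum, norm_mul, norm_ee, one_mul]
  have h1 : ∑ r, R4 r * ((S r).card : ℂ) = n0 * ∑ r, R4 r + ∑ r, R4 r * (((S r).card : ℂ) - n0) := by
    rw [mul_sum, ← sum_add_distrib]
    exact sum_congr rfl fun r _ => by ring
  rw [h1]
  refine (norm_add_le _ _).trans (add_le_add ?_ ?_)
  · rw [norm_mul, Complex.norm_natCast]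
    refine mR (by exact_mod_cast hn0L) (norm_nonneg _)
  · refine (norm_sum_le _ _).trans ((slc _ _ 1 fun r _ => ?_).trans (by simp [ZMod.card]))
    refine bd_mul (hR41 r) ?_
    have := cnt_AP q hq r.val lo hi
    have e : ((S r).card : ℂ) - n0 = ((((S r).card : ℝ) - (n0 : ℝ) : ℝ) : ℂ) := by push_cast; rfl
    rw [e, Complex.norm_real, Real.norm_eq_abs]
    exact this

lemma TCii (Q K M l q L : ℕ) [NeZero M] [NeZero q] (hQ : 2 ≤ Q) (hK : Q ^ 50 ≤ K) (hM : 100 * K ^ 2 = M) (hl : l.Prime) (hlq : l ∣ q)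
    (hl2 : l ≠ 2) (hqQ : q ≤ Q * l) (hlK : l ≤ K) (hKl : K ≤ Q * l) (hL : 0 < L) (hqL : q * L ≤ K ^ 2)
    (f g : ZMod M → ℂ) (hf : ∀ x, ‖f x‖ ≤ 1)
    (hg : ∀ x, ‖g x‖ ≤ 1) (R : ZMod q → ℂ) (α : ℝ) (hR : ∀ r, ‖R r‖ ≤ 1)
    (H : (M:ℝ) * K ≤ Q * ‖Lam K f g (cyc M (HR q L R α))‖) :
    ∃ ξ : ZMod q, (q:ℝ) ≤ (Q:ℝ) ^ 40 * ‖∑ r, R r * ch ξ r‖ := by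
  by_contra hcon
  push Not at hcon
  have hLr : (0:ℝ) < L := by exact_mod_cast hL
  have hQr : (2:ℝ) ≤ Q := by exact_mod_cast hQ
  have hQ0 : (0:ℝ) < Q := by linarith
  have hqpos : (0:ℝ) < q := by exact_mod_cast NeZero.pos q
  have hTC := TC Q K M l q hQ ((npR (by omega) (by norm_num)).trans hK) hl hlq hl2 hqQ hlK hKl f g (cyc M (HR q L R α)) hf hg
    (cyc_bd _ _ (HR_bd q L R α hR))
    (fun u v w => L * ‖∑ r, R r * conj (R (r + u)) * conj (R (r + v)) * R (r + u + v + w)‖ + q)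
    (fun u v w => by positivity) (fun U V W hU hV hW => by
      rw [Q4H M K hM (HR q L R α) (q * L) (by exact_mod_cast hqL) (fun x hx => HR_supp q L R α x hx) U V W hU hV hW]
      exact HR_Q4 q L R α hR U V W) H
  set X : ZMod q → ZMod q → ZMod q → ℝ := fun u v w => ‖∑ r, R r * conj (R (r + u)) * conj (R (r + v)) * R (r + u + v + w)‖ with hX
  set m : ℝ := q / Q ^ 40 with hm
  have hsq : ∀ u v, ∑ w, X u v w ≤ q * m := by
    intro u v
    have h1 : ∑ w, X u v w ^ 2 ≤ m ^ 2 * q := by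
      have h2 := conv_bound R (fun r => R r * conj (R (r + u)) * conj (R (r + v))) m (fun j => by
        rw [hm, le_div_iff₀ (by positivity), mul_comm]; exact (hcon j).le)
      have h3 : ∑ x, ‖R x * conj (R (x + u)) * conj (R (x + v))‖ ^ 2 ≤ (q:ℝ) := by
        refine (slc _ _ 1 fun r _ => ?_).trans (by simp [ZMod.card])
        exact pow_le_one₀ (norm_nonneg _) (bd_mul (bd_mul (hR _) (bd_conj (hR _))) (bd_conj (hR _)))
      refine le_trans (le_of_eq ?_) (h2.trans (mL h3 (by positivity)))
      rw [← Equiv.sum_comp (Equiv.addLeft (u + v)) (fun w => ‖∑ x, R (w + x) * _‖ ^ 2)]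
      refine sum_congr rfl fun w _ => ?_
      simp only [hX, Equiv.coe_addLeft]
      congr 2
      refine sum_congr rfl fun r _ => ?_
      rw [show u + v + w + r = r + u + v + w by ring]; ring
    have h0 : 0 ≤ ∑ w, X u v w := sum_nonneg fun _ _ => norm_nonneg _
    have h4 := cs_card univ (X u v) (∑ w, X u v w) q le_rfl h0 (by simp [ZMod.card])
    have h5 : (∑ w, X u v w) ^ 2 ≤ (q * m) ^ 2 := by
      calc _ ≤ _ := h4
        _ ≤ q * (m ^ 2 * q) := by gcongr
        _ = _ := by ring
    exact le_of_sq_le_sq h5 (by positivity)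
  have h6 : ∑ u, ∑ v, ∑ w, (L * X u v w + q) ≤ (q:ℝ) ^ 2 * (L * (q * m) + q * q) := by
    calc ∑ u, ∑ v, ∑ w, (L * X u v w + q) ≤ ∑ u : ZMod q, ∑ v : ZMod q, (L * (q * m) + q * q) := by
          refine sum_le_sum fun u _ => sum_le_sum fun v _ => ?_
          rw [sum_add_distrib, ← mul_sum]
          simp only [sum_const, card_univ, ZMod.card, nsmul_eq_mul]
          gcongr
          exact hsq u v
      _ = _ := by simp only [sum_const, card_univ, ZMod.card, nsmul_eq_mul]; ring
  have h7 : (M:ℝ) * q ^ 3 ≤ Q ^ 40 * ((q:ℝ) ^ 2 * (L * (q * m) + q * q)) :=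
    hTC.trans (mL h6 (by positivity))
  have h8 : (Q:ℝ) ^ 40 * ((q:ℝ) ^ 2 * (L * (q * m) + q * q)) = q ^ 3 * (q * L + Q ^ 40 * q) := by
    rw [hm]; field_simp
  rw [h8, mul_comm (M:ℝ)] at h7
  have h9 := cL h7 (by positivity)
  have h10 : (q:ℝ) * L ≤ K ^ 2 := by exact_mod_cast hqL
  have h11 : (M:ℝ) = 100 * K ^ 2 := by rw [← hM]; push_cast; ring
  have hK0 : (0:ℝ) < K := by
    have : 0 < K := lt_of_lt_of_le (by positivity) hK
    exact_mod_cast this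
  have h12 : (Q:ℝ) ^ 40 * q ≤ K ^ 2 := by
    have i1 : (q:ℝ) ≤ Q * K := by
      have : q ≤ Q * K := hqQ.trans (nmL _ hlK)
      exact_mod_cast this
    have i2 : (Q:ℝ) ^ 50 ≤ K := by exact_mod_cast hK
    have i3 : (Q:ℝ) ^ 41 ≤ Q ^ 50 := pow_le_pow_right₀ (by linarith) (by norm_num)
    calc (Q:ℝ) ^ 40 * q ≤ (Q:ℝ) ^ 40 * (Q * K) := by gcongr
      _ = (Q:ℝ) ^ 41 * K := by ring
      _ ≤ (K:ℝ) * K := by gcongr; linarith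
      _ = _ := by ring
  rw [h11] at h9
  nlinarith

noncomputable def Dl {M : ℕ} (K : ℕ) (f g : ZMod M → ℂ) : ZMod M → ℂ := fun x =>
  (K:ℂ)⁻¹ * ∑ y ∈ IC K, f (x - (y : ZMod M) ^ 2) * g (x - (y : ZMod M) ^ 2 + (y : ZMod M))

lemma Dl_bd {M : ℕ} (K : ℕ) (hK : 0 < K) (f g : ZMod M → ℂ) (hf : ∀ x, ‖f x‖ ≤ 1) (hg : ∀ x, ‖g x‖ ≤ 1) (x : ZMod M) :
    ‖Dl K f g x‖ ≤ 1 := by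
  unfold Dl
  have hK' : (0:ℝ) < K := by exact_mod_cast hK
  rw [norm_mul, norm_inv, Complex.norm_natCast, inv_mul_le_iff₀ hK', mul_one]
  refine (norm_sum_le _ _).trans ((slc _ _ 1 fun t _ => bd_mul (hf _) (hg _)).trans (by simp))

lemma Lam_Dl {M : ℕ} [NeZero M] (K : ℕ) (hK : 0 < K) (f g h : ZMod M → ℂ) :
    Lam K f g h = K * ∑ x, Dl K f g x * h x := by
  have hK' : (K:ℂ) ≠ 0 := by exact_mod_cast hK.ne'
  unfold Lam Dl
  simp only [mul_assoc, ← mul_sum]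
  rw [← mul_assoc, mul_inv_cancel₀ hK', one_mul]
  simp only [sum_mul]
  symm
  rw [sum_comm]
  refine sum_congr rfl fun y _ => ?_
  rw [← shiftZ _ ((y : ZMod M) ^ 2)]
  refine sum_congr rfl fun x _ => ?_
  rw [add_sub_cancel_right, mul_assoc]

lemma pigs {ι : Type*} (T : Finset ι) (hT : T.Nonempty) (F : ι → ℝ) : ∃ i ∈ T, ∑ i ∈ T, F i ≤ T.card * F i := by
  obtain ⟨i, hi, hmax⟩ := T.exists_max_image F hT
  exact ⟨i, hi, by rw [← nsmul_eq_mul]; exact slc _ _ _ hmax⟩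

lemma pigw {α ι : Type*} [DecidableEq ι] (S : Finset α) (T : Finset ι) (hT : T.Nonempty) (φ : α → ι)
    (hφ : ∀ a ∈ S, φ a ∈ T) (F : α → ℝ) : ∃ i ∈ T, ∑ a ∈ S, F a ≤ T.card * ∑ a ∈ S with φ a = i, F a := by
  rw [← sum_fiberwise_of_maps_to hφ]
  exact pigs T hT _

lemma pigc {α ι : Type*} [DecidableEq ι] (S : Finset α) (T : Finset ι) (hT : T.Nonempty) (φ : α → ι)
    (hφ : ∀ a ∈ S, φ a ∈ T) : ∃ i ∈ T, (S.card : ℝ) ≤ T.card * ((S.filter fun a => φ a = i).card : ℝ) := by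
  obtain ⟨i, hi, h⟩ := pigw S T hT φ hφ (fun _ => 1)
  exact ⟨i, hi, by simpa using h⟩

lemma sum_cyc {M : ℕ} [NeZero M] (D : ZMod M → ℂ) (H : ℤ → ℂ) (P : ℤ) (hP : P ≤ M)
    (hH : ∀ x, H x ≠ 0 → 0 ≤ x ∧ x < P) :
    ∑ x, D x * cyc M H x = ∑ n ∈ IZ P, D (n : ZMod M) * H n := by
  rw [sum_zmod_Ico _ 0, zero_add]
  have hMpos : (0:ℤ) < M := by exact_mod_cast NeZero.pos M
  rw [← sum_subset (Ico_subset_Ico_right hP)]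
  · refine sum_congr rfl fun n hn => ?_
    rw [mem_Ico] at hn
    rw [cyc_int H P hH n (by omega) (by omega)]
  · intro n hn hn'
    rw [mem_Ico] at hn hn'
    rw [cyc_int H P hH n (by omega) (by omega)]
    have : H n = 0 := by by_contra hc; exact hn' (hH n hc)
    rw [this]; simp

lemma Lam_HH {M : ℕ} [NeZero M] (K : ℕ) (hK : 0 < K) (f g : ZMod M → ℂ) (q L : ℕ) [NeZero q] (hqL : q * L ≤ M)
    (c : ZMod q → ℂ) (β : ZMod q → ℝ) :
    Lam K f g (cyc M (HH q L c β)) = K * ∑ r, c r * ∑ t ∈ IZ L,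
      Dl K f g (zc M (r.val + q * t)) * ee (β r * t) := by
  have hq : (0:ℤ) < q := by exact_mod_cast NeZero.pos q
  rw [Lam_Dl K hK, sum_cyc _ _ (q * L) (by exact_mod_cast hqL) (HH_supp q L c β), sum_block]
  congr 1
  refine sum_congr rfl fun r _ => ?_
  rw [mul_sum]
  refine sum_congr rfl fun t ht => ?_
  rw [mem_Ico] at ht
  have hv := ZMod.val_lt r
  have e1 : (((r.val:ℤ) + q * t : ℤ) : ZMod q) = r := by push_cast; simp
  have e2 : ((r.val:ℤ) + q * t) / (q:ℤ) = t := by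
    rw [Int.add_mul_ediv_left _ _ hq.ne', Int.ediv_eq_zero_of_lt (by omega) (by omega), zero_add]
  have e3 : 0 ≤ (r.val:ℤ) + q * t ∧ (r.val:ℤ) + q * t < q * L := by
    constructor
    · nlinarith
    · nlinarith
  unfold HH
  rw [if_pos e3, e1, e2]; ring

lemma Lam_HR {M : ℕ} [NeZero M] (K : ℕ) (hK : 0 < K) (f g : ZMod M → ℂ) (q L : ℕ) [NeZero q] (hqL : q * L ≤ M)
    (R : ZMod q → ℂ) (α : ℝ) :
    Lam K f g (cyc M (HR q L R α)) = K * ∑ r, R r * ∑ t ∈ IZ L,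
      Dl K f g (zc M (r.val + q * t)) * ee (α * (r.val + q * t : ℤ)) := by
  have hq : (0:ℤ) < q := by exact_mod_cast NeZero.pos q
  rw [Lam_Dl K hK, sum_cyc _ _ (q * L) (by exact_mod_cast hqL) (HR_supp q L R α), sum_block]
  congr 1
  refine sum_congr rfl fun r _ => ?_
  rw [mul_sum]
  refine sum_congr rfl fun t ht => ?_
  rw [mem_Ico] at ht
  have hv := ZMod.val_lt r
  have e1 : (((r.val:ℤ) + q * t : ℤ) : ZMod q) = r := by push_cast; simp
  have e3 : 0 ≤ (r.val:ℤ) + q * t ∧ (r.val:ℤ) + q * t < q * L := by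
    constructor
    · nlinarith
    · nlinarith
  unfold HR
  rw [if_pos e3, e1]; ring

lemma net1 {α : Type*} (G : Finset α) (β : α → ℝ) (βs ρ S : ℝ) (B : ℕ) (hS : 0 < S) (hB : ρ * S ≤ B)
    (hG : ∀ r ∈ G, nd (β r - βs) ≤ ρ) :
    ∃ γ : ℝ, (G.card : ℝ) ≤ (2 * B + 3 : ℕ) * ((G.filter fun r => nd (β r - γ) ≤ 1 / S).card : ℝ) := by
  classical
  set s : α → ℝ := fun r => (β r - βs) - round (β r - βs) with hs
  obtain ⟨i, -, hi⟩ := pigc G (Icc (-(B+1):ℤ) (B+1)) ⟨0, by simp; omega⟩ (fun r => round (S * s r)) (by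
    intro r hr
    have h1 : |s r| ≤ ρ := hG r hr
    have h2 : |S * s r| ≤ B := by
      rw [abs_mul, abs_of_pos hS]; nlinarith
    have h3 := abs_sub_round (S * s r)
    rw [abs_le] at h2 h3
    rw [mem_Icc]
    constructor
    · have : (-(B+1) : ℝ) ≤ round (S * s r) := by linarith
      exact_mod_cast this
    · have : (round (S * s r) : ℝ) ≤ B + 1 := by linarith
      exact_mod_cast this)
  refine ⟨βs + i / S, ?_⟩
  have hc : (Icc (-(B+1):ℤ) (B+1)).card = 2 * B + 3 := by rw [Int.card_Icc]; omega
  rw [hc] at hi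
  refine hi.trans (mL ?_ (by positivity))
  have : (G.filter fun a => round (S * s a) = i) ⊆ (G.filter fun r => nd (β r - (βs + i / S)) ≤ 1 / S) := by
    intro r hr
    rw [mem_filter] at hr ⊢
    refine ⟨hr.1, (nd_le _ (round (β r - βs))).trans ?_⟩
    have h3 := abs_sub_round (S * s r)
    rw [hr.2] at h3
    have h4 : β r - (βs + i / S) - round (β r - βs) = (S * s r - i) / S := by
      rw [hs]; field_simp; ring
    rw [h4, abs_div, abs_of_pos hS]
    gcongr; linarith
  exact_mod_cast card_le_card this

lemma pert (L : ℕ) (A : ℤ → ℂ) (hA : ∀ t, ‖A t‖ ≤ 1) (β γ : ℝ) :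
    ‖∑ t ∈ IZ L, A t * ee (β * t)‖ ≤ ‖∑ t ∈ IZ L, A t * ee (γ * t)‖ + 7 * L ^ 2 * nd (β - γ) := by
  have h : ∑ t ∈ IZ L, A t * ee (β * t) = ∑ t ∈ IZ L, A t * ee (γ * t) +
      ∑ t ∈ IZ L, A t * (ee (β * t) - ee (γ * t)) := by
    rw [← sum_add_distrib]; exact sum_congr rfl fun t _ => by ring
  rw [h]
  refine (norm_add_le _ _).trans (add_le_add le_rfl ?_)
  refine (norm_sum_le _ _).trans ((slc _ _ (7 * (L * nd (β - γ))) fun t ht => ?_).trans (le_of_eq ?_))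
  · rw [mem_Ico] at ht
    rw [norm_mul]
    have h1 := ee_sub_le (β * t) (γ * t)
    have h2 : nd (β * t - γ * t) ≤ L * nd (β - γ) := by
      rw [show β * t - γ * t = t * (β - γ) by ring]
      refine (nd_int_mul _ _).trans ?_
      have : |(t:ℝ)| ≤ L := by
        rw [abs_of_nonneg (by exact_mod_cast ht.1)]; exact_mod_cast ht.2.le
      exact mR this (nd_nonneg _)
    have h3 := hA t
    have h4 := norm_nonneg (ee (β * t) - ee (γ * t))
    nlinarith [norm_nonneg (A t)]
  · rw [Int.card_Ico, nsmul_eq_mul]; simp; ring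

structure Ctx (Q K M l q L : ℕ) : Prop where
  hQ : 2 ≤ Q
  hM : 100 * K ^ 2 = M
  hl : l.Prime
  hlq : l ∣ q
  hl2 : l ≠ 2
  hqQ : q ≤ Q * l
  hlK : l ≤ K
  hKl : K ≤ Q * l
  hL : 0 < L
  hqL : q * L ≤ K ^ 2
  hKq : K ^ 2 ≤ Q * (q * L)

lemma Ctx.mono {Q Q' K M l q L : ℕ} (h : Ctx Q K M l q L) (hQ : Q ≤ Q') : Ctx Q' K M l q L :=
  ⟨h.hQ.trans hQ, h.hM, h.hl, h.hlq, h.hl2, h.hqQ.trans (nmR _ hQ), h.hlK,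
    h.hKl.trans (nmR _ hQ), h.hL, h.hqL, h.hKq.trans (nmR _ hQ)⟩

noncomputable def phs (z : ℂ) : ℂ := conj z / (‖z‖ : ℂ)

lemma phs_mul (z : ℂ) : phs z * z = (‖z‖ : ℂ) := by
  unfold phs
  by_cases h : z = 0
  · simp [h]
  · have : (‖z‖ : ℂ) ≠ 0 := by exact_mod_cast norm_ne_zero_iff.2 h
    rw [div_mul_eq_mul_div, Complex.conj_mul', sq, mul_div_assoc, div_self this, mul_one]

lemma phs_bd (z : ℂ) : ‖phs z‖ ≤ 1 := by
  unfold phs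
  rw [norm_div, RCLike.norm_conj, Complex.norm_real, norm_norm]
  exact div_self_le_one _

lemma cpow {Q : ℝ} (hQ : 2 ≤ Q) {c : ℝ} {b n : ℕ} (a : ℕ) (hc : c ≤ 2 ^ a) (h : a + b ≤ n) : c * Q ^ b ≤ Q ^ n := by
  have hQ0 : 0 ≤ Q := by linarith
  calc c * Q ^ b ≤ Q ^ a * Q ^ b := by
        refine mR (hc.trans ?_) (pow_nonneg hQ0 _)
        exact pL (by norm_num) hQ _
    _ = Q ^ (a + b) := (pow_add _ _ _).symm
    _ ≤ Q ^ n := pow_le_pow_right₀ (by linarith) h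

/-- from a bound on the mean to a large set -/
lemma popular {α : Type*} (S : Finset α) (m : α → ℝ) (p : α → Prop) [DecidablePred p] (Q L N : ℝ) (hQ : 0 < Q) (hL : 0 < L)
    (hN : (S.card : ℝ) ≤ N)
    (hp : ∀ r ∈ S, ¬ p r → 2 * Q * m r ≤ L) (h : N * L ≤ Q * ∑ r ∈ S, m r) : N * L ≤ 2 * Q * ∑ r ∈ S with p r, m r := by
  rw [← sum_filter_add_sum_filter_not S p] at h
  have h1 : ∑ r ∈ S with ¬ p r, (2 * Q * m r) ≤ N * L := by
    refine (slc _ _ L fun r hr => hp r (mem_filter.1 hr).1 (mem_filter.1 hr).2).trans ?_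
    rw [nsmul_eq_mul]
    refine mR (le_trans ?_ hN) hL.le
    exact_mod_cast card_filter_le _ _
  rw [← mul_sum] at h1
  nlinarith

lemma Ctx.real {Q K M l q L : ℕ} (h : Ctx Q K M l q L) : (2:ℝ) ≤ Q ∧ (M:ℝ) = 100 * K ^ 2 ∧ (0:ℝ) < L ∧ (q:ℝ) * L ≤ K ^ 2 ∧
    (K:ℝ) ^ 2 ≤ Q * (q * L) := by
  refine ⟨by exact_mod_cast h.hQ, by rw [← h.hM]; push_cast; ring, by exact_mod_cast h.hL, by exact_mod_cast h.hqL, by exact_mod_cast h.hKq⟩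

lemma LemPa (Q K M l q L : ℕ) [NeZero M] [NeZero q] (cx : Ctx Q K M l q L) (hK : Q ^ 300 ≤ K)
    (f g : ZMod M → ℂ) (hf : ∀ x, ‖f x‖ ≤ 1)
    (hg : ∀ x, ‖g x‖ ≤ 1) (c : ZMod q → ℂ) (β : ZMod q → ℝ) (hc : ∀ r, ‖c r‖ ≤ 1)
    (H : (q:ℝ) * L ≤ Q * ‖∑ r, c r * ∑ t ∈ IZ L, Dl K f g (zc M (r.val + q * t)) * ee (β r * t)‖) :
    ∃ γ : ℝ, (q:ℝ) ≤ Q ^ 900 * ((univ.filter fun r : ZMod q => c r ≠ 0 ∧ nd (β r - γ) ≤ 1 / L ∧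
      (L:ℝ) ≤ Q ^ 900 * ‖∑ t ∈ IZ L, Dl K f g (zc M (r.val + q * t)) * ee (γ * t)‖).card : ℝ) := by
  classical
  obtain ⟨hQr, hMr, hLr, hqLr, hKqr⟩ := cx.real
  have hQ0 : (0:ℝ) < Q := by linarith
  have hQ1 : (1:ℝ) ≤ Q := by linarith
  have hqpos : (0:ℝ) < q := by exact_mod_cast NeZero.pos q
  have hKpos : 0 < K := lt_of_lt_of_le (Nat.pow_pos (by have := cx.hQ; omega)) hK
  have hKr : (0:ℝ) < K := by exact_mod_cast hKpos
  set D := Dl K f g with hD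
  have hD1 : ∀ x, ‖D x‖ ≤ 1 := Dl_bd K hKpos f g hf hg
  set S : ZMod q → ℝ → ℂ := fun r γ => ∑ t ∈ IZ L, D (zc M (r.val + q * t)) * ee (γ * t) with hS
  set m : ZMod q → ℝ := fun r => if c r = 0 then 0 else ‖S r (β r)‖ with hm
  have hqM : q * L ≤ M := by rw [← cx.hM]; exact cx.hqL.trans (by nlinarith)
  have h1 : (q:ℝ) * L ≤ Q * ∑ r, m r := by
    refine H.trans (mL ((norm_sum_le _ _).trans (sum_le_sum fun r _ => ?_)) hQ0.le)
    simp only [hm]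
    split_ifs with h
    · rw [h]; simp
    · rw [norm_mul]; exact mul_le_of_le_one_left (norm_nonneg _) (hc r)
  have h2 := popular univ m (fun r => c r ≠ 0 ∧ L ≤ 2 * Q * m r) Q L q hQ0 hLr (by simp [ZMod.card]) (by
    intro r _ hr
    by_cases h : c r = 0
    · simp only [hm, h, if_true]; simpa using hLr.le
    · have : ¬ (L ≤ 2 * Q * m r) := fun h' => hr ⟨h, h'⟩
      linarith) h1
  set G := univ.filter fun r => c r ≠ 0 ∧ L ≤ 2 * Q * m r with hG
  have hmG : ∀ r ∈ G, m r = ‖S r (β r)‖ ∧ (L:ℝ) ≤ 2 * Q * ‖S r (β r)‖ ∧ c r ≠ 0 := by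
    intro r hr
    rw [hG, mem_filter] at hr
    have : m r = ‖S r (β r)‖ := by simp only [hm, if_neg hr.2.1]
    exact ⟨this, this ▸ hr.2.2, hr.2.1⟩
  set c' : ZMod q → ℂ := fun r => if r ∈ G then phs (S r (β r)) else 0 with hc'
  have hc'1 : ∀ r, ‖c' r‖ ≤ 1 := by
    intro r; simp only [hc']; split_ifs
    · exact phs_bd _
    · simp
  have hc'G : ∀ r, c' r ≠ 0 → r ∈ G := by
    intro r; simp only [hc']; split_ifs with h
    · exact fun _ => h
    · simp
  have h3 : Lam K f g (cyc M (HH q L c' β)) = ((K * ∑ r ∈ G, m r : ℝ) : ℂ) := by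
    rw [Lam_HH K hKpos f g q L hqM]
    simp only [Complex.ofReal_mul, Complex.ofReal_sum, Complex.ofReal_natCast]
    congr 1
    rw [← sum_filter_add_sum_filter_not univ (fun r => r ∈ G), filter_mem_eq_inter, univ_inter]
    rw [sum_eq_zero (s := univ.filter fun r => r ∉ G), add_zero]
    · refine sum_congr rfl fun r hr => ?_
      simp only [hc', if_pos hr]
      rw [(hmG r hr).1]; exact phs_mul _
    · intro r hr
      simp only [hc', if_neg (mem_filter.1 hr).2, zero_mul]
  have h4 : (M:ℝ) * K ≤ (Q ^ 10 : ℕ) * ‖Lam K f g (cyc M (HH q L c' β))‖ := by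
    have hnn : 0 ≤ ∑ r ∈ G, m r := sum_nonneg fun r hr => by rw [(hmG r hr).1]; exact norm_nonneg _
    rw [h3, Complex.norm_real, Real.norm_eq_abs, abs_of_nonneg (by positivity), hMr]
    have e1 : (200:ℝ) * Q ^ 2 ≤ Q ^ 10 := by
      exact cpow hQr 8 (by norm_num) (by norm_num)
    have e2 : 100 * (K:ℝ) ^ 2 ≤ 200 * Q ^ 2 * ∑ r ∈ G, m r := by nlinarith
    push_cast
    calc 100 * (K:ℝ) ^ 2 * K ≤ (200 * Q ^ 2 * ∑ r ∈ G, m r) * K := by gcongr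
      _ ≤ ((Q:ℝ) ^ 10 * ∑ r ∈ G, m r) * K := by gcongr
      _ = _ := by ring
  have cx' := cx.mono (Q' := Q ^ 10) (nsp (by norm_num) _)
  obtain ⟨βs, hβ⟩ := TCi (Q ^ 10) K M l q L cx'.hQ (by rw [← pow_mul]; exact hK) cx.hM cx.hl cx.hlq cx.hl2 cx'.hqQ cx.hlK
    cx'.hKl cx.hL cx.hqL f g hf hg c' β hc'1 h4
  push_cast at hβ
  rw [← pow_mul, ← pow_mul] at hβ
  set G1 := univ.filter fun r => c' r ≠ 0 ∧ nd (β r - βs) ≤ (Q:ℝ) ^ (10 * 41) / L with hG1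
  obtain ⟨γ, hγ⟩ := net1 G1 β βs ((Q:ℝ) ^ (10 * 41) / L) (28 * Q * L) (28 * Q ^ 411) (by positivity) (by
    push_cast
    apply le_of_eq; field_simp) (fun r hr => (mem_filter.1 hr).2.2)
  refine ⟨γ, ?_⟩
  have h5 : ((G1.filter fun r => nd (β r - γ) ≤ 1 / (28 * Q * L)).card : ℝ) ≤
     ((univ.filter fun r : ZMod q => c r ≠ 0 ∧ nd (β r - γ) ≤ 1 / L ∧
      (L:ℝ) ≤ Q ^ 900 * ‖∑ t ∈ IZ L, D (zc M (r.val + q * t)) * ee (γ * t)‖).card : ℝ) := by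
    refine Nat.cast_le.2 (card_le_card ?_)
    intro r hr
    rw [mem_filter, hG1, mem_filter] at hr
    obtain ⟨⟨-, hr1, hr2⟩, hr3⟩ := hr
    obtain ⟨-, k2, k3⟩ := hmG r (hc'G r hr1)
    rw [mem_filter]
    refine ⟨mem_univ _, k3, hr3.trans ?_, ?_⟩
    · apply one_div_le_one_div_of_le hLr
      have : (1:ℝ) ≤ 28 * Q := by linarith
      exact le_mul_of_one_le_left hLr.le this
    · have hp := pert L (fun t => D (zc M (r.val + q * t))) (fun t => hD1 _) (β r) γ
      have e1 : 7 * (L:ℝ) ^ 2 * nd (β r - γ) ≤ L / (4 * Q) := by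
        calc 7 * (L:ℝ) ^ 2 * nd (β r - γ) ≤ 7 * (L:ℝ) ^ 2 * (1 / (28 * Q * L)) := by gcongr
          _ = (L:ℝ) / (4 * Q) := by field_simp; norm_num
      set Y := ‖∑ t ∈ IZ L, D (zc M (r.val + q * t)) * ee (γ * t)‖ with hY
      have e2 : ‖S r (β r)‖ ≤ Y + L / (4 * Q) := hp.trans (add_le_add le_rfl e1)
      have e3 : (L:ℝ) ≤ 2 * Q * (Y + L / (4 * Q)) := k2.trans (by gcongr)
      have e4 : 2 * Q * (Y + L / (4 * Q)) = 2 * Q * Y + L / 2 := by field_simp; ring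
      have e5 : (L:ℝ) ≤ 4 * Q * Y := by linarith
      have e6 : 4 * (Q:ℝ) ≤ Q ^ 900 := by
        simpa using cpow hQr (b := 1) (n := 900) 2 (by norm_num : (4:ℝ) ≤ 2 ^ 2) (by norm_num)
      exact e5.trans (mR e6 (norm_nonneg _))
  have h6 : ((2 * (28 * Q ^ 411) + 3 : ℕ) : ℝ) ≤ Q ^ 420 := by
    push_cast
    have : (1:ℝ) ≤ Q ^ 411 := one_le_pow₀ hQ1
    have := cpow hQr (b := 411) (n := 420) 6 (by norm_num : (59:ℝ) ≤ 2 ^ 6) (by norm_num)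
    linarith
  set Z := ((univ.filter fun r : ZMod q => c r ≠ 0 ∧ nd (β r - γ) ≤ 1 / L ∧
      (L:ℝ) ≤ Q ^ 900 * ‖∑ t ∈ IZ L, D (zc M (r.val + q * t)) * ee (γ * t)‖).card : ℝ) with hZ
  calc (q:ℝ) ≤ (Q:ℝ) ^ (10 * 44) * (G1.card : ℝ) := hβ
    _ ≤ (Q:ℝ) ^ (10 * 44) * ((Q:ℝ) ^ 420 * Z) := by
      refine mL (hγ.trans ?_) (pow_nonneg hQ0.le _)
      exact mul_le_mul h6 h5 (Nat.cast_nonneg _) (pow_nonneg hQ0.le _)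
    _ = (Q:ℝ) ^ 860 * Z := by rw [← mul_assoc, ← pow_add]
    _ ≤ (Q:ℝ) ^ 900 * Z := mR (pow_le_pow_right₀ hQ1 (by norm_num)) (Nat.cast_nonneg _)

lemma LemPb (Q K M l q L : ℕ) [NeZero M] [NeZero q] (cx : Ctx Q K M l q L) (hK : Q ^ 600 ≤ K)
    (f g : ZMod M → ℂ) (hf : ∀ x, ‖f x‖ ≤ 1)
    (hg : ∀ x, ‖g x‖ ≤ 1) (γ : ℝ) (G : Finset (ZMod q)) (hG : (q:ℝ) ≤ Q * G.card)
    (H : ∀ r ∈ G, (L:ℝ) ≤ Q * ‖∑ t ∈ IZ L, Dl K f g (zc M (r.val + q * t)) * ee (γ * t)‖) :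
    ∃ (α : ℝ) (ξ : ℤ), q * α = γ - ξ ∧
      (q:ℝ) * L ≤ Q ^ 440 * ‖∑ n ∈ IZ (q * L), Dl K f g (n : ZMod M) * ee (α * n)‖ := by
  classical
  obtain ⟨hQr, hMr, hLr, hqLr, hKqr⟩ := cx.real
  have hQ0 : (0:ℝ) < Q := by linarith
  have hqpos : (0:ℝ) < q := by exact_mod_cast NeZero.pos q
  have hKpos : 0 < K := lt_of_lt_of_le (Nat.pow_pos (by have := cx.hQ; omega)) hK
  have hKr : (0:ℝ) < K := by exact_mod_cast hKpos
  set D := Dl K f g with hD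
  have hD1 : ∀ x, ‖D x‖ ≤ 1 := Dl_bd K hKpos f g hf hg
  have hqM : q * L ≤ M := by rw [← cx.hM]; exact cx.hqL.trans (by nlinarith)
  set S : ZMod q → ℝ → ℂ := fun r α => ∑ t ∈ IZ L, D (zc M (r.val + q * t)) * ee (α * (r.val + q * t : ℤ)) with hS
  set α0 : ℝ := γ / q with hα0
  have hSn : ∀ r, ‖S r α0‖ = ‖∑ t ∈ IZ L, D (zc M (r.val + q * t)) * ee (γ * t)‖ := by
    intro r
    have : S r α0 = ee (α0 * r.val) * ∑ t ∈ IZ L, D (zc M (r.val + q * t)) * ee (γ * t) := by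
      simp only [hS, mul_sum]
      refine sum_congr rfl fun t _ => ?_
      have e : α0 * ((r.val + q * t : ℤ) : ℝ) = α0 * r.val + γ * t := by
        push_cast; simp only [hα0]; field_simp
      rw [e, ee_add]; ring
    rw [this, norm_mul, norm_ee, one_mul]
  have hSb : ∀ r, ‖S r α0‖ ≤ L := by
    intro r
    refine (norm_sum_le _ _).trans ((slc _ _ 1 fun t _ => ?_).trans (by simp))
    rw [norm_mul, norm_ee, mul_one]; exact hD1 _
  set R : ZMod q → ℂ := fun r => conj (S r α0) / L with hR
  have hR1 : ∀ r, ‖R r‖ ≤ 1 := by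
    intro r
    simp only [hR]
    rw [norm_div, RCLike.norm_conj, Complex.norm_natCast, div_le_one hLr]; exact hSb r
  have h3 : Lam K f g (cyc M (HR q L R α0)) = ((K * ∑ r, ‖S r α0‖ ^ 2 / L : ℝ) : ℂ) := by
    rw [Lam_HR K hKpos f g q L hqM]
    simp only [Complex.ofReal_mul, Complex.ofReal_sum, Complex.ofReal_natCast]
    congr 1
    refine sum_congr rfl fun r _ => ?_
    change conj (S r α0) / L * S r α0 = _
    rw [div_mul_eq_mul_div, Complex.conj_mul']; push_cast; rfl
  have h4 : (M:ℝ) * K ≤ (Q ^ 11 : ℕ) * ‖Lam K f g (cyc M (HR q L R α0))‖ := by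
    rw [h3, Complex.norm_real, Real.norm_eq_abs, abs_of_nonneg (by positivity), hMr]
    have e0 : (q:ℝ) * L ≤ Q ^ 3 * ∑ r, ‖S r α0‖ ^ 2 / L := by
      have k1 : ∑ r ∈ G, (L:ℝ) / Q ^ 2 ≤ ∑ r, ‖S r α0‖ ^ 2 / L := by
        refine (sum_le_sum fun r hr => ?_).trans (sum_le_sum_of_subset_of_nonneg (subset_univ _) fun _ _ _ => by positivity)
        have := H r hr
        rw [← hSn] at this
        have h2 : (L:ℝ) ^ 2 ≤ Q ^ 2 * ‖S r α0‖ ^ 2 := by rw [← mul_pow]; gcongr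
        rw [div_le_div_iff₀ (by positivity) hLr]; linarith
      rw [sum_const, nsmul_eq_mul] at k1
      calc (q:ℝ) * L ≤ (Q * G.card) * L := by gcongr
        _ = (Q:ℝ) ^ 3 * (G.card * (L / Q ^ 2)) := by field_simp
        _ ≤ _ := by gcongr
    have hnn : 0 ≤ ∑ r, ‖S r α0‖ ^ 2 / L := sum_nonneg fun _ _ => by positivity
    have e1 : (100:ℝ) * Q ^ 4 ≤ Q ^ 11 := cpow hQr 7 (by norm_num) (by norm_num)
    have e2 : 100 * (K:ℝ) ^ 2 ≤ (100 * Q ^ 4) * ∑ r, ‖S r α0‖ ^ 2 / L := by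
      calc 100 * (K:ℝ) ^ 2 ≤ 100 * (Q * (q * L)) := by gcongr
        _ ≤ 100 * (Q * (Q ^ 3 * ∑ r, ‖S r α0‖ ^ 2 / L)) := by gcongr
        _ = _ := by ring
    push_cast
    calc 100 * (K:ℝ) ^ 2 * K ≤ ((100 * Q ^ 4) * ∑ r, ‖S r α0‖ ^ 2 / L) * K := by gcongr
      _ ≤ ((Q:ℝ) ^ 11 * ∑ r, ‖S r α0‖ ^ 2 / L) * K := by gcongr
      _ = _ := by ring
  have cx' := cx.mono (Q' := Q ^ 11) (nsp (by norm_num) _)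
  obtain ⟨ξ, hξ⟩ := TCii (Q ^ 11) K M l q L cx'.hQ (by
    rw [← pow_mul]; exact (npR (by have := cx.hQ; omega) (by norm_num)).trans hK) cx.hM cx.hl cx.hlq cx.hl2 cx'.hqQ cx.hlK
    cx'.hKl cx.hL cx.hqL f g hf hg R α0 hR1 h4
  push_cast at hξ
  rw [← pow_mul] at hξ
  refine ⟨α0 - ξ.val / q, ξ.val, by push_cast; simp only [hα0]; field_simp, ?_⟩
  have e3 : ∑ n ∈ IZ (q * L), D (n : ZMod M) * ee ((α0 - ξ.val / q) * n) = L * conj (∑ r, R r * ch ξ r) := by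
    rw [sum_block, map_sum, mul_sum]
    refine sum_congr rfl fun r _ => ?_
    simp only [hR, map_mul, map_div₀, Complex.conj_conj, Complex.conj_natCast]
    have hL0 : (L:ℂ) ≠ 0 := by exact_mod_cast hLr.ne'
    rw [← mul_assoc, mul_div_cancel₀ _ hL0]
    simp only [hS, sum_mul]
    refine sum_congr rfl fun t _ => ?_
    have e : (α0 - ξ.val / q) * ((r.val + q * t : ℤ) : ℝ) = α0 * ((r.val + q * t : ℤ) : ℝ) + -(ξ.val / q * r.val) + ((-(ξ.val * t) : ℤ) : ℝ) := by
      push_cast; field_simp; ring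
    rw [e, ee_add_int, ee_add, ee_neg, ch_eq]; ring
  rw [e3, norm_mul, Complex.norm_natCast, RCLike.norm_conj]
  calc (q:ℝ) * L ≤ ((Q:ℝ) ^ (11 * 40) * ‖∑ r, R r * ch ξ r‖) * L := mR hξ hLr.le
    _ = _ := by ring

lemma LemP : ∃ n : ℕ, ∀ (Q K M l q L : ℕ) [NeZero M] [NeZero q] (cx : Ctx Q K M l q L) (hK : Q ^ n ≤ K)
    (f g : ZMod M → ℂ) (hf : ∀ x, ‖f x‖ ≤ 1)
    (hg : ∀ x, ‖g x‖ ≤ 1) (c : ZMod q → ℂ) (β : ZMod q → ℝ) (hc : ∀ r, ‖c r‖ ≤ 1)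
    (H : (q:ℝ) * L ≤ Q * ‖∑ r, c r * ∑ t ∈ IZ L, Dl K f g (zc M (r.val + q * t)) * ee (β r * t)‖),
    ∃ α : ℝ, (q:ℝ) * L ≤ (Q ^ n : ℕ) * ‖∑ n ∈ IZ (q * L), Dl K f g (n : ZMod M) * ee (α * n)‖ ∧
     (q:ℝ) ≤ (Q ^ n : ℕ) * ((univ.filter fun r : ZMod q => c r ≠ 0 ∧ nd (β r - q * α) ≤ 1 / L).card : ℝ) := by
  obtain ⟨n, hn⟩ : ∃ n, n = 900 * 600 := ⟨_, rfl⟩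
  refine ⟨n, ?_⟩
  intro Q K M l q L _ _ cx hK f g hf hg c β hc H
  have hQp : 0 < Q := by have := cx.hQ; omega
  have hQ1 : (1:ℝ) ≤ Q := by exact_mod_cast hQp
  obtain ⟨γ, hγ⟩ := LemPa Q K M l q L cx ((npR hQp (by omega)).trans hK) f g hf hg c β hc H
  have cx' := cx.mono (Q' := Q ^ 900) (nsp (by norm_num) _)
  have hc900 : ((Q ^ 900 : ℕ) : ℝ) = (Q:ℝ) ^ 900 := Nat.cast_pow _ _
  obtain ⟨α, ξ, h1, h2⟩ := LemPb (Q ^ 900) K M l q L cx' (by rw [← pow_mul, ← hn]; exact hK) f g hf hg γ _ (by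
    rw [hc900]; exact hγ) (by
    intro r hr
    rw [hc900]
    exact (mem_filter.1 hr).2.2.2)
  refine ⟨α, h2.trans (mR ?_ (norm_nonneg _)), hγ.trans (mul_le_mul ?_ (Nat.cast_le.2 (card_le_card ?_)) (Nat.cast_nonneg _) (Nat.cast_nonneg _))⟩
  · rw [← Nat.cast_pow, ← pow_mul]
    exact Nat.cast_le.2 (npR hQp (by omega))
  · rw [← Nat.cast_pow]
    exact Nat.cast_le.2 (npR hQp (by omega))
  · intro r hr
    obtain ⟨-, a, b, -⟩ := mem_filter.1 hr
    refine mem_filter.2 ⟨mem_univ _, a, ?_⟩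
    rw [h1, ← sub_add, nd_add_int]; exact b

lemma Aexists (K Q : ℕ) (hQ : 2 ≤ Q) (hK : Q ^ 200 ≤ K) : ∃ A : ℕ, 1 ≤ A ∧ A ≤ K ∧ K ≤ Q ^ 4 * A ∧ 4 * A * Q ≤ K := by
  have h1 : 4 * Q ≤ K := by
    refine le_trans ?_ hK
    calc 4 * Q = 2 ^ 2 * Q := by norm_num
      _ ≤ Q ^ 2 * Q := nmR _ (npL hQ 2)
      _ = Q ^ 3 := by ring
      _ ≤ Q ^ 200 := npR (by omega) (by norm_num)
  have hA1 : 1 ≤ K / (4 * Q) := (Nat.one_le_div_iff (by omega)).2 h1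
  refine ⟨K / (4 * Q), hA1, Nat.div_le_self _ _, ?_, ?_⟩
  · have h2 := Nat.div_add_mod K (4 * Q)
    have h3 := Nat.mod_lt K (show 4 * Q > 0 by omega)
    have h4 : 8 * Q ≤ Q ^ 4 := by
      calc 8 * Q = 2 ^ 3 * Q := by norm_num
        _ ≤ Q ^ 3 * Q := nmR _ (npL hQ 3)
        _ = Q ^ 4 := by ring
    calc K ≤ 4 * Q * (K / (4 * Q)) + 4 * Q := by omega
      _ ≤ 4 * Q * (K / (4 * Q)) + 4 * Q * (K / (4 * Q)) := Nat.add_le_add_left (Nat.le_mul_of_pos_right _ hA1) _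
      _ = 8 * Q * (K / (4 * Q)) := by ring
      _ ≤ _ := nmR _ h4
  · have := Nat.div_mul_le_self K (4 * Q)
    linarith

/-- Lemma M -/
lemma LemM (Q K M : ℕ) [NeZero M] (hQ : 2 ≤ Q) (hK : Q ^ 200 ≤ K)
    (f g : ZMod M → ℂ) (hf : ∀ x, ‖f x‖ ≤ 1) (hg : ∀ x, ‖g x‖ ≤ 1) (j : ZMod M)
    (H : (M:ℝ) * K ≤ Q * ‖Lam K f g (ch j)‖) :
    ∃ v : ℕ, 1 ≤ v ∧ v ≤ Q ^ 201 ∧ nd (v * (j.val / M : ℝ)) ≤ Q ^ 201 / K ^ 2 := by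
  obtain ⟨A, hA1, hAK, hKA, hAQ⟩ := Aexists K Q hQ hK
  have hQr : (2:ℝ) ≤ Q := by exact_mod_cast hQ
  have hMp : (0:ℝ) < M := by exact_mod_cast NeZero.pos M
  have h1 := vdc_pair (X := ZMod M) K Q A ({()} : Finset Unit) (range A) (fun i => (i:ℤ)) (by
      intro i hi
      rw [mem_range] at hi
      push_cast
      rw [abs_of_nonneg (by positivity)]; exact_mod_cast hi.le) (fun _ x => f x * ch j x)
    (fun _ x y => g (x + (y : ZMod M)) * ch j ((y : ZMod M) ^ 2))
    (fun _ x => bd_mul (hf x) (norm_ch j x).le) (fun _ x y => bd_mul (hg _) (norm_ch j _).le)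
    (by linarith) (by exact_mod_cast hAQ) (by
      simp only [card_singleton, sum_singleton, ZMod.card]
      rw [Nat.cast_one, mul_one]
      refine H.trans (le_of_eq ?_)
      congr 2
      unfold Lam
      refine sum_congr rfl fun y _ => sum_congr rfl fun x _ => ?_
      rw [ch_add]; ring)
  set φ : ℝ := 2 * (j.val / M : ℝ) with hφ
  set b : ℕ → ℕ → ℝ := fun a a' => ‖∑ y ∈ Ico (1:ℤ) (K + 1), ee (-(φ * (a' - a)) * y + 0)‖ with hb
  have hIc : IC K = Ico (1:ℤ) (K + 1) := by ext; simp [Int.lt_add_one_iff]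
  have h2 : ∀ a a' : ℕ, ‖∑ y ∈ IC K, ∑ x : ZMod M, (g (x + (zc M (y + a))) * ch j ((zc M (y + a)) ^ 2)) *
      conj (g (x + (zc M (y + a'))) * ch j ((zc M (y + a')) ^ 2))‖ ≤ M * b a a' := by
    intro a a'
    have e : ∀ y ∈ IC K, ∑ x : ZMod M, (g (x + (zc M (y + a))) * ch j ((zc M (y + a)) ^ 2)) *
      conj (g (x + (zc M (y + a'))) * ch j ((zc M (y + a')) ^ 2)) =
      (∑ x : ZMod M, g (x + (a : ZMod M)) * conj (g (x + (a' : ZMod M)))) * ch j ((a : ZMod M) ^ 2 - (a' : ZMod M) ^ 2) *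
       ee (-(φ * (a' - a)) * y + 0) := by
      intro y _
      rw [← shiftZ (fun x => g (x + (a : ZMod M)) * conj (g (x + (a' : ZMod M)))) (y : ZMod M), sum_mul, sum_mul]
      refine sum_congr rfl fun x _ => ?_
      have e1 : ch j ((zc M (y + a)) ^ 2) * conj (ch j ((zc M (y + a')) ^ 2)) =
          ch j ((a : ZMod M) ^ 2 - (a' : ZMod M) ^ 2) * ee (-(φ * (a' - a)) * y + 0) := by
        have : ee (-(φ * (a' - a)) * y + 0) = ch j (zc M (2 * (a - a') * y)) := by
          rw [ch_int]; congr 1; push_cast; rw [hφ]; ring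
        rw [this, ← ch_neg, ← ch_add, ← ch_add]
        congr 1; push_cast; ring
      rw [map_mul, mul_assoc _ (ch j _) (ee _), ← e1]
      push_cast
      simp only [add_assoc]; ring
    rw [sum_congr rfl e, ← mul_sum, norm_mul, norm_mul, norm_ch, mul_one, hIc]
    refine mR ?_ (norm_nonneg _)
    refine (norm_sum_le _ _).trans ((slc _ _ 1 fun x _ => bd_mul (hg _) (bd_conj (hg _))).trans ?_)
    simp [ZMod.card]
  have h3 : (M:ℝ) * ((K:ℝ) * A ^ 2) ≤ M * ((Q ^ 4 : ℕ) * ∑ a ∈ range A, ∑ a' ∈ range A, b a a') := by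
    simp only [card_product, card_singleton, card_range, ZMod.card, sum_product, sum_singleton] at h1
    push_cast at h1 ⊢
    calc (M:ℝ) * (K * A ^ 2) = M * K * (1 * (A * A)) := by ring
      _ ≤ _ := h1
      _ ≤ 4 * (Q:ℝ) ^ 2 * ∑ a ∈ range A, ∑ a' ∈ range A, M * b a a' := by
        gcongr with a _ a' _
        have := h2 a a'
        push_cast at this
        exact this
      _ = M * (4 * (Q:ℝ) ^ 2 * ∑ a ∈ range A, ∑ a' ∈ range A, b a a') := by simp only [← mul_sum]; ring
      _ ≤ _ := by
        gcongr
        · exact cpow hQr 2 (by norm_num) (by norm_num)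
  obtain ⟨v, hv1, hv2, hv3⟩ := AL2 K A (Q ^ 4) (hQ.trans (nsp (by norm_num) _)) (by rw [← pow_mul]; exact hK) hKA hAK φ b (by
      intro a a'
      refine (norm_sum_le _ _).trans ((slc _ _ 1 fun x _ => (norm_ee _).le).trans ?_)
      simp) (by
      intro a a'
      have := geo_Ico (-(φ * (a' - a))) 0 1 (K + 1)
      rw [nd_neg] at this; exact this) (cL h3 hMp)
  have hpow : Q ^ 200 * 2 ≤ Q ^ 201 := by rw [pow_succ]; exact nmL _ hQ
  refine ⟨2 * v, by omega, ?_, ?_⟩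
  · have hv2' : v ≤ Q ^ 200 := by rw [← pow_mul] at hv2; exact hv2
    omega
  · have e : ((2 * v : ℕ) : ℝ) * (j.val / M : ℝ) = v * φ := by rw [hφ]; push_cast; ring
    rw [e]
    refine hv3.trans ?_
    rw [Nat.cast_pow, ← pow_mul]
    exact div_le_div_of_nonneg_right (pow_le_pow_right₀ (by linarith) (by norm_num)) (by positivity)

lemma Ico_Icc (F : ℤ → ℂ) (P : ℕ) : ∑ n ∈ IZ P, F n = ∑ y ∈ IC P, F (y - 1) := by
  refine sum_nbij' (fun n => n + 1) (fun y => y - 1) ?_ ?_ ?_ ?_ ?_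
  · intro n hn; rw [mem_Ico] at hn; rw [mem_Icc]; omega
  · intro n hn; rw [mem_Icc] at hn; rw [mem_Ico]; omega
  · intro n _; ring
  · intro n _; ring
  · intro n _; rw [add_sub_cancel_right]

lemma shift_sum0 (F : ℤ → ℂ) (hF : ∀ x, ‖F x‖ ≤ 1) (K : ℕ) (s : ℤ) :
    ‖∑ y ∈ IZ K, F y - ∑ y ∈ IZ K, F (y + s)‖ ≤ 2 * |(s:ℝ)| := by
  rw [Ico_Icc, Ico_Icc]
  have := shift_sum (fun y => F (y - 1)) (fun _ => hF _) K s
  convert this using 6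
  ring

lemma Smooth (Q M P : ℕ) [NeZero M] (hQ : 2 ≤ Q) (hP : P ≤ M) (hM : 4 * Q ≤ M) (D : ZMod M → ℂ) (hD : ∀ x, ‖D x‖ ≤ 1) (α : ℝ)
    (H : (M:ℝ) ≤ Q * ‖∑ n ∈ IZ P, D (n : ZMod M) * ee (α * n)‖) :
    ∃ j : ZMod M, (M:ℝ) ≤ (Q:ℝ) ^ 5 * ‖∑ x, D x * ch j x‖ := by
  by_contra hcon
  push Not at hcon
  have hQr : (2:ℝ) ≤ Q := by exact_mod_cast hQ
  have hQ0 : (0:ℝ) < Q := by linarith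
  have hMr : (0:ℝ) < M := by exact_mod_cast NeZero.pos M
  set S := M / (4 * Q) with hS
  have hS1 : 1 ≤ S := (Nat.one_le_div_iff (by omega)).2 hM
  have hS2 : 4 * Q * S ≤ M := Nat.mul_div_le _ _
  have hS3 : M ≤ 8 * Q * S := by
    have h2 := Nat.div_add_mod M (4 * Q)
    have h3 := Nat.mod_lt M (show 4 * Q > 0 by omega)
    calc M ≤ 4 * Q * S + 4 * Q := by rw [← hS] at h2; linarith
      _ ≤ 4 * Q * S + 4 * Q * S := Nat.add_le_add_left (Nat.le_mul_of_pos_right _ hS1) _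
      _ = _ := by ring
  have hSr : (0:ℝ) < S := by exact_mod_cast hS1
  have hS2r : 4 * (Q:ℝ) * S ≤ M := by exact_mod_cast hS2
  have hS3r : (M:ℝ) ≤ 8 * Q * S := by exact_mod_cast hS3
  set H0 : ℤ → ℂ := fun n => if 0 ≤ n ∧ n < P then ee (α * n) else 0 with hH0
  have hH0s : ∀ x, H0 x ≠ 0 → 0 ≤ x ∧ x < P := by
    intro x hx; simp only [hH0] at hx; by_contra hc; exact hx (if_neg hc)
  have hH0b : ∀ x, ‖H0 x‖ ≤ 1 := by
    intro x; simp only [hH0]; split_ifs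
    · exact (norm_ee _).le
    · simp
  set B := cyc M H0 with hB
  have h1 := conv_bound D B (M / Q ^ 5) (by
    intro j
    rw [le_div_iff₀ (by positivity)]
    have := hcon j; linarith)
  have h2 : ∑ x, ‖B x‖ ^ 2 ≤ M := by
    refine (slc _ _ 1 fun x _ => ?_).trans (by simp [ZMod.card])
    exact pow_le_one₀ (norm_nonneg _) (hH0b _)
  have h3 : ∀ s ∈ range S, (M:ℝ) / (2 * Q) ≤ ‖∑ x, D ((s:ZMod M) + x) * B x‖ := by
    intro s hs
    rw [mem_range] at hs
    have hs' : (s:ℝ) ≤ S := by exact_mod_cast hs.le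
    rw [hB, sum_cyc (fun x => D ((s:ZMod M) + x)) H0 P (by exact_mod_cast hP) hH0s]
    have e1 := shift_sum0 (fun n => D (n : ZMod M) * ee (α * n)) (fun n => bd_mul (hD _) (norm_ee _).le) P s
    have e2 : ∑ y ∈ IZ P, D (zc M (y + s)) * ee (α * (y + s : ℤ)) =
        (∑ n ∈ IZ P, D ((s:ZMod M) + n) * H0 n) * ee (α * s) := by
      rw [sum_mul]
      refine sum_congr rfl fun n hn => ?_
      rw [mem_Ico] at hn
      simp only [hH0, if_pos hn]
      push_cast
      rw [mul_add, ee_add, add_comm (n : ZMod M)]; ring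
    rw [e2, abs_of_nonneg (by positivity)] at e1
    have e3 := norm_sub_norm_le (∑ n ∈ IZ P, D (n : ZMod M) * ee (α * n)) ((∑ n ∈ IZ P, D ((s:ZMod M) + n) * H0 n) * ee (α * s))
    rw [norm_mul (∑ n ∈ IZ P, D ((s:ZMod M) + n) * H0 n), norm_ee, mul_one] at e3
    push_cast at e1
    rw [div_le_iff₀ (by positivity)]
    set Y := ‖∑ n ∈ IZ P, D ((s:ZMod M) + n) * H0 n‖
    set X := ‖∑ n ∈ IZ P, D (n : ZMod M) * ee (α * n)‖
    have e4 : X ≤ Y + 2 * S := by linarith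
    have e5 : (Q:ℝ) * X ≤ Q * (Y + 2 * S) := by gcongr
    linarith
  have h4 : S * ((M:ℝ) / (2 * Q)) ^ 2 ≤ ∑ w, ‖∑ x, D (w + x) * B x‖ ^ 2 := by
    rw [sum_zmod_rangeR]
    have : ∑ s ∈ range S, ((M:ℝ) / (2 * Q)) ^ 2 = S * ((M:ℝ) / (2 * Q)) ^ 2 := by simp
    rw [← this]
    refine (sum_le_sum fun s hs => ?_).trans (sum_le_sum_of_subset_of_nonneg (range_subset_range.2 (?_ : S ≤ M)) fun _ _ _ => by positivity)
    · exact pL (by positivity) (h3 s hs) 2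
    · exact Nat.div_le_self _ _
  have h5 : S * ((M:ℝ) / (2 * Q)) ^ 2 ≤ (M / Q ^ 5) ^ 2 * M := h4.trans (h1.trans (by gcongr))
  have h6 : (Q:ℝ) ^ 8 * S ≤ 4 * M := by
    have e : S * ((M:ℝ) / (2 * Q)) ^ 2 = (Q ^ 8 * S) * ((M:ℝ) ^ 2 / (4 * Q ^ 10)) := by field_simp; norm_num
    have e' : ((M:ℝ) / Q ^ 5) ^ 2 * M = (4 * M) * ((M:ℝ) ^ 2 / (4 * Q ^ 10)) := by field_simp
    rw [e, e'] at h5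
    exact le_of_mul_le_mul_right h5 (by positivity)
  have h7 : (64:ℝ) * Q ^ 1 ≤ Q ^ 8 := cpow hQr 6 (by norm_num) (by norm_num)
  have h8 : 64 * (Q:ℝ) ^ 1 * S ≤ Q ^ 8 * S := by gcongr
  nlinarith [mul_pos hQ0 hSr]

def C2 {M : ℕ} (h : ZMod M → ℂ) (u v x : ZMod M) : ℂ := h (x + u) * conj (h (x + v))

lemma C2_bd {M : ℕ} {h : ZMod M → ℂ} (hh : ∀ x, ‖h x‖ ≤ 1) (u v x : ZMod M) : ‖C2 h u v x‖ ≤ 1 :=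
  bd_mul (hh _) (bd_conj (hh _))

lemma U3a (K M L : ℕ) [NeZero M] (hKp : 0 < K) (Q E : ℝ) (hQ : 1 ≤ Q) (hE0 : 0 ≤ E) (hE : 256 * E * Q ^ 4 ≤ K) (h1 h2 h3 h4 : ZMod M → ℂ)
    (b1 : ∀ x, ‖h1 x‖ ≤ 1) (b2 : ∀ x, ‖h2 x‖ ≤ 1) (b3 : ∀ x, ‖h3 x‖ ≤ 1) (b4 : ∀ x, ‖h4 x‖ ≤ 1)
    (a b : ZMod M) (s1 s2 s3 : ℕ → ℤ) (e1 : ∀ i ∈ range L, |(s1 i : ℝ)| ≤ E) (e2 : ∀ i ∈ range L, |(s2 i : ℝ)| ≤ E)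
    (e3 : ∀ i ∈ range L, |(s3 i : ℝ)| ≤ E)
    (H : (M:ℝ) * K ≤ Q * ‖∑ y ∈ IC K, ∑ x : ZMod M, h1 x * (h2 (x + a * y) * h3 (x + b * y) * h4 (x + (a + b) * y))‖) :
    (M:ℝ) * L ^ 6 ≤ 2 ^ 14 * Q ^ 8 * ∑ p ∈ (range L ×ˢ range L) ×ˢ (range L ×ˢ range L), ∑ x : ZMod M,
      ‖∑ t ∈ range L, C2 (C2 h4 ((a + b) * s1 p.1.1) ((a + b) * s1 p.1.2)) (b * s2 p.2.1) (b * s2 p.2.2) (x + a * s3 t)‖ ^ 2 := by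
  have hQ2 : 1 ≤ Q ^ 2 := one_le_pow₀ hQ
  have hQ4 : Q ^ 2 ≤ Q ^ 4 := pow_le_pow_right₀ hQ (by norm_num)
  have hQ1 : Q ≤ Q ^ 4 := le_self_pow₀ hQ (by norm_num)
  have v1 := vdc_pair (X := ZMod M) K Q E ({()} : Finset Unit) (range L) s1 e1 (fun _ x => h1 x)
    (fun _ x y => h2 (x + a * y) * h3 (x + b * y) * h4 (x + (a + b) * y)) (fun _ => b1)
    (fun _ x y => bd_mul (bd_mul (b2 _) (b3 _)) (b4 _)) (by linarith) (by nlinarith) (by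
      simp only [card_singleton, sum_singleton, ZMod.card, Nat.cast_one, mul_one]
      exact H)
  have v2 := vdc_pair (X := ZMod M) K (4 * Q ^ 2) E _ (range L) s2 e2
    (fun (p : Unit × ℕ × ℕ) x => C2 h2 (a * s1 p.2.1) (a * s1 p.2.2) x)
    (fun p x y => C2 h3 (b * s1 p.2.1) (b * s1 p.2.2) (x + (b - a) * y) *
      C2 h4 ((a + b) * s1 p.2.1) ((a + b) * s1 p.2.2) (x + b * y)) (fun p x => C2_bd b2 _ _ _)
    (fun p x y => bd_mul (C2_bd b3 _ _ _) (C2_bd b4 _ _ _)) (by positivity) (by nlinarith) (v1.trans (le_of_eq (by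
      congr 1
      refine sum_congr rfl fun p _ => ?_
      congr 1
      refine sum_congr rfl fun y _ => ?_
      rw [← shiftZ _ (-(a * (y : ZMod M)))]
      refine sum_congr rfl fun x _ => ?_
      unfold C2
      simp only [map_mul]
      push_cast
      ring_nf)))
  have v3 := vdc (X := ZMod M) K (4 * (4 * Q ^ 2) ^ 2) E _ (range L) s3 e3
    (fun (p : (Unit × ℕ × ℕ) × ℕ × ℕ) x => C2 (C2 h3 (b * s1 p.1.2.1) (b * s1 p.1.2.2)) ((b - a) * s2 p.2.1) ((b - a) * s2 p.2.2) x)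
    (fun p x y => C2 (C2 h4 ((a + b) * s1 p.1.2.1) ((a + b) * s1 p.1.2.2)) (b * s2 p.2.1) (b * s2 p.2.2) (x + a * y))
    (fun p x => C2_bd (fun _ => C2_bd b3 _ _ _) _ _ _)
    (fun p x y => C2_bd (fun _ => C2_bd b4 _ _ _) _ _ _) (by positivity) (by nlinarith) (v2.trans (le_of_eq (by
      congr 1
      refine sum_congr rfl fun p _ => ?_
      congr 1
      refine sum_congr rfl fun y _ => ?_
      rw [← shiftZ _ (-((b - a) * (y : ZMod M)))]
      refine sum_congr rfl fun x _ => ?_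
      unfold C2
      simp only [map_mul]
      push_cast
      ring_nf)))
  have e : ∀ p : (Unit × ℕ × ℕ) × ℕ × ℕ, ∑ y ∈ IC K, ∑ x : ZMod M, ‖∑ i ∈ range L,
      C2 (C2 h4 ((a + b) * s1 p.1.2.1) ((a + b) * s1 p.1.2.2)) (b * s2 p.2.1) (b * s2 p.2.2) (x + a * (zc M (y + s3 i)))‖ ^ 2 =
      K * ∑ x : ZMod M, ‖∑ i ∈ range L,
      C2 (C2 h4 ((a + b) * s1 p.1.2.1) ((a + b) * s1 p.1.2.2)) (b * s2 p.2.1) (b * s2 p.2.2) (x + a * s3 i)‖ ^ 2 := by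
    intro p
    have : ∀ y ∈ IC K, ∑ x : ZMod M, ‖∑ i ∈ range L,
      C2 (C2 h4 ((a + b) * s1 p.1.2.1) ((a + b) * s1 p.1.2.2)) (b * s2 p.2.1) (b * s2 p.2.2) (x + a * (zc M (y + s3 i)))‖ ^ 2 =
      ∑ x : ZMod M, ‖∑ i ∈ range L,
      C2 (C2 h4 ((a + b) * s1 p.1.2.1) ((a + b) * s1 p.1.2.2)) (b * s2 p.2.1) (b * s2 p.2.2) (x + a * s3 i)‖ ^ 2 := by
      intro y _
      rw [← Equiv.sum_comp (Equiv.addRight (a * (y : ZMod M))) (fun x => ‖∑ i ∈ range L,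
        C2 (C2 h4 ((a + b) * s1 p.1.2.1) ((a + b) * s1 p.1.2.2)) (b * s2 p.2.1) (b * s2 p.2.2) (x + a * s3 i)‖ ^ 2)]
      refine sum_congr rfl fun x _ => ?_
      simp only [Equiv.coe_addRight]
      congr 2
      refine sum_congr rfl fun i _ => ?_
      congr 1
      push_cast; ring
    rw [sum_congr rfl this, sum_const]; simp
  simp only [e] at v3
  have hKr : (0:ℝ) < K := by exact_mod_cast hKp
  refine cL ?_ hKr
  refine le_trans (le_of_eq ?_) (v3.trans (le_of_eq ?_))
  · simp only [card_product, card_singleton, card_range, ZMod.card]; push_cast; ring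
  · rw [← mul_sum]
    have : ∀ F : (ℕ × ℕ) → (ℕ × ℕ) → ℝ, ∑ p ∈ ((({()} : Finset Unit) ×ˢ (range L ×ˢ range L)) ×ˢ (range L ×ˢ range L)), F p.1.2 p.2 =
        ∑ p ∈ (range L ×ˢ range L) ×ˢ (range L ×ˢ range L), F p.1 p.2 := by
      intro F
      rw [sum_product, sum_product, sum_product, sum_singleton]
    have := this (fun p p' => ∑ x : ZMod M, ‖∑ i ∈ range L,
        C2 (C2 h4 ((a + b) * s1 p.1) ((a + b) * s1 p.2)) (b * s2 p'.1) (b * s2 p'.2) (x + a * s3 i)‖ ^ 2)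
    rw [this]; ring

lemma shiftZR {M : ℕ} [NeZero M] (F : ZMod M → ℝ) (a : ZMod M) : ∑ x, F (x + a) = ∑ x, F x :=
  Equiv.sum_comp (Equiv.addRight a) F

lemma U3b1 (M L : ℕ) [NeZero M] (hL : 0 < L) (q : ZMod M) (C : ZMod M → ℂ) (hC : ∀ x, ‖C x‖ ≤ 1) :
    ∃ θ : ZMod M → ℝ, ∑ p ∈ range L ×ˢ range L, ∑ x, ‖∑ t ∈ range L, C2 C (q * p.1) (q * p.2) (x + q * t)‖ ^ 2 ≤
      3 * (L:ℝ) ^ 2 * ∑ x, ‖∑ t ∈ range L, conj (C (x + q * t)) * ee (θ x * t)‖ ^ 2 := by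
  choose θ hθ using fun x : ZMod M => PLex L (2 * L) hL (fun t => conj (C (x + q * t))) (fun u => C (x - q * L + q * u))
  refine ⟨θ, ?_⟩
  rw [sum_product_right]
  have key : ∀ t' ∈ range L, ∑ s ∈ range L, ∑ x, ‖∑ t ∈ range L, C2 C (q * s) (q * t') (x + q * t)‖ ^ 2 ≤
      3 * (L:ℝ) * ∑ x, ‖∑ t ∈ range L, conj (C (x + q * t)) * ee (θ x * t)‖ ^ 2 := by
    intro t' ht'
    rw [mem_range] at ht'
    rw [sum_comm, ← shiftZR _ (-(q * (t' : ZMod M))), mul_sum]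
    refine sum_le_sum fun x _ => ?_
    refine le_trans ?_ ((hθ x).trans ?_)
    · refine le_trans (le_of_eq ?_) (sum_le_sum_of_subset_of_nonneg (s := (range L).image fun s => s + L - t') ?_ fun _ _ _ => by positivity)
      · rw [sum_image]
        · refine sum_congr rfl fun s hs => ?_
          congr 2
          refine sum_congr rfl fun t _ => ?_
          unfold C2
          rw [mul_comm]
          rw [show (t + (s + L - t')) = t + s + (L - t') by omega]
          push_cast [ht'.le]
          congr 2
          · congr 1; ring
          · ring
        · intro s _ s' _ h
          simp only at h
          omega
      · intro w hw
        rw [mem_image] at hw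
        obtain ⟨s, hs, rfl⟩ := hw
        rw [mem_range] at hs ⊢; omega
    · rw [mul_comm]
      refine mR ?_ (by positivity)
      refine (slc _ _ 1 fun u _ => pow_le_one₀ (norm_nonneg _) (hC _)).trans ?_
      simp; linarith
  refine (sum_le_sum key).trans (le_of_eq ?_)
  rw [sum_const, card_range, nsmul_eq_mul]; ring

lemma U3b (M L : ℕ) [NeZero M] (hL : 0 < L) (q σ : ZMod M) (h4 : ZMod M → ℂ) (hh : ∀ x, ‖h4 x‖ ≤ 1) (R : ℝ) (hR : 0 < R)
    (H : (M:ℝ) * L ^ 6 ≤ R * ∑ p ∈ (range L ×ˢ range L) ×ˢ (range L ×ˢ range L), ∑ x : ZMod M,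
      ‖∑ t ∈ range L, C2 (C2 h4 (q * σ * p.1.1) (q * σ * p.1.2)) (q * p.2.1) (q * p.2.2) (x + q * t)‖ ^ 2) (x1 : ZMod M) :
    ∃ t0 < L, ∃ θ : ℕ → ZMod M → ℝ, (M:ℝ) * L ^ 3 ≤ (3 * R) * ∑ s ∈ range L, ∑ x, ‖∑ t ∈ range L,
      h4 (x + x1 + q * t) * conj (h4 (x + x1 + q * t + q * σ * (s - t0))) * ee (θ s x * t)‖ ^ 2 := by
  choose θ hθ using fun p : ℕ × ℕ => U3b1 M L hL q (C2 h4 (q * σ * p.1) (q * σ * p.2)) (C2_bd hh _ _)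
  rw [sum_product] at H
  have h1 := H.trans (mL (sum_le_sum fun p _ => hθ p) hR.le)
  rw [sum_product_right] at h1
  have hLr : (0:ℝ) < L := by exact_mod_cast hL
  obtain ⟨t0, ht0, h2⟩ := pigs (range L) ⟨0, mem_range.2 hL⟩ (fun t' => ∑ s ∈ range L, 3 * (L:ℝ) ^ 2 * ∑ x, ‖∑ t ∈ range L,
    conj (C2 h4 (q * σ * s) (q * σ * t') (x + q * t)) * ee (θ (s, t') x * t)‖ ^ 2)
  refine ⟨t0, mem_range.1 ht0, fun s x => θ (s, t0) (x + x1 - q * σ * t0), ?_⟩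
  refine cL ?_ (show (0:ℝ) < L ^ 3 by positivity)
  calc (L:ℝ) ^ 3 * (M * L ^ 3) = M * L ^ 6 := by ring
    _ ≤ R * ((range L).card * _) := h1.trans (mL h2 hR.le)
    _ = _ := by
      rw [card_range, ← mul_sum]
      have : ∀ s ∈ range L, ∑ x, ‖∑ t ∈ range L, conj (C2 h4 (q * σ * s) (q * σ * t0) (x + q * t)) * ee (θ (s, t0) x * t)‖ ^ 2 =
        ∑ x, ‖∑ t ∈ range L, h4 (x + x1 + q * t) * conj (h4 (x + x1 + q * t + q * σ * (s - t0))) * ee (θ (s, t0) (x + x1 - q * σ * t0) * t)‖ ^ 2 := by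
        intro s _
        rw [← shiftZR _ (x1 - q * σ * (t0 : ZMod M))]
        refine sum_congr rfl fun x _ => ?_
        congr 2
        refine sum_congr rfl fun t _ => ?_
        unfold C2
        rw [map_mul, Complex.conj_conj, mul_comm (conj _)]
        have a1 : x + (x1 - q * σ * t0) + q * t + q * σ * t0 = x + x1 + q * t := by ring
        have a2 : x + (x1 - q * σ * t0) + q * t + q * σ * s = x + x1 + q * t + q * σ * (s - t0) := by ring
        rw [a1, a2, add_sub_assoc]
      rw [sum_congr rfl this]; ring

lemma U3c (Q K M l J : ℕ) [NeZero M] (hQ : 2 ≤ Q) (hK : 0 < K) (hJ : J = Q ^ 13) (hl : 16 * (l * J ^ 2) * Q ^ 2 ≤ K)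
    (f g h : ZMod M → ℂ) (hf : ∀ x, ‖f x‖ ≤ 1) (hg : ∀ x, ‖g x‖ ≤ 1)
    (hh : ∀ x, ‖h x‖ ≤ 1) (H : (M:ℝ) * K ≤ Q * ‖Lam K f g h‖) :
    ∃ j i s0 : ℤ, j ≠ 0 ∧ i ≠ 0 ∧ |j| < J ∧ |i| < J ∧ (M:ℝ) * K ≤ 128 * Q ^ 4 * ‖∑ y ∈ IC K,
      Q4 h (zc M (2 * (l * j) * (y + s0) + (l * j) ^ 2)) (zc M (2 * (l * J * i) * (y + s0) + (l * J * i) ^ 2 - l * J * i))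
        (zc M (2 * (l * j) * (l * J * i)))‖ := by
  have hQr : (2:ℝ) ≤ Q := by exact_mod_cast hQ
  have hQ0 : (0:ℝ) < Q := by linarith
  have hMr : (0:ℝ) < M := by exact_mod_cast NeZero.pos M
  have hKr : (0:ℝ) < K := by exact_mod_cast hK
  have hJ0 : (0:ℝ) < J := by rw [hJ]; positivity
  by_contra hcon
  push Not at hcon
  have hb : ∀ i ∈ range J, |((l * i : ℤ) : ℝ)| ≤ (l * J ^ 2 : ℕ) := by
    intro i hi
    rw [mem_range] at hi
    have h1 : i ≤ J ^ 2 := hi.le.trans (nsp (by norm_num) _)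
    push_cast
    rw [abs_of_nonneg (by positivity)]
    exact_mod_cast nmL l h1
  have hb' : ∀ i ∈ range J, |((l * J * i : ℤ) : ℝ)| ≤ (l * J ^ 2 : ℕ) := by
    intro i hi
    rw [mem_range] at hi
    push_cast
    rw [abs_of_nonneg (by positivity)]
    have : l * J * i ≤ l * J ^ 2 := by rw [sq, ← mul_assoc]; exact nmL _ hi.le
    exact_mod_cast this
  have h1 := T4 K Q ((l * J ^ 2 : ℕ) : ℝ) f g h hf hg hh (range J) (fun i => (l * i : ℤ)) hb (range J) (fun i => (l * J * i : ℤ)) hb'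
    (by linarith) (by positivity) (by exact_mod_cast hl) H
  have h2 : ∀ p ∈ (range J ×ˢ range J) ×ˢ (range J ×ˢ range J), 128 * (Q:ℝ) ^ 4 * ‖∑ y ∈ IC K,
        Q4 h (zc M (2 * ((l * p.1.2 : ℤ) - (l * p.1.1 : ℤ)) * (y + (l * p.1.1 : ℤ) + (l * J * p.2.1 : ℤ)) + ((l * p.1.2 : ℤ) - (l * p.1.1 : ℤ)) ^ 2))
          (zc M (2 * ((l * J * p.2.2 : ℤ) - (l * J * p.2.1 : ℤ)) * (y + (l * p.1.1 : ℤ) + (l * J * p.2.1 : ℤ)) + ((l * J * p.2.2 : ℤ) - (l * J * p.2.1 : ℤ)) ^ 2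
            - ((l * J * p.2.2 : ℤ) - (l * J * p.2.1 : ℤ))))
          (zc M (2 * ((l * p.1.2 : ℤ) - (l * p.1.1 : ℤ)) * ((l * J * p.2.2 : ℤ) - (l * J * p.2.1 : ℤ))))‖ ≤
      (M * K) * (128 * Q ^ 4 * (if p.1.1 = p.1.2 then 1 else 0) + 128 * Q ^ 4 * (if p.2.1 = p.2.2 then 1 else 0) + 1) := by
    intro p hp
    simp only [mem_product, mem_range] at hp
    have triv : ∀ U V W : ℤ → ZMod M, ‖∑ y ∈ IC K, Q4 h (U y) (V y) (W y)‖ ≤ M * K := by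
      intro U V W
      refine (norm_sum_le _ _).trans ((slc _ _ (M:ℝ) fun y _ => norm_Q4_le h hh _ _ _).trans ?_)
      simp [mul_comm]
    have hMK : (0:ℝ) < M * K := by positivity
    have hc : (0:ℝ) < 128 * Q ^ 4 := by positivity
    by_cases c1 : p.1.1 = p.1.2 ∨ p.2.1 = p.2.2
    · refine (mL (triv _ _ _) hc.le).trans ?_
      have : (1:ℝ) ≤ (if p.1.1 = p.1.2 then 1 else 0) + (if p.2.1 = p.2.2 then 1 else 0) := by
        rcases c1 with c | c <;> rw [if_pos c] <;> split_ifs <;> norm_num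
      have := mL this (mul_pos hMK hc).le
      linarith
    · push Not at c1
      rw [if_neg c1.1, if_neg c1.2]
      have := hcon (p.1.2 - p.1.1) (p.2.2 - p.2.1) (l * p.1.1 + l * J * p.2.1) (by omega) (by omega) (by rw [abs_lt]; omega) (by rw [abs_lt]; omega)
      refine le_trans (le_of_eq ?_) (this.le.trans (le_of_eq (by ring)))
      congr 2
      refine sum_congr rfl fun y _ => ?_
      congr 2 <;> ring
  have h3 := sum_le_sum h2
  rw [← mul_sum, ← mul_sum] at h3
  have h4 : ∑ p ∈ (range J ×ˢ range J) ×ˢ (range J ×ˢ range J), (128 * (Q:ℝ) ^ 4 * (if p.1.1 = p.1.2 then (1:ℝ) else 0) + 128 * Q ^ 4 * (if p.2.1 = p.2.2 then 1 else 0) + 1) =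
      128 * (Q:ℝ) ^ 4 * J ^ 3 + 128 * Q ^ 4 * J ^ 3 + J ^ 4 := by
    rw [sum_add_distrib, sum_add_distrib, ← mul_sum, ← mul_sum]
    have e0 : ∑ x ∈ range J, ∑ y ∈ range J, (if x = y then (1:ℝ) else 0) = J := by
      have : ∀ x ∈ range J, ∑ y ∈ range J, (if x = y then (1:ℝ) else 0) = 1 := by
        intro x hx; rw [sum_ite_eq, if_pos hx]
      rw [sum_congr rfl this]; simp
    have e1 : ∑ p ∈ (range J ×ˢ range J) ×ˢ (range J ×ˢ range J), (if p.1.1 = p.1.2 then (1:ℝ) else 0) = J ^ 3 := by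
      rw [sum_product]
      have : ∀ x ∈ range J ×ˢ range J, ∑ y ∈ range J ×ˢ range J, (if x.1 = x.2 then (1:ℝ) else 0) =
          (J:ℝ) ^ 2 * (if x.1 = x.2 then (1:ℝ) else 0) := by
        intro x _
        rw [sum_const, card_product, card_range, nsmul_eq_mul]; push_cast; ring
      rw [sum_congr rfl this, ← mul_sum, sum_product, e0]; ring
    have e2 : ∑ p ∈ (range J ×ˢ range J) ×ˢ (range J ×ˢ range J), (if p.2.1 = p.2.2 then (1:ℝ) else 0) = J ^ 3 := by
      rw [sum_product_right]
      have : ∀ x ∈ range J ×ˢ range J, ∑ y ∈ range J ×ˢ range J, (if x.1 = x.2 then (1:ℝ) else 0) =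
          (J:ℝ) ^ 2 * (if x.1 = x.2 then (1:ℝ) else 0) := by
        intro x _
        rw [sum_const, card_product, card_range, nsmul_eq_mul]; push_cast; ring
      rw [sum_congr rfl this, ← mul_sum, sum_product, e0]; ring
    rw [e1, e2]; simp; ring
  rw [h4] at h3
  have h5 : (M:ℝ) * K * J ^ 4 * 2 ≤ M * K * (128 * Q ^ 4 * J ^ 3 + 128 * Q ^ 4 * J ^ 3 + J ^ 4) := by
    refine le_trans ?_ h3
    simp only [card_product, card_range] at h1
    push_cast at h1 ⊢
    linarith
  have h6 : (J:ℝ) ≤ 256 * Q ^ 4 := by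
    have : (M:ℝ) * K * J ^ 3 * J ≤ (M * K * J ^ 3) * (256 * Q ^ 4) := by nlinarith
    exact cL this (by positivity)
  have h7 : (512:ℝ) * Q ^ 4 ≤ Q ^ 13 := cpow hQr 9 (by norm_num) (by norm_num)
  rw [hJ] at h6
  push_cast at h6
  have : (0:ℝ) < Q ^ 4 := by positivity
  linarith

lemma floorL (Q K a : ℕ) (hQ : 2 ≤ Q) (hK : Q ^ a ≤ K) : ∃ L, 1 ≤ L ∧ Q ^ a * L ≤ K ∧ K < Q ^ a * (L + 1) ∧ K ≤ Q ^ (a + 1) * L := by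
  have hp : 0 < Q ^ a := Nat.pow_pos (by omega)
  have h1 : 1 ≤ K / Q ^ a := (Nat.one_le_div_iff hp).2 hK
  have h2 : K < Q ^ a * (K / Q ^ a + 1) := Nat.lt_mul_div_succ _ hp
  refine ⟨K / Q ^ a, h1, Nat.mul_div_le _ _, h2, h2.le.trans ?_⟩
  rw [pow_succ, mul_assoc]
  refine nmL _ ?_
  nlinarith

lemma sizes (Q K : ℕ) (hQ : 2 ≤ Q) (hK : Q ^ 130 ≤ K) : ∃ l L, l.Prime ∧ l ≠ 2 ∧ 1 ≤ L ∧ Q ^ 32 * l ≤ K ∧ K ≤ Q ^ 33 * l ∧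
    Q ^ 91 * L ≤ K ∧ K ≤ Q ^ 92 * L := by
  obtain ⟨L, hL1, hL2, -, hL3⟩ := floorL Q K 91 hQ ((npR (by omega) (by norm_num)).trans hK)
  obtain ⟨n, hn1, hn2, hn3, hn4⟩ := floorL Q K 33 hQ ((npR (by omega) (by norm_num)).trans hK)
  obtain ⟨l, hl, h1, h2⟩ := Nat.exists_prime_lt_and_le_two_mul n (by omega)
  have hn5 : 2 ≤ n := by
    have h : Q ^ 33 * Q ^ 97 < Q ^ 33 * (n + 1) := by rw [← pow_add]; exact lt_of_le_of_lt hK hn3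
    have h' := Nat.lt_of_mul_lt_mul_left h
    have : Q ^ 2 ≤ Q ^ 97 := npR (by omega) (by norm_num)
    nlinarith
  refine ⟨l, L, hl, by omega, hL1, ?_, ?_, hL2, hL3⟩
  · refine le_trans ?_ hn2
    rw [pow_succ Q 32, mul_assoc]
    exact nmL _ (h2.trans (nmR _ hQ))
  · exact hn3.le.trans (nmL _ h1)

lemma blockpig (M q : ℕ) [NeZero M] [NeZero q] (G : ZMod M → ℝ) :
    ∃ x0 : ZMod M, (q:ℝ) * ∑ x, G x ≤ M * ∑ r : ZMod q, G (x0 + ((r.val : ℕ) : ZMod M)) := by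
  obtain ⟨x0, -, h⟩ := pigs univ ⟨(0 : ZMod M), mem_univ _⟩ (fun x0 => ∑ r : ZMod q, G (x0 + ((r.val : ℕ) : ZMod M)))
  refine ⟨x0, ?_⟩
  rw [card_univ, ZMod.card] at h
  refine le_trans (le_of_eq ?_) h
  rw [sum_comm, sum_congr rfl fun r _ => shiftZR G _, sum_const, card_univ, ZMod.card, nsmul_eq_mul]

lemma U3 (Q K M : ℕ) [NeZero M] (hQ : 2 ≤ Q) (hM : 100 * K ^ 2 = M) (hK : Q ^ 130 ≤ K)
    (f g h : ZMod M → ℂ) (hf : ∀ x, ‖f x‖ ≤ 1) (hg : ∀ x, ‖g x‖ ≤ 1)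
    (hh : ∀ x, ‖h x‖ ≤ 1) (H : (M:ℝ) * K ≤ Q * ‖Lam K f g h‖) :
    ∃ l q L σ t0 : ℕ, ∃ _ : NeZero q, Ctx (Q ^ 130) K M l q L ∧ 1 ≤ σ ∧ σ ≤ Q ^ 130 ∧ t0 < L ∧
      ∃ (x0 : ZMod M) (θ : ℕ → ZMod q → ℝ), (q:ℝ) * L ^ 3 ≤ (Q ^ 130 : ℕ) * ∑ s ∈ range L, ∑ r : ZMod q, ‖∑ t ∈ range L,
        h (x0 + (r.val : ZMod M) + q * t) * conj (h (x0 + (r.val : ZMod M) + q * t + q * σ * (s - t0))) * ee (θ s r * t)‖ ^ 2 := by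
  obtain ⟨l, L, hl, hl2, hL, l1, l2, L1, L2⟩ := sizes Q K hQ hK
  have hKp : 0 < K := lt_of_lt_of_le (Nat.pow_pos (by omega)) hK
  have hQp : 0 < Q := by omega
  have hQr : (2:ℝ) ≤ Q := by exact_mod_cast hQ
  have hMr : (0:ℝ) < M := by exact_mod_cast NeZero.pos M
  obtain ⟨J, hJ⟩ : ∃ J, J = Q ^ 13 := ⟨_, rfl⟩
  have hJ1 : 1 ≤ J := by rw [hJ]; exact Nat.pow_pos hQp
  obtain ⟨j, i, s0, hj, hi, hjJ, hiJ, h1⟩ := U3c Q K M l J hQ hKp hJ (by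
    refine le_trans ?_ l1
    rw [hJ]
    calc 16 * (l * (Q ^ 13) ^ 2) * Q ^ 2 = 2 ^ 4 * (Q ^ 28 * l) := by ring
      _ ≤ Q ^ 4 * (Q ^ 28 * l) := nmR _ (npL hQ 4)
      _ = Q ^ 32 * l := by ring) f g h hf hg hh H
  set j' : ℤ := J * i with hj'
  have hj'0 : j' ≠ 0 := mul_ne_zero (by omega) hi
  have hjj' : j + j' ≠ 0 := by
    intro h0
    have : |j| = J * |i| := by
      rw [show j = -j' by omega, abs_neg, hj', abs_mul, abs_of_nonneg (by omega : (0:ℤ) ≤ J)]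
    have h3 : 1 ≤ |i| := Int.one_le_abs hi
    nlinarith
  have hj'J : |j'| ≤ (J:ℤ) ^ 2 := by
    rw [hj', abs_mul, abs_of_nonneg (by omega : (0:ℤ) ≤ J), sq]
    exact mL hiJ.le (by omega)
  have hpq : |j * j'| ≤ (J:ℤ) ^ 3 := by
    rw [abs_mul]
    calc |j| * |j'| ≤ J * (J:ℤ) ^ 2 := mul_le_mul hjJ.le hj'J (abs_nonneg _) (by omega)
      _ = _ := by ring
  have hpos : 1 ≤ (j * j').natAbs := Int.natAbs_pos.2 (mul_ne_zero hj hj'0)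
  have hpq' : (j * j').natAbs ≤ Q ^ 39 := by
    have : ((j * j').natAbs : ℤ) ≤ ((Q ^ 39 : ℕ) : ℤ) := by
      rw [Int.natCast_natAbs]; refine hpq.trans (le_of_eq ?_); rw [hJ]; push_cast; ring
    exact_mod_cast this
  set q : ℕ := 2 * l * (j * j').natAbs with hq
  set σ : ℕ := (j + j').natAbs with hσ
  have hlp := hl.pos
  have hqpos : 0 < q := Nat.mul_pos (Nat.mul_pos (by norm_num) hlp) hpos
  have hqz : NeZero q := ⟨hqpos.ne'⟩
  have hσ1 : 1 ≤ σ := Int.natAbs_pos.2 hjj'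
  have hσQ : σ ≤ Q ^ 27 := by
    have : (σ:ℤ) ≤ ((Q ^ 27 : ℕ) : ℤ) := by
      rw [hσ, Int.natCast_natAbs]
      refine (abs_add_le _ _).trans ?_
      have h3 : (J:ℤ) ≤ J ^ 2 := by exact_mod_cast nsp (by norm_num) J
      have h4 : 2 * (J:ℤ) ^ 2 ≤ Q * J ^ 2 := mR (by exact_mod_cast hQ) (by positivity)
      have h5 : (Q:ℤ) * J ^ 2 = ((Q ^ 27 : ℕ) : ℤ) := by rw [hJ]; push_cast; ring
      linarith
    exact_mod_cast this
  have hql : q ≤ Q ^ 40 * l := by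
    calc q = 2 * (j * j').natAbs * l := by rw [hq]; ring
      _ ≤ Q * Q ^ 39 * l := nmR _ (Nat.mul_le_mul hQ hpq')
      _ = _ := by ring
  have hpm : ∀ a b : ℕ, a ≤ b → Q ^ a ≤ Q ^ b := fun a b h => npR hQp h
  have cx : Ctx (Q ^ 130) K M l q L := by
    refine ⟨hQ.trans (nsp (by norm_num) _), hM, hl, ⟨2 * (j * j').natAbs, by rw [hq]; ring⟩, hl2,
      hql.trans (nmR _ (hpm _ _ (by norm_num))), ?_, l2.trans (nmR _ (hpm _ _ (by norm_num))), hL, ?_, ?_⟩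
    · exact le_trans (Nat.le_mul_of_pos_left _ (Nat.pow_pos hQp)) l1
    · calc q * L ≤ (Q ^ 40 * l) * L := nmR _ hql
        _ = (Q ^ 32 * l) * (Q ^ 8 * L) := by ring
        _ ≤ K * K := Nat.mul_le_mul l1 ((nmR _ (hpm _ _ (by norm_num))).trans L1)
        _ = K ^ 2 := by ring
    · calc K ^ 2 = K * K := by ring
        _ ≤ (Q ^ 33 * l) * (Q ^ 92 * L) := Nat.mul_le_mul l2 L2
        _ = Q ^ 125 * (l * L) := by ring
        _ ≤ Q ^ 130 * (q * L) := by
          refine Nat.mul_le_mul (hpm _ _ (by norm_num)) (nmR _ ?_)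
          calc l = 1 * l * 1 := by ring
            _ ≤ 2 * l * (j * j').natAbs := Nat.mul_le_mul (nmR _ (by norm_num)) hpos
  refine ⟨l, q, L, σ, ?_⟩
  -- shifts
  have bdshift : ∀ (e m : ℤ), |e| ≤ 1 → |m| ≤ |j * j'| → ∀ t ∈ range L, |((e * m * t : ℤ) : ℝ)| ≤ ((Q ^ 39 * L : ℕ) : ℝ) := by
    intro e m he hm t ht
    rw [mem_range] at ht
    have : |e * m * t| ≤ ((Q ^ 39 * L : ℕ) : ℤ) := by
      rw [abs_mul, abs_mul, abs_of_nonneg (by positivity : (0:ℤ) ≤ t)]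
      push_cast
      have h6 : |e| * |m| ≤ (Q:ℤ) ^ 39 := by
        have h7 : ((j * j').natAbs : ℤ) ≤ (Q:ℤ) ^ 39 := by exact_mod_cast hpq'
        rw [Int.natCast_natAbs] at h7
        nlinarith [abs_nonneg m, abs_nonneg e]
      exact mul_le_mul h6 (by exact_mod_cast ht.le) (by positivity) (by positivity)
    exact_mod_cast this
  have hsg : ∀ z : ℤ, |Int.sign z| ≤ 1 := by
    intro z; rcases lt_trichotomy z 0 with h | h | h
    · rw [Int.sign_eq_neg_one_of_neg h]; norm_num
    · rw [h]; simp
    · rw [Int.sign_eq_one_of_pos h]; norm_num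
  have hj1 : 1 ≤ |j| := Int.one_le_abs hj
  have hj'1 : 1 ≤ |j'| := Int.one_le_abs hj'0
  set c2 : ZMod M := (zc M (2 * (l * j) * s0 + (l * j) ^ 2)) with hc2
  set c3 : ZMod M := (zc M (2 * (l * j') * s0 + (l * j') ^ 2 - l * j')) with hc3
  set c4 : ZMod M := c2 + c3 + (zc M (2 * (l * j) * (l * j'))) with hc4
  have h2 := U3a K M L hKp (128 * Q ^ 4) ((Q ^ 39 * L : ℕ) : ℝ) (by nlinarith [one_le_pow₀ (by linarith : (1:ℝ) ≤ Q) (n := 4)]) (by positivity) (by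
      have : Q ^ 91 * L ≤ K := L1
      have h3 : (Q:ℝ) ^ 91 * L ≤ K := by exact_mod_cast L1
      refine le_trans ?_ h3
      push_cast
      have h4 : (2:ℝ) ^ 36 * Q ^ 55 ≤ Q ^ 91 := cpow hQr 36 le_rfl (by norm_num)
      calc 256 * ((Q:ℝ) ^ 39 * L) * (128 * Q ^ 4) ^ 4 = (2 ^ 36 * Q ^ 55) * L := by ring
        _ ≤ _ := by gcongr) h (fun x => conj (h (x + c2))) (fun x => conj (h (x + c3))) (fun x => h (x + c4))
      hh (fun _ => bd_conj (hh _)) (fun _ => bd_conj (hh _)) (fun _ => hh _)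
      (zc M (2 * l * j)) (zc M (2 * l * j')) (fun t => Int.sign (j + j') * |j * j'| * t)
      (fun t => Int.sign j' * |j| * t) (fun t => Int.sign j * |j'| * t)
      (bdshift _ _ (hsg _) (by rw [abs_abs])) (bdshift _ _ (hsg _) (by rw [abs_abs, abs_mul j j']; exact le_mul_of_one_le_right (abs_nonneg _) hj'1))
      (bdshift _ _ (hsg _) (by rw [abs_abs, abs_mul j j']; exact le_mul_of_one_le_left (abs_nonneg _) hj1)) (by
        refine h1.trans (le_of_eq ?_)
        congr 2
        refine sum_congr rfl fun y _ => ?_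
        unfold Q4
        refine sum_congr rfl fun x _ => ?_
        rw [mul_assoc, mul_assoc]
        have a1 : x + (zc M (2 * (l * j) * (y + s0) + (l * j) ^ 2)) = x + (zc M (2 * l * j)) * y + c2 := by
          rw [hc2]; push_cast; ring
        have a2 : x + (zc M (2 * (l * J * i) * (y + s0) + (l * J * i) ^ 2 - l * J * i)) = x + (zc M (2 * l * j')) * y + c3 := by
          rw [hc3, hj']; push_cast; ring
        have a3 : x + (zc M (2 * (l * j) * (y + s0) + (l * j) ^ 2)) + (zc M (2 * (l * J * i) * (y + s0) + (l * J * i) ^ 2 - l * J * i)) +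
            (zc M (2 * (l * j) * (l * J * i))) = x + ((zc M (2 * l * j)) + (zc M (2 * l * j'))) * y + c4 := by
          rw [hc4, hc3, hc2, hj']; push_cast; ring
        rw [a3, a1, a2]; ring)
  have hsa : ∀ z : ℤ, z * Int.sign z = |z| := fun z => by rw [mul_comm, Int.sign_mul_self_eq_abs]
  have hna : ∀ z : ℤ, ((z.natAbs : ℕ) : ZMod M) = (zc M (|z|)) := fun z => by rw [← Int.natCast_natAbs z, Int.cast_natCast]
  have hqc : (q : ZMod M) = (zc M (2 * l * |j * j'|)) := by
    rw [hq, Int.cast_mul, ← hna (j * j')]; push_cast; ring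
  have hσc : (σ : ZMod M) = (zc M (|j + j'|)) := by
    rw [hσ, hna]
  have i1 : ∀ t : ℕ, ((zc M (2 * l * j)) + (zc M (2 * l * j'))) * (zc M (Int.sign (j + j') * |j * j'| * t)) = q * σ * t := by
    intro t; rw [hqc, hσc, ← hsa (j + j')]; push_cast; ring
  have i2 : ∀ t : ℕ, (zc M (2 * l * j')) * (zc M (Int.sign j' * |j| * t)) = q * t := by
    intro t; rw [hqc, abs_mul j j', ← hsa j']; push_cast; ring
  have i3 : ∀ t : ℕ, (zc M (2 * l * j)) * (zc M (Int.sign j * |j'| * t)) = q * t := by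
    intro t; rw [hqc, abs_mul j j', ← hsa j]; push_cast; ring
  simp only [i1, i2, i3] at h2
  obtain ⟨t0, ht0, θ, h5⟩ := U3b M L hL q σ (fun x => h (x + c4)) (fun _ => hh _) _ (by positivity) h2 (-c4)
  obtain ⟨x0, hx0⟩ := blockpig M q (fun x => ∑ s ∈ range L, ‖∑ t ∈ range L, h (x + q * t) * conj (h (x + q * t + q * σ * (s - t0))) * ee (θ s x * t)‖ ^ 2)
  refine ⟨t0, hqz, cx, hσ1, hσQ.trans (hpm _ _ (by norm_num)), ht0, x0, fun s r => θ s (x0 + (r.val : ZMod M)), ?_⟩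
  rw [sum_comm] at h5 hx0
  have h6 : (M:ℝ) * L ^ 3 ≤ 3 * (2 ^ 14 * (128 * Q ^ 4) ^ 8) * ∑ s ∈ range L, ∑ x, ‖∑ t ∈ range L, h (x + q * t) * conj (h (x + q * t + q * σ * (s - t0))) * ee (θ s x * t)‖ ^ 2 := by
    refine h5.trans (le_of_eq ?_)
    rw [sum_comm]
    congr 1
    refine sum_congr rfl fun s _ => sum_congr rfl fun x _ => ?_
    congr 2
    refine sum_congr rfl fun t _ => ?_
    have a1 : x + -c4 + q * t + c4 = x + q * t := by ring
    have a2 : x + -c4 + q * t + q * σ * (s - t0) + c4 = x + q * t + q * σ * (s - t0) := by ring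
    rw [a1, a2]
  have h7 : 3 * ((2:ℝ) ^ 14 * (128 * Q ^ 4) ^ 8) ≤ Q ^ 130 := by
    have := cpow hQr (b := 32) (n := 130) 72 (by norm_num : (3:ℝ) * 2 ^ 70 ≤ 2 ^ 72) (by norm_num)
    refine le_trans (le_of_eq ?_) this
    ring
  refine cL ?_ hMr
  push_cast
  rw [sum_comm (s := range L)]
  set S2 := ∑ r : ZMod q, ∑ s ∈ range L, ‖∑ t ∈ range L,
        h (x0 + (r.val : ZMod M) + q * t) * conj (h (x0 + (r.val : ZMod M) + q * t + q * σ * (s - t0))) * ee (θ s (x0 + (r.val : ZMod M)) * t)‖ ^ 2 with hS2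
  have hS2n : 0 ≤ S2 := by positivity
  calc (M:ℝ) * (q * L ^ 3) = q * (M * L ^ 3) := by ring
    _ ≤ (q:ℝ) * (3 * (2 ^ 14 * (128 * (Q:ℝ) ^ 4) ^ 8) * _) := mL h6 (by positivity)
    _ = 3 * (2 ^ 14 * (128 * (Q:ℝ) ^ 4) ^ 8) * ((q:ℝ) * _) := by ring
    _ ≤ 3 * (2 ^ 14 * (128 * (Q:ℝ) ^ 4) ^ 8) * (M * S2) := mL hx0 (by positivity)
    _ ≤ (Q:ℝ) ^ 130 * (M * S2) := mR h7 (by positivity)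
    _ = _ := by ring

noncomputable def HP (P : ℕ) (α : ℝ) : ℤ → ℂ := fun n => if 0 ≤ n ∧ n < P then ee (α * n) else 0

lemma HP_supp (P : ℕ) (α : ℝ) (x : ℤ) (h : HP P α x ≠ 0) : 0 ≤ x ∧ x < P := by
  unfold HP at h; by_contra hc; exact h (if_neg hc)

lemma HP_bd (P : ℕ) (α : ℝ) (x : ℤ) : ‖HP P α x‖ ≤ 1 := by
  unfold HP; split_ifs
  · exact (norm_ee _).le
  · simp

lemma HP_inner (P K : ℕ) (α : ℝ) (n : ℤ) (a a' : ℕ) :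
    ‖∑ y ∈ IC K, HP P α (n - y + (y + a) ^ 2) * conj (HP P α (n - y + (y + a') ^ 2))‖ * (2 * nd (2 * α * (a' - a))) ≤ 1 := by
  set S := (IC K).filter fun y => (0 ≤ n - y + (y + a) ^ 2 ∧ n - y + (y + a) ^ 2 < P) ∧ (0 ≤ n - y + (y + a') ^ 2 ∧ n - y + (y + a') ^ 2 < P) with hS
  have h1 : ∑ y ∈ IC K, HP P α (n - y + (y + a) ^ 2) * conj (HP P α (n - y + (y + a') ^ 2)) =
      ∑ y ∈ S, ee (-(2 * α * (a' - a)) * y + α * (a ^ 2 - a' ^ 2)) := by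
    rw [hS, sum_filter]
    refine sum_congr rfl fun y _ => ?_
    unfold HP
    by_cases h1 : 0 ≤ n - y + (y + a) ^ 2 ∧ n - y + (y + a) ^ 2 < P <;> by_cases h2 : 0 ≤ n - y + (y + a') ^ 2 ∧ n - y + (y + a') ^ 2 < P <;>
      simp only [h1, h2, if_true, if_false, true_and, and_true, false_and, map_zero, mul_zero, zero_mul, and_self, and_false]
    rw [← ee_neg, ← ee_add]
    congr 1; push_cast; ring
  rw [h1]
  obtain ⟨u, v, huv⟩ : ∃ u v, S = Ico u v := by
    apply ordc_Ico
    have mono : ∀ (b : ℕ) (x y : ℤ), 1 ≤ x → x ≤ y → (x + b) ^ 2 - x ≤ (y + b) ^ 2 - y := by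
      intro b x y h1 h2
      nlinarith [mul_nonneg (sub_nonneg.2 h2) (by positivity : (0:ℤ) ≤ b), mul_nonneg (sub_nonneg.2 h2) (by linarith : 0 ≤ x + y - 1)]
    intro x hx z hz y h1 h2
    rw [hS, mem_filter, mem_Icc] at *
    have a1 := mono a x y hx.1.1 h1
    have a2 := mono a y z (by omega) h2
    have a3 := mono a' x y hx.1.1 h1
    have a4 := mono a' y z (by omega) h2
    refine ⟨⟨?_, ?_⟩, ⟨?_, ?_⟩, ?_, ?_⟩ <;> linarith
  rw [huv]
  have := geo_Ico (-(2 * α * (a' - a))) (α * (a ^ 2 - a' ^ 2)) u v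
  rw [nd_neg] at this; exact this

/-- Lemma M for truncated phases -/
lemma LemM2 (Q K M P : ℕ) [NeZero M] (hQ : 2 ≤ Q) (hK : Q ^ 200 ≤ K) (hM : 100 * K ^ 2 = M) (hP : P ≤ K ^ 2)
    (f g : ZMod M → ℂ) (hf : ∀ x, ‖f x‖ ≤ 1) (hg : ∀ x, ‖g x‖ ≤ 1) (α : ℝ)
    (H : (M:ℝ) ≤ Q * ‖∑ n ∈ IZ P, Dl K f g (n : ZMod M) * ee (α * n)‖) :
    ∃ v : ℕ, 1 ≤ v ∧ v ≤ Q ^ 201 ∧ nd (v * α) ≤ Q ^ 201 / K ^ 2 := by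
  obtain ⟨A, hA1, hAK, hKA, hAQ⟩ := Aexists K Q hQ hK
  have hKp : 0 < K := lt_of_lt_of_le (Nat.pow_pos (by omega)) hK
  have hQr : (2:ℝ) ≤ Q := by exact_mod_cast hQ
  have hMp : (0:ℝ) < M := by exact_mod_cast NeZero.pos M
  have hKK : (K:ℤ) ≤ K ^ 2 := by exact_mod_cast nsp (by norm_num) K
  have hMz : 100 * (K:ℤ) ^ 2 = M := by exact_mod_cast hM
  have hPz : (P:ℤ) ≤ (K:ℤ) ^ 2 := by exact_mod_cast hP
  set h := cyc M (HP P α) with hh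
  have hb1 : ∀ x, ‖h x‖ ≤ 1 := fun x => HP_bd _ _ _
  have HL : (M:ℝ) * K ≤ Q * ‖Lam K f g h‖ := by
    rw [Lam_Dl K hKp, hh, sum_cyc _ _ P (by linarith [sq_nonneg (K:ℤ)]) (HP_supp P α), norm_mul, Complex.norm_natCast]
    have e : ∑ n ∈ IZ P, Dl K f g (n : ZMod M) * HP P α n = ∑ n ∈ IZ P, Dl K f g (n : ZMod M) * ee (α * n) := by
      refine sum_congr rfl fun n hn => ?_
      unfold HP; rw [if_pos (mem_Ico.1 hn)]
    rw [e]
    calc (M:ℝ) * K ≤ _ * K := mR H (by positivity)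
      _ = _ := by ring
  have h1 := vdc_pair (X := ZMod M) K Q A ({()} : Finset Unit) (range A) (fun i => (i:ℤ)) (by
      intro i hi
      rw [mem_range] at hi
      push_cast
      rw [abs_of_nonneg (by positivity)]; exact_mod_cast hi.le) (fun _ x => f x)
    (fun _ x y => g (x + (y : ZMod M)) * h (x + (y : ZMod M) ^ 2))
    (fun _ x => hf x) (fun _ x y => bd_mul (hg _) (hb1 _))
    (by linarith) (by exact_mod_cast hAQ) (by
      simp only [card_singleton, sum_singleton, ZMod.card]
      rw [Nat.cast_one, mul_one]
      refine HL.trans (le_of_eq ?_)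
      congr 2
      unfold Lam
      refine sum_congr rfl fun y _ => sum_congr rfl fun x _ => ?_
      ring)
  set φ : ℝ := 2 * α with hφ
  set B : ℕ → ℕ → ℤ → ℝ := fun a a' n => ‖∑ y ∈ IC K, HP P α (n - y + (y + a) ^ 2) * conj (HP P α (n - y + (y + a') ^ 2))‖ with hB
  set I := Ico (-90 * (K:ℤ) ^ 2) (-90 * (K:ℤ) ^ 2 + M) with hI
  have hIc : (I.card : ℝ) = M := by rw [hI, Int.card_Ico]; simp
  set b : ℕ → ℕ → ℝ := fun a a' => (∑ n ∈ I, B a a' n) / M with hb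
  have h2 : ∀ a ∈ range A, ∀ a' ∈ range A, ‖∑ y ∈ IC K, ∑ x : ZMod M, (g (x + (zc M (y + a))) * h (x + (zc M (y + a)) ^ 2)) *
      conj (g (x + (zc M (y + a'))) * h (x + (zc M (y + a')) ^ 2))‖ ≤ M * b a a' := by
    intro a ha a' ha'
    have e : ∀ y ∈ IC K, ∑ x : ZMod M, (g (x + (zc M (y + a))) * h (x + (zc M (y + a)) ^ 2)) *
      conj (g (x + (zc M (y + a'))) * h (x + (zc M (y + a')) ^ 2)) =
      ∑ n ∈ I, (g ((n : ZMod M) + a) * conj (g ((n : ZMod M) + a'))) * (HP P α (n - y + (y + a) ^ 2) * conj (HP P α (n - y + (y + a') ^ 2))) := by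
      intro y hy
      rw [← shiftZ _ (-(y : ZMod M)), sum_zmod_Ico _ (-90 * (K:ℤ) ^ 2)]
      refine sum_congr rfl fun n hn => ?_
      rw [mem_Ico] at hn
      rw [mem_Icc] at hy
      have k : ∀ c ∈ range A, h ((n : ZMod M) + -(y : ZMod M) + (zc M (y + c)) ^ 2) = HP P α (n - y + (y + c) ^ 2) := by
        intro c hc
        rw [mem_range] at hc
        have e1 : (n : ZMod M) + -(y : ZMod M) + (zc M (y + c)) ^ 2 = (zc M (n - y + (y + c) ^ 2)) := by push_cast; ring
        have e2 : (y + c : ℤ) ^ 2 ≤ (2 * K) ^ 2 := pL (by omega) (by omega) 2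
        have e3 : (0:ℤ) ≤ (y + c : ℤ) ^ 2 := sq_nonneg _
        rw [e1, hh, cyc_int (HP P α) P (HP_supp P α) _ (by nlinarith) (by nlinarith)]
      have a1 : ∀ c : ℕ, (n : ZMod M) + -(y : ZMod M) + (zc M (y + c)) = n + c := by intro c; push_cast; ring
      rw [k a ha, k a' ha', a1, a1, map_mul]; ring
    rw [sum_congr rfl e, sum_comm, hb]
    simp only
    rw [mul_div_cancel₀ _ hMp.ne']
    refine (norm_sum_le _ _).trans (sum_le_sum fun n _ => ?_)
    rw [← mul_sum, norm_mul]
    exact mul_le_of_le_one_left (norm_nonneg _) (bd_mul (hg _) (bd_conj (hg _)))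
  have h3 : (M:ℝ) * ((K:ℝ) * A ^ 2) ≤ M * ((Q ^ 4 : ℕ) * ∑ a ∈ range A, ∑ a' ∈ range A, b a a') := by
    simp only [card_product, card_singleton, card_range, ZMod.card, sum_product, sum_singleton] at h1
    push_cast at h1 ⊢
    calc (M:ℝ) * (K * A ^ 2) = M * K * (1 * (A * A)) := by ring
      _ ≤ _ := h1
      _ ≤ 4 * (Q:ℝ) ^ 2 * ∑ a ∈ range A, ∑ a' ∈ range A, M * b a a' := by
        refine mL (sum_le_sum fun a ha => sum_le_sum fun a' ha' => ?_) (by positivity)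
        have := h2 a ha a' ha'
        push_cast at this
        exact this
      _ = M * (4 * (Q:ℝ) ^ 2 * ∑ a ∈ range A, ∑ a' ∈ range A, b a a') := by simp only [← mul_sum]; ring
      _ ≤ _ := by
        refine mL (mR (cpow hQr 2 (by norm_num) (by norm_num)) ?_) (by positivity)
        exact sum_nonneg fun a _ => sum_nonneg fun a' _ => div_nonneg (sum_nonneg fun _ _ => norm_nonneg _) (by positivity)
  obtain ⟨v, hv1, hv2, hv3⟩ := AL2 K A (Q ^ 4) (hQ.trans (nsp (by norm_num) _)) (by rw [← pow_mul]; exact hK) hKA hAK φ b (by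
      intro a a'
      rw [hb]; simp only
      rw [div_le_iff₀ hMp, mul_comm, ← hIc, ← nsmul_eq_mul]
      refine slc _ _ _ fun n _ => ?_
      refine (norm_sum_le _ _).trans ((slc _ _ 1 fun x _ => bd_mul (HP_bd _ _ _) (bd_conj (HP_bd _ _ _))).trans ?_)
      simp) (by
      intro a a'
      rw [hb]; simp only
      rw [div_mul_eq_mul_div, div_le_iff₀ hMp, one_mul, sum_mul]
      refine (slc _ _ 1 fun n _ => HP_inner P K α n a a').trans ?_
      rw [nsmul_eq_mul, mul_one, hIc]) (cL h3 hMp)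
  have hpow : Q ^ 200 * 2 ≤ Q ^ 201 := by rw [pow_succ]; exact nmL _ hQ
  refine ⟨2 * v, by omega, ?_, ?_⟩
  · have hv2' : v ≤ Q ^ 200 := by rw [← pow_mul] at hv2; exact hv2
    omega
  · have e : ((2 * v : ℕ) : ℝ) * α = v * φ := by rw [hφ]; push_cast; ring
    rw [e]
    refine hv3.trans ?_
    rw [Nat.cast_pow, ← pow_mul]
    exact div_le_div_of_nonneg_right (pow_le_pow_right₀ (by linarith) (by norm_num)) (by positivity)

lemma sum_HH {M : ℕ} [NeZero M] (E : ZMod M → ℂ) (q L : ℕ) [NeZero q] (hqL : q * L ≤ M)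
    (c : ZMod q → ℂ) (β : ZMod q → ℝ) :
    ∑ x, E x * cyc M (HH q L c β) x = ∑ r, c r * ∑ t ∈ IZ L, E (zc M (r.val + q * t)) * ee (β r * t) := by
  have hq : (0:ℤ) < q := by exact_mod_cast NeZero.pos q
  rw [sum_cyc _ _ (q * L) (by exact_mod_cast hqL) (HH_supp q L c β), sum_block]
  refine sum_congr rfl fun r _ => ?_
  rw [mul_sum]
  refine sum_congr rfl fun t ht => ?_
  rw [mem_Ico] at ht
  have hv := ZMod.val_lt r
  have e1 : (((r.val:ℤ) + q * t : ℤ) : ZMod q) = r := by push_cast; simp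
  have e2 : ((r.val:ℤ) + q * t) / (q:ℤ) = t := by
    rw [Int.add_mul_ediv_left _ _ hq.ne', Int.ediv_eq_zero_of_lt (by omega) (by omega), zero_add]
  have e3 : 0 ≤ (r.val:ℤ) + q * t ∧ (r.val:ℤ) + q * t < q * L := by
    constructor
    · nlinarith
    · nlinarith
  unfold HH
  rw [if_pos e3, e1, e2]; ring

lemma HH_conj (q L : ℕ) (c c' : ZMod q → ℂ) (β β' : ZMod q → ℝ) (x : ℤ) :
    HH q L c β x * conj (HH q L c' β' x) = HH q L (fun r => c r * conj (c' r)) (fun r => β r - β' r) x := by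
  unfold HH
  split_ifs with h
  · rw [sub_mul, sub_eq_add_neg, ee_add, ee_neg, map_mul]; ring
  · simp

lemma Dl_shift {M : ℕ} (K : ℕ) (f g : ZMod M → ℂ) (x w : ZMod M) :
    Dl K f g (x + w) = Dl K (fun z => f (z + w)) (fun z => g (z + w)) x := by
  unfold Dl
  congr 1
  refine sum_congr rfl fun y _ => ?_
  have a1 : x + w - (y : ZMod M) ^ 2 = x - (y : ZMod M) ^ 2 + w := by ring
  have a2 : x - (y : ZMod M) ^ 2 + w + y = x - (y : ZMod M) ^ 2 + y + w := by ring
  rw [a1, a2]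

lemma AStep1 (Q K M l q L : ℕ) [NeZero M] [NeZero q] (cx : Ctx Q K M l q L) (hKp : 0 < K)
    (f g E : ZMod M → ℂ) (hE : ∀ x, ‖E x‖ ≤ 1)
    (w : ℕ → ZMod M) (c : ℕ → ZMod q → ℂ) (θ : ℕ → ZMod q → ℝ)
    (H : (q:ℝ) * L ^ 2 ≤ Q * ‖∑ s ∈ range L, ∑ r, c s r * ∑ t ∈ IZ L,
      (E (zc M (r.val + q * t)) * Dl K f g ((zc M (r.val + q * t)) + w s)) * ee (θ s r * t)‖) :
    (q:ℝ) * L ^ 3 ≤ 100 * Q ^ 3 * ∑ s ∈ range L, ∑ s' ∈ range L, ‖∑ r, (c s r * conj (c s' r)) * ∑ t ∈ IZ L,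
      Dl K (fun x => f (x + w s) * conj (f (x + w s'))) (fun x => g (x + w s) * conj (g (x + w s'))) (zc M (r.val + q * t)) * ee ((θ s r - θ s' r) * t)‖ := by
  obtain ⟨hQ, hM, hL, hqL, hKq⟩ := cx.real
  have hqLM : q * L ≤ M := cx.hqL.trans (by have := cx.hM; omega)
  have hKr : (0:ℝ) < K := by exact_mod_cast hKp
  have hqr : (0:ℝ) < q := by exact_mod_cast NeZero.pos q
  set h : ℕ → ZMod M → ℂ := fun s => cyc M (HH q L (c s) (θ s)) with hh
  set F : ℕ → ℤ → ZMod M → ℂ := fun s y x => f (x + w s) * g (x + y + w s) * h s (x + (y : ZMod M) ^ 2) with hF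
  set Z : ℕ → ℕ → ℂ := fun s s' => ∑ r, (c s r * conj (c s' r)) * ∑ t ∈ IZ L,
      Dl K (fun x => f (x + w s) * conj (f (x + w s'))) (fun x => g (x + w s) * conj (g (x + w s'))) (zc M (r.val + q * t)) * ee ((θ s r - θ s' r) * t) with hZ
  have h1 : (K:ℂ) * ∑ s ∈ range L, ∑ r, c s r * ∑ t ∈ IZ L,
      (E (zc M (r.val + q * t)) * Dl K f g ((zc M (r.val + q * t)) + w s)) * ee (θ s r * t) =
      ∑ y ∈ IC K, ∑ x, E (x + (y : ZMod M) ^ 2) * ∑ s ∈ range L, F s y x := by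
    have e : ∀ s ∈ range L, (K:ℂ) * ∑ r, c s r * ∑ t ∈ IZ L,
      (E (zc M (r.val + q * t)) * Dl K f g ((zc M (r.val + q * t)) + w s)) * ee (θ s r * t) =
      ∑ y ∈ IC K, ∑ x, E (x + (y : ZMod M) ^ 2) * F s y x := by
      intro s _
      rw [← sum_HH (fun x => E x * Dl K f g (x + w s)) q L hqLM]
      have := Lam_Dl K hKp (fun z => f (z + w s)) (fun z => g (z + w s)) (fun x => E x * h s x)
      rw [show ∑ x, E x * Dl K f g (x + w s) * cyc M (HH q L (c s) (θ s)) x = ∑ x, Dl K (fun z => f (z + w s)) (fun z => g (z + w s)) x * (E x * h s x) from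
        sum_congr rfl fun x _ => by rw [Dl_shift]; ring, ← this]
      unfold Lam
      refine sum_congr rfl fun y _ => sum_congr rfl fun x _ => ?_
      simp only [hF]; ring
    rw [mul_sum, sum_congr rfl e, sum_comm]
    refine sum_congr rfl fun y _ => ?_
    rw [sum_comm]
    exact sum_congr rfl fun x _ => (mul_sum _ _ _).symm
  have h2 : (K:ℝ) * (q * L ^ 2) / Q ≤ ∑ p ∈ IC K ×ˢ (univ : Finset (ZMod M)), ‖∑ s ∈ range L, F s p.1 p.2‖ := by
    rw [div_le_iff₀ (by linarith)]
    have e : ‖∑ y ∈ IC K, ∑ x, E (x + (y : ZMod M) ^ 2) * ∑ s ∈ range L, F s y x‖ ≤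
        ∑ p ∈ IC K ×ˢ (univ : Finset (ZMod M)), ‖∑ s ∈ range L, F s p.1 p.2‖ := by
      rw [sum_product]
      refine (norm_sum_le _ _).trans (sum_le_sum fun y _ => (norm_sum_le _ _).trans (sum_le_sum fun x _ => ?_))
      rw [norm_mul]
      exact mul_le_of_le_one_left (norm_nonneg _) (hE _)
    rw [← h1, norm_mul, Complex.norm_natCast] at e
    set X := ‖∑ s ∈ range L, ∑ r, c s r * ∑ t ∈ IZ L,
      (E (zc M (r.val + q * t)) * Dl K f g ((zc M (r.val + q * t)) + w s)) * ee (θ s r * t)‖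
    calc (K:ℝ) * (q * L ^ 2) ≤ K * (Q * X) := mL H hKr.le
      _ = (K * X) * Q := by ring
      _ ≤ _ := mR e (by linarith)
  have h3 := cs_card _ _ _ ((K:ℝ) * M) h2 (by positivity) (by rw [card_product, card_univ, ZMod.card]; simp)
  have h4 : ∑ p ∈ IC K ×ˢ (univ : Finset (ZMod M)), ‖∑ s ∈ range L, F s p.1 p.2‖ ^ 2 ≤
      K * ∑ s ∈ range L, ∑ s' ∈ range L, ‖Z s s'‖ := by
    have e : ((∑ p ∈ IC K ×ˢ (univ : Finset (ZMod M)), ‖∑ s ∈ range L, F s p.1 p.2‖ ^ 2 : ℝ) : ℂ) =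
        K * ∑ s ∈ range L, ∑ s' ∈ range L, Z s s' := by
      rw [Complex.ofReal_sum, sum_product]
      simp only [norm_sq_sum_eq]
      rw [swap22, mul_sum]
      refine sum_congr rfl fun s _ => ?_
      rw [mul_sum]
      refine sum_congr rfl fun s' _ => ?_
      simp only [hZ]
      rw [← Lam_HH K hKp _ _ q L hqLM]
      unfold Lam
      refine sum_congr rfl fun y _ => sum_congr rfl fun x _ => ?_
      simp only [hF, hh]
      unfold cyc
      rw [← HH_conj]
      simp only [map_mul]; ring
    have e2 : (∑ p ∈ IC K ×ˢ (univ : Finset (ZMod M)), ‖∑ s ∈ range L, F s p.1 p.2‖ ^ 2 : ℝ) = ‖(K:ℂ) * ∑ s ∈ range L, ∑ s' ∈ range L, Z s s'‖ := by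
      rw [← e, Complex.norm_real, Real.norm_of_nonneg (by positivity)]
    rw [e2, norm_mul, Complex.norm_natCast]
    exact mL ((norm_sum_le _ _).trans (sum_le_sum fun s _ => norm_sum_le _ _)) hKr.le
  set ZZ := ∑ s ∈ range L, ∑ s' ∈ range L, ‖Z s s'‖ with hZZ
  have hZZ0 : 0 ≤ ZZ := by positivity
  have h5 : ((K:ℝ) * (q * L ^ 2)) ^ 2 ≤ (K * M * (K * ZZ)) * Q ^ 2 := by
    have := h3.trans (mL h4 (by positivity))
    rw [div_pow, div_le_iff₀ (by positivity)] at this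
    exact this
  have h6 : ((K:ℝ) ^ 2 * (q * L)) * (q * L ^ 3) ≤ (K ^ 2 * (q * L)) * (100 * Q ^ 3 * ZZ) := by
    calc ((K:ℝ) ^ 2 * (q * L)) * (q * L ^ 3) = ((K:ℝ) * (q * L ^ 2)) ^ 2 := by ring
      _ ≤ _ := h5
      _ = (K:ℝ) ^ 2 * (100 * ZZ * Q ^ 2) * K ^ 2 := by rw [hM]; ring
      _ ≤ (K:ℝ) ^ 2 * (100 * ZZ * Q ^ 2) * (Q * (q * L)) := mL hKq (by positivity)
      _ = _ := by ring
  exact cL h6 (by positivity)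

lemma PairM : ∃ n : ℕ, 1 ≤ n ∧ ∀ (Q K M l q L : ℕ) [NeZero M] [NeZero q] (cx : Ctx Q K M l q L) (hK : Q ^ n ≤ K)
    (f g : ZMod M → ℂ) (hf : ∀ x, ‖f x‖ ≤ 1)
    (hg : ∀ x, ‖g x‖ ≤ 1) (c : ZMod q → ℂ) (β : ZMod q → ℝ) (hc : ∀ r, ‖c r‖ ≤ 1)
    (H : (q:ℝ) * L ≤ Q * ‖∑ r, c r * ∑ t ∈ IZ L, Dl K f g (zc M (r.val + q * t)) * ee (β r * t)‖),
    ∃ v : ℕ, 1 ≤ v ∧ v ≤ Q ^ n ∧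
     (q:ℝ) ≤ (Q ^ n : ℕ) * ((univ.filter fun r : ZMod q => c r ≠ 0 ∧ nd (v * β r) ≤ (Q ^ n : ℕ) / L).card : ℝ) := by
  obtain ⟨n, hn⟩ := LemP
  obtain ⟨m, hm⟩ : ∃ m, m = (n + 8) * 201 := ⟨_, rfl⟩
  refine ⟨m + 1, by omega, ?_⟩
  intro Q K M l q L _ _ cx hK f g hf hg c β hc H
  obtain ⟨hQ, hM, hL, hqL, hKq⟩ := cx.real
  have hQ1 : 0 < Q := by have := cx.hQ; omega
  have hKa : ∀ a, a ≤ m + 1 → Q ^ a ≤ K := fun a ha => (npR hQ1 ha).trans hK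
  have hKp : 0 < K := lt_of_lt_of_le (Nat.pow_pos hQ1) hK
  have hKr : (0:ℝ) < K := by exact_mod_cast hKp
  obtain ⟨α, h1, h2⟩ := hn Q K M l q L cx (hKa _ (by omega)) f g hf hg c β hc H
  set X := ‖∑ n ∈ IZ (q * L), Dl K f g (n : ZMod M) * ee (α * n)‖ with hX
  have h3 : (M:ℝ) ≤ (Q ^ (n + 8) : ℕ) * X := by
    push_cast at h1 ⊢
    calc (M:ℝ) ≤ 100 * (Q * (q * L)) := by rw [hM]; linarith
      _ ≤ 100 * (Q * ((Q:ℝ) ^ n * X)) := by gcongr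
      _ = (100 * (Q:ℝ) ^ (n + 1)) * X := by ring
      _ ≤ _ := mR (cpow hQ 7 (by norm_num) (by omega)) (norm_nonneg _)
  obtain ⟨v, hv1, hv2, hv3⟩ := LemM2 (Q ^ (n + 8)) K M (q * L) (cx.hQ.trans (nsp (by omega) _))
    (by rw [← pow_mul]; exact hKa _ (by omega)) cx.hM cx.hqL f g hf hg α (by push_cast at h3 hX ⊢; rw [← hX]; exact h3)
  have e1 : (((Q ^ (n + 8) : ℕ) : ℝ)) ^ 201 = (Q:ℝ) ^ m := by rw [hm, Nat.cast_pow, ← pow_mul]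
  have hv2' : v ≤ Q ^ m := by rw [hm, pow_mul]; exact hv2
  have hv2r : (v:ℝ) ≤ (Q:ℝ) ^ m := by exact_mod_cast hv2'
  rw [e1] at hv3
  refine ⟨v, hv1, hv2'.trans (npR hQ1 (by omega)), h2.trans ?_⟩
  refine mul_le_mul (Nat.cast_le.2 (npR hQ1 (by omega))) (Nat.cast_le.2 (card_le_card ?_)) (by positivity) (by positivity)
  intro r hr
  rw [mem_filter] at hr ⊢
  refine ⟨hr.1, hr.2.1, ?_⟩
  have e2 : (v:ℝ) * β r = v * (β r - q * α) + (q:ℕ) * (v * α) := by ring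
  rw [e2]
  refine (nd_add _ _).trans ?_
  have k1 := nd_nat_mul v (β r - q * α)
  have k2 := nd_nat_mul q (v * α)
  have k3 : (v:ℝ) * nd (β r - q * α) ≤ (Q:ℝ) ^ m * (1 / L) := mul_le_mul hv2r hr.2.2 (nd_nonneg _) (by positivity)
  have k4 : (q:ℝ) * nd (v * α) ≤ (Q:ℝ) ^ m * (1 / L) := by
    refine (mL hv3 (by positivity)).trans ?_
    rw [← mul_div_assoc, div_le_iff₀ (by positivity)]
    have : (Q:ℝ) ^ m * (1 / L) * K ^ 2 = Q ^ m * (K ^ 2 / L) := by ring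
    rw [this, mul_comm]
    refine mL ?_ (by positivity)
    rwa [le_div_iff₀ hL]
  have k5 : (2:ℝ) * Q ^ m ≤ Q ^ (m + 1) := cpow hQ 1 (by norm_num) (by omega)
  push_cast
  calc _ ≤ (Q:ℝ) ^ m * (1 / L) + (Q:ℝ) ^ m * (1 / L) := by linarith
    _ = (2 * (Q:ℝ) ^ m) / L := by ring
    _ ≤ _ := by gcongr

lemma net2 {α : Type*} (G : Finset α) (ψ : α → ℝ) (v W : ℕ) (hv : 1 ≤ v) (hvW : v ≤ W) (ρ S : ℝ) (B : ℕ) (hS : 0 < S) (hB : ρ * S ≤ B)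
    (hG : ∀ a ∈ G, nd (v * ψ a) ≤ ρ) :
    ∃ τ : ℝ, (G.card : ℝ) ≤ (W * (2 * B + 3) : ℕ) * ((G.filter fun a => nd (ψ a - τ) ≤ 1 / S).card : ℝ) := by
  classical
  have hvr : (1:ℝ) ≤ v := by exact_mod_cast hv
  have key : ∀ a ∈ G, (round (v * ψ a)) % (v:ℤ) ∈ IZ v := by
    intro a _
    rw [mem_Ico]
    exact ⟨Int.emod_nonneg _ (by omega), Int.emod_lt_of_pos _ (by omega)⟩
  obtain ⟨u, -, hu⟩ := pigc G (IZ v) ⟨0, by rw [mem_Ico]; omega⟩ (fun a => (round (v * ψ a)) % (v:ℤ)) key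
  obtain ⟨τ, hτ⟩ := net1 (G.filter fun a => (round (v * ψ a)) % (v:ℤ) = u) ψ (u / v) ρ S B hS hB (by
    intro a ha
    rw [mem_filter] at ha
    have h1 := hG a ha.1
    set m := round (v * ψ a) with hm
    have h2 : (m:ℝ) = v * (m / (v:ℤ) : ℤ) + u := by
      have := Int.mul_ediv_add_emod m v
      rw [ha.2] at this
      exact_mod_cast this.symm
    refine (nd_le _ (m / (v:ℤ))).trans ?_
    have h3 : |v * ψ a - m| ≤ ρ := h1
    have h4 : v * ψ a - m = v * (ψ a - u / v - (m / (v:ℤ) : ℤ)) := by rw [h2]; field_simp; ring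
    rw [h4, abs_mul, abs_of_pos (by linarith)] at h3
    exact (le_mul_of_one_le_left (abs_nonneg _) hvr).trans h3)
  refine ⟨τ, hu.trans ?_⟩
  have hc : (IZ v).card = v := by rw [Int.card_Ico]; omega
  rw [hc]
  set N2 := (((G.filter fun a => (round (v * ψ a)) % (v:ℤ) = u).filter fun r => nd (ψ r - τ) ≤ 1 / S).card : ℝ)
  calc (v:ℝ) * _ ≤ v * ((2 * B + 3 : ℕ) * N2) := mL hτ (by positivity)
    _ ≤ (W:ℝ) * ((2 * B + 3 : ℕ) * N2) := mR (Nat.cast_le.2 hvW) (by positivity)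
    _ = (W * (2 * B + 3) : ℕ) * N2 := by push_cast; ring
    _ ≤ _ := mL (Nat.cast_le.2 (card_le_card (filter_subset_filter _ (filter_subset _ _)))) (by positivity)

set_option maxHeartbeats 1000000 in
lemma AStep2 : ∃ n : ℕ, 1 ≤ n ∧ ∀ (Q K M l q L : ℕ) [NeZero M] [NeZero q] (cx : Ctx Q K M l q L) (hK : Q ^ n ≤ K)
    (f g E : ZMod M → ℂ) (hf : ∀ x, ‖f x‖ ≤ 1)
    (hg : ∀ x, ‖g x‖ ≤ 1) (hE : ∀ x, ‖E x‖ ≤ 1)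
    (w : ℕ → ZMod M) (θ : ℕ → ZMod q → ℝ)
    (H : (q:ℝ) * L ^ 3 ≤ Q * ∑ s ∈ range L, ∑ r : ZMod q, ‖∑ t ∈ IZ L,
      (E (zc M (r.val + q * t)) * Dl K f g ((zc M (r.val + q * t)) + w s)) * ee (θ s r * t)‖ ^ 2),
    ∃ γ : ZMod q → ℝ, (q:ℝ) * L ^ 3 ≤ (Q ^ n : ℕ) * ∑ s ∈ range L, ∑ r : ZMod q, ‖∑ t ∈ IZ L,
      (E (zc M (r.val + q * t)) * Dl K f g ((zc M (r.val + q * t)) + w s)) * ee (γ r * t)‖ ^ 2 := by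
  classical
  obtain ⟨n, hn1, hn⟩ := PairM
  refine ⟨100 * n + 100, by omega, ?_⟩
  intro Q K M l q L _ _ cx hK f g E hf hg hE w θ H
  obtain ⟨hQ, hM, hL, hqL, hKq⟩ := cx.real
  have hQ2 := cx.hQ
  have hQ1 : 0 < Q := by omega
  have hKa : ∀ a, a ≤ 100 * n + 100 → Q ^ a ≤ K := fun a ha => (npR hQ1 ha).trans hK
  have hKp : 0 < K := lt_of_lt_of_le (Nat.pow_pos hQ1) hK
  have hqr : (0:ℝ) < q := by exact_mod_cast NeZero.pos q
  have hDb : ∀ x, ‖Dl K f g x‖ ≤ 1 := Dl_bd K hKp f g hf hg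
  set A : ℕ → ZMod q → ℤ → ℂ := fun s r t => E (zc M (r.val + q * t)) * Dl K f g ((zc M (r.val + q * t)) + w s) with hA
  have hA1 : ∀ s r t, ‖A s r t‖ ≤ 1 := fun s r t => bd_mul (hE _) (hDb _)
  set T : ℕ → ZMod q → ℂ := fun s r => ∑ t ∈ IZ L, A s r t * ee (θ s r * t) with hT
  have hTL : ∀ s r, ‖T s r‖ ≤ L := fun s r =>
    (norm_sum_le _ _).trans ((slc _ _ 1 fun t _ => bd_mul (hA1 s r t) (norm_ee _).le).trans (by simp))
  -- pass to large values
  have h1 : ((q:ℝ) * L) * L ≤ Q * ∑ p ∈ range L ×ˢ (univ : Finset (ZMod q)), ‖T p.1 p.2‖ := by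
    have e : ∑ s ∈ range L, ∑ r : ZMod q, ‖T s r‖ ^ 2 ≤ L * ∑ p ∈ range L ×ˢ (univ : Finset (ZMod q)), ‖T p.1 p.2‖ := by
      rw [sum_product, mul_sum]
      refine sum_le_sum fun s _ => ?_
      rw [mul_sum]
      refine sum_le_sum fun r _ => ?_
      rw [sq]; exact mR (hTL s r) (norm_nonneg _)
    have e2 := H.trans (mL e (by linarith))
    refine cL ?_ hL
    calc (L:ℝ) * (q * L * L) = q * L ^ 3 := by ring
      _ ≤ _ := e2
      _ = _ := by ring
  have h2 := popular (range L ×ˢ (univ : Finset (ZMod q))) (fun p => ‖T p.1 p.2‖) (fun p => (L:ℝ) < 2 * Q * ‖T p.1 p.2‖) Q L (q * L) (by linarith) hL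
    (by rw [card_product, card_univ, ZMod.card, card_range]; push_cast; linarith) (fun p _ hp => not_lt.1 hp) h1
  set c : ℕ → ZMod q → ℂ := fun s r => if (L:ℝ) < 2 * Q * ‖T s r‖ then phs (T s r) else 0 with hc
  have hc1 : ∀ s r, ‖c s r‖ ≤ 1 := by
    intro s r; simp only [hc]; split_ifs
    · exact phs_bd _
    · simp
  have hc0 : ∀ s r, c s r ≠ 0 → (L:ℝ) < 2 * Q * ‖T s r‖ := by
    intro s r h; simp only [hc] at h; by_contra hcon; exact h (if_neg hcon)
  have h3 : (q:ℝ) * L ^ 2 ≤ (2 * Q : ℕ) * ‖∑ s ∈ range L, ∑ r, c s r * T s r‖ := by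
    have e : ∑ s ∈ range L, ∑ r, c s r * T s r = ((∑ p ∈ range L ×ˢ (univ : Finset (ZMod q)) with (L:ℝ) < 2 * Q * ‖T p.1 p.2‖, ‖T p.1 p.2‖ : ℝ) : ℂ) := by
      rw [sum_filter, sum_product, Complex.ofReal_sum]
      refine sum_congr rfl fun s _ => ?_
      rw [Complex.ofReal_sum]
      refine sum_congr rfl fun r _ => ?_
      simp only [hc]
      split_ifs
      · exact phs_mul _
      · simp
    rw [e, Complex.norm_real, Real.norm_of_nonneg (sum_nonneg fun _ _ => norm_nonneg _)]
    push_cast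
    calc (q:ℝ) * L ^ 2 = q * L * L := by ring
      _ ≤ _ := h2
  have h4 := AStep1 (2 * Q) K M l q L (cx.mono (by omega)) hKp f g E hE w c θ h3
  set fs : ℕ → ℕ → ZMod M → ℂ := fun s s' x => f (x + w s) * conj (f (x + w s')) with hfs
  set gs : ℕ → ℕ → ZMod M → ℂ := fun s s' x => g (x + w s) * conj (g (x + w s')) with hgs
  have hfs1 : ∀ s s' x, ‖fs s s' x‖ ≤ 1 := fun s s' x => bd_mul (hf _) (bd_conj (hf _))
  have hgs1 : ∀ s s' x, ‖gs s s' x‖ ≤ 1 := fun s s' x => bd_mul (hg _) (bd_conj (hg _))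
  have hcc : ∀ s s' r, ‖c s r * conj (c s' r)‖ ≤ 1 := fun s s' r => bd_mul (hc1 _ _) (bd_conj (hc1 _ _))
  set Z : ℕ → ℕ → ℂ := fun s s' => ∑ r, (c s r * conj (c s' r)) * ∑ t ∈ IZ L,
      Dl K (fs s s') (gs s s') (zc M (r.val + q * t)) * ee ((θ s r - θ s' r) * t) with hZ
  have hZb : ∀ s s', ‖Z s s'‖ ≤ q * L := by
    intro s s'
    refine (norm_sum_le _ _).trans ((slc _ _ (L:ℝ) fun r _ => ?_).trans (by rw [card_univ, ZMod.card, nsmul_eq_mul]))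
    rw [norm_mul]
    refine (mul_le_of_le_one_left (norm_nonneg _) (hcc _ _ _)).trans ?_
    exact (norm_sum_le _ _).trans ((slc _ _ 1 fun t _ => bd_mul (Dl_bd K hKp _ _ (hfs1 s s') (hgs1 s s') _) (norm_ee _).le).trans (by simp))
  have h5 : ((L:ℝ) * L) * (q * L) ≤ (Q:ℝ) ^ 13 * ∑ p ∈ range L ×ˢ range L, ‖Z p.1 p.2‖ := by
    have e1 : (100:ℝ) * ((2 * Q : ℕ) : ℝ) ^ 3 ≤ Q ^ 13 := by
      push_cast
      have := cpow hQ (b := 3) (n := 13) 10 (by norm_num : (800:ℝ) ≤ 2 ^ 10) (by norm_num)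
      refine le_trans (le_of_eq (by ring)) this
    rw [sum_product]
    calc ((L:ℝ) * L) * (q * L) = q * L ^ 3 := by ring
      _ ≤ _ := h4
      _ ≤ _ := mR e1 (sum_nonneg fun _ _ => sum_nonneg fun _ _ => norm_nonneg _)
  have h6 := popular (range L ×ˢ range L) (fun p => ‖Z p.1 p.2‖) (fun p => (q:ℝ) * L < 2 * Q ^ 13 * ‖Z p.1 p.2‖) (Q ^ 13) (q * L) (L * L) (by positivity) (by positivity)
    (by rw [card_product, card_range]; push_cast; exact le_rfl) (fun p _ hp => not_lt.1 hp) h5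
  set GP := (range L ×ˢ range L).filter fun p => (q:ℝ) * L < 2 * Q ^ 13 * ‖Z p.1 p.2‖ with hGP
  have hQ14 : (2:ℝ) * Q ^ 13 ≤ Q ^ 14 := cpow hQ 1 (by norm_num) (by norm_num)
  have h7 : (L:ℝ) * L ≤ Q ^ 14 * GP.card := by
    have e1 : ∑ p ∈ GP, ‖Z p.1 p.2‖ ≤ GP.card * (q * L) := by
      rw [← nsmul_eq_mul]; exact slc _ _ _ fun p _ => hZb _ _
    refine le_of_mul_le_mul_right ?_ (by positivity : 0 < (q:ℝ) * L)
    calc (L:ℝ) * L * (q * L) ≤ 2 * (Q:ℝ) ^ 13 * ∑ p ∈ GP, ‖Z p.1 p.2‖ := h6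
      _ ≤ (Q:ℝ) ^ 14 * (GP.card * (q * L)) := mul_le_mul hQ14 e1 (sum_nonneg fun _ _ => norm_nonneg _) (by positivity)
      _ = _ := by ring
  obtain ⟨W, hW⟩ : ∃ W : ℕ, W = (Q ^ 14) ^ n := ⟨_, rfl⟩
  have hWe : W = Q ^ (14 * n) := by rw [hW, ← pow_mul]
  have hWp : 0 < W := by rw [hW]; exact Nat.pow_pos (Nat.pow_pos hQ1)
  set G : ℕ → ℕ → Finset (ℕ × ZMod q) := fun v s' => (range L ×ˢ univ).filter fun p => c p.1 p.2 ≠ 0 ∧ nd (v * (θ p.1 p.2 - θ s' p.2)) ≤ W / L with hG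
  have h8 : ∀ p ∈ GP, (q:ℝ) ≤ W * ∑ v ∈ Icc 1 W, ((univ.filter fun r : ZMod q => c p.1 r ≠ 0 ∧ nd (v * (θ p.1 r - θ p.2 r)) ≤ W / L).card : ℝ) := by
    intro p hp
    rw [hGP, mem_filter] at hp
    obtain ⟨v, hv1, hv2, hv3⟩ := hn (Q ^ 14) K M l q L (cx.mono (nsp (by norm_num) _)) (by rw [← pow_mul]; exact hKa _ (by omega))
      (fs p.1 p.2) (gs p.1 p.2) (hfs1 _ _) (hgs1 _ _) _ (fun r => θ p.1 r - θ p.2 r) (hcc p.1 p.2) (by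
        rw [Nat.cast_pow]
        refine hp.2.le.trans (mR hQ14 (norm_nonneg _)))
    rw [← hW] at hv2 hv3
    refine hv3.trans (mL ?_ (by positivity))
    refine le_trans ?_ (single_le_sum (f := fun v : ℕ => ((univ.filter fun r : ZMod q => c p.1 r ≠ 0 ∧ nd (v * (θ p.1 r - θ p.2 r)) ≤ W / L).card : ℝ)) (fun _ _ => Nat.cast_nonneg _) (mem_Icc.2 ⟨hv1, hv2⟩))
    refine Nat.cast_le.2 (card_le_card fun r hr => ?_)
    rw [mem_filter] at hr ⊢
    exact ⟨hr.1, left_ne_zero_of_mul hr.2.1, hr.2.2⟩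
  have hGcard : ∀ v s', ((G v s').card : ℝ) = ∑ s ∈ range L, ((univ.filter fun r : ZMod q => c s r ≠ 0 ∧ nd (v * (θ s r - θ s' r)) ≤ W / L).card : ℝ) := by
    intro v s'
    simp only [hG, card_filter, sum_product]
    push_cast; rfl
  have h9 : (q:ℝ) * (L * L) ≤ Q ^ 14 * W * ∑ p ∈ Icc 1 W ×ˢ range L, ((G p.1 p.2).card : ℝ) := by
    have e1 : (GP.card : ℝ) * q ≤ ∑ p ∈ GP, W * ∑ v ∈ Icc 1 W, ((univ.filter fun r : ZMod q => c p.1 r ≠ 0 ∧ nd (v * (θ p.1 r - θ p.2 r)) ≤ W / L).card : ℝ) := by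
      rw [← nsmul_eq_mul]; exact card_nsmul_le_sum _ _ _ h8
    have e2 : ∑ p ∈ GP, W * ∑ v ∈ Icc 1 W, ((univ.filter fun r : ZMod q => c p.1 r ≠ 0 ∧ nd (v * (θ p.1 r - θ p.2 r)) ≤ W / L).card : ℝ) ≤
        W * ∑ p ∈ Icc 1 W ×ˢ range L, ((G p.1 p.2).card : ℝ) := by
      rw [← mul_sum]
      refine mL ?_ (by positivity)
      refine (sum_le_sum_of_subset_of_nonneg (filter_subset _ _) fun _ _ _ => sum_nonneg fun _ _ => Nat.cast_nonneg _).trans (le_of_eq ?_)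
      rw [sum_comm, sum_product]
      refine sum_congr rfl fun v _ => ?_
      rw [sum_product, sum_comm]
      exact sum_congr rfl fun s' _ => (hGcard v s').symm
    calc (q:ℝ) * (L * L) ≤ q * (Q ^ 14 * GP.card) := mL h7 hqr.le
      _ = (Q:ℝ) ^ 14 * (GP.card * q) := by ring
      _ ≤ (Q:ℝ) ^ 14 * (W * ∑ p ∈ Icc 1 W ×ˢ range L, ((G p.1 p.2).card : ℝ)) := mL (e1.trans e2) (by positivity)
      _ = _ := by ring
  obtain ⟨⟨v, s'⟩, hvs, h10⟩ := pigs (Icc 1 W ×ˢ range L) ⟨(1, 0), by rw [mem_product, mem_Icc, mem_range]; exact ⟨⟨le_rfl, hWp⟩, cx.hL⟩⟩ (fun p => ((G p.1 p.2).card : ℝ))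
  rw [mem_product, mem_Icc] at hvs
  simp only [card_product, Nat.card_Icc, card_range, Nat.add_sub_cancel] at h10 hvs
  obtain ⟨τ, hτ⟩ := net2 (G v s') (fun p => θ p.1 p.2 - θ s' p.2) v W hvs.1.1 hvs.1.2 (W / L) (28 * Q * L) (28 * Q * W) (by positivity)
    (by push_cast; rw [div_mul_eq_mul_div, div_le_iff₀ hL]; exact le_of_eq (by ring)) (by
      intro p hp
      simp only [hG] at hp
      exact (mem_filter.1 hp).2.2)
  set G' := (G v s').filter fun p => nd (θ p.1 p.2 - θ s' p.2 - τ) ≤ 1 / (28 * Q * L) with hG'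
  have hWr : (1:ℝ) ≤ W := by exact_mod_cast hWp
  have h11 : (q:ℝ) * L ≤ Q ^ 22 * W ^ 4 * G'.card := by
    refine le_of_mul_le_mul_right ?_ hL
    have e3 : ((W * (2 * (28 * Q * W) + 3) : ℕ) : ℝ) ≤ Q ^ 8 * W ^ 2 := by
      push_cast
      have := cpow hQ (b := 1) (n := 8) 6 (by norm_num : (64:ℝ) ≤ 2 ^ 6) (by norm_num)
      have e4 : (1:ℝ) ≤ Q * W := by nlinarith
      calc (W:ℝ) * (2 * (28 * Q * W) + 3) ≤ W * (64 * Q ^ 1 * W) := by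
            refine mL ?_ (by positivity)
            nlinarith
        _ ≤ W * (Q ^ 8 * W) := by gcongr
        _ = _ := by ring
    calc (q:ℝ) * L * L = q * (L * L) := by ring
      _ ≤ _ := h9
      _ ≤ (Q:ℝ) ^ 14 * W * ((W * L : ℕ) * ((W * (2 * (28 * Q * W) + 3) : ℕ) * G'.card)) := by
        refine mL (h10.trans (mL hτ (by positivity))) (by positivity)
      _ ≤ (Q:ℝ) ^ 14 * W * ((W * L : ℕ) * ((Q ^ 8 * W ^ 2) * G'.card)) := by gcongr
      _ = _ := by push_cast; ring
  refine ⟨fun r => θ s' r + τ, ?_⟩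
  have h12 : ∀ p ∈ G', (L:ℝ) ^ 2 / (16 * Q ^ 2) ≤ ‖∑ t ∈ IZ L, A p.1 p.2 t * ee ((θ s' p.2 + τ) * t)‖ ^ 2 := by
    intro p hp
    rw [hG', mem_filter] at hp
    have hp1 := hp.1
    simp only [hG] at hp1
    have e1 := hc0 _ _ (mem_filter.1 hp1).2.1
    have e2 := pert L (A p.1 p.2) (hA1 _ _) (θ p.1 p.2) (θ s' p.2 + τ)
    have e3 := hp.2
    rw [sub_sub] at e3
    have e4 : 7 * (L:ℝ) ^ 2 * nd (θ p.1 p.2 - (θ s' p.2 + τ)) ≤ L / (4 * Q) := by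
      refine (mL e3 (by positivity)).trans (le_of_eq ?_)
      field_simp; norm_num
    have e5 : (L:ℝ) / (2 * Q) ≤ ‖T p.1 p.2‖ := by rw [div_le_iff₀ (by positivity)]; linarith
    have e6 : (L:ℝ) / (2 * Q) = L / (4 * Q) + L / (4 * Q) := by field_simp; norm_num
    have e7 : (L:ℝ) / (4 * Q) ≤ ‖∑ t ∈ IZ L, A p.1 p.2 t * ee ((θ s' p.2 + τ) * t)‖ := by
      have e8 : ‖T p.1 p.2‖ ≤ _ := e2
      linarith
    refine le_trans (le_of_eq ?_) (pL (by positivity) e7 2)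
    rw [div_pow]; ring
  have h13 : G'.card * ((L:ℝ) ^ 2 / (16 * Q ^ 2)) ≤ ∑ s ∈ range L, ∑ r : ZMod q, ‖∑ t ∈ IZ L, A s r t * ee ((θ s' r + τ) * t)‖ ^ 2 := by
    have e1 := card_nsmul_le_sum _ _ _ h12
    rw [nsmul_eq_mul] at e1
    refine e1.trans ?_
    have e2 : G' ⊆ range L ×ˢ (univ : Finset (ZMod q)) := (filter_subset _ _).trans (filter_subset _ _)
    refine (sum_le_sum_of_subset_of_nonneg e2 fun _ _ _ => by positivity).trans ?_
    rw [sum_product]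
  set SS := ∑ s ∈ range L, ∑ r : ZMod q, ‖∑ t ∈ IZ L, A s r t * ee ((θ s' r + τ) * t)‖ ^ 2 with hSS
  have h14 : G'.card * (L:ℝ) ^ 2 ≤ 16 * Q ^ 2 * SS := by
    rw [← mul_div_assoc, div_le_iff₀ (by positivity)] at h13; linarith
  have hSS0 : 0 ≤ SS := by positivity
  have hW4 : (W:ℝ) ^ 4 = Q ^ (56 * n) := by rw [hWe]; push_cast; rw [← pow_mul]; ring_nf
  calc (q:ℝ) * L ^ 3 = (q * L) * L ^ 2 := by ring
    _ ≤ ((Q:ℝ) ^ 22 * W ^ 4 * G'.card) * L ^ 2 := mR h11 (by positivity)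
    _ = (Q:ℝ) ^ 22 * W ^ 4 * (G'.card * L ^ 2) := by ring
    _ ≤ (Q:ℝ) ^ 22 * W ^ 4 * (16 * Q ^ 2 * SS) := mL h14 (by positivity)
    _ = (16 * (Q:ℝ) ^ (24 + 56 * n)) * SS := by rw [hW4, pow_add]; ring
    _ ≤ (Q ^ (100 * n + 100) : ℕ) * SS := by
      push_cast
      exact mR (cpow hQ 4 (by norm_num) (by omega)) hSS0

lemma sum_Ico_range (F : ℤ → ℂ) (L : ℕ) : ∑ t ∈ IZ L, F t = ∑ t ∈ range L, F (t:ℤ) := by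
  symm
  refine sum_nbij' (fun n => (n:ℤ)) (fun y => y.toNat) ?_ ?_ ?_ ?_ ?_
  · intro n hn; rw [mem_range] at hn; rw [mem_Ico]; omega
  · intro n hn; rw [mem_Ico] at hn; rw [mem_range]; omega
  · intro n _; simp
  · intro n hn; rw [mem_Ico] at hn; simp [hn.1]
  · intro n _; rfl

lemma AStep3 : ∃ n : ℕ, 1 ≤ n ∧ ∀ (Q K M l q L σ t0 : ℕ) [NeZero M] [NeZero q] (cx : Ctx Q K M l q L) (hK : Q ^ n ≤ K) (hσ1 : 1 ≤ σ) (hσ : σ ≤ Q)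
    (f g : ZMod M → ℂ) (hf : ∀ x, ‖f x‖ ≤ 1) (hg : ∀ x, ‖g x‖ ≤ 1) (γ : ZMod q → ℝ)
    (H : (q:ℝ) * L ^ 3 ≤ Q * ∑ s ∈ range L, ∑ r : ZMod q, ‖∑ t ∈ IZ L,
      (conj (Dl K f g (zc M (r.val + q * t))) * Dl K f g ((zc M (r.val + q * t)) + q * σ * (s - t0))) * ee (γ r * t)‖ ^ 2),
    ∃ j : ZMod M, (M:ℝ) ≤ (Q ^ n : ℕ) * ‖∑ x, Dl K f g x * ch j x‖ := by
  obtain ⟨n, hn⟩ := LemP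
  obtain ⟨m, hm⟩ : ∃ m, m = 4 * n + 8 := ⟨_, rfl⟩
  refine ⟨m * 5, by omega, ?_⟩
  intro Q K M l q L σ t0 _ _ cx hK hσ1 hσ f g hf hg γ H
  obtain ⟨hQ, hM, hL, hqL, hKq⟩ := cx.real
  have hQ2 := cx.hQ
  have hQ1 : 0 < Q := by omega
  have hKa : ∀ a, a ≤ m * 5 → Q ^ a ≤ K := fun a ha => (npR hQ1 ha).trans hK
  have hKp : 0 < K := lt_of_lt_of_le (Nat.pow_pos hQ1) hK
  have hqr : (0:ℝ) < q := by exact_mod_cast NeZero.pos q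
  have hσr : (σ:ℝ) ≤ Q := Nat.cast_le.2 hσ
  set D := Dl K f g with hD
  have hDb : ∀ x, ‖D x‖ ≤ 1 := Dl_bd K hKp f g hf hg
  have h1 : ∀ r : ZMod q, ∃ β : ℝ, ∑ s ∈ range L, ‖∑ t ∈ IZ L,
      (conj (D (zc M (r.val + q * t))) * D ((zc M (r.val + q * t)) + q * σ * (s - t0))) * ee (γ r * t)‖ ^ 2 ≤
      ‖∑ t ∈ IZ L, D (zc M (r.val + q * t)) * ee (β * t)‖ ^ 2 * (2 * Q * L) := by
    intro r
    obtain ⟨θ, hθ⟩ := PLex L (σ * L) cx.hL (fun t => conj (D (zc M (r.val + q * t))) * ee (γ r * t))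
      (fun u => D ((zc M (r.val + q * u)) - q * σ * t0))
    refine ⟨-(γ r + θ), ?_⟩
    have e1 : ∑ s ∈ range L, ‖∑ t ∈ IZ L,
      (conj (D (zc M (r.val + q * t))) * D ((zc M (r.val + q * t)) + q * σ * (s - t0))) * ee (γ r * t)‖ ^ 2 ≤
      ∑ w ∈ range (σ * L), ‖∑ t ∈ range L, conj (D (zc M (r.val + q * (t:ℤ)))) * ee (γ r * t) * D ((zc M (r.val + q * ((t + w : ℕ):ℤ))) - q * σ * t0)‖ ^ 2 := by
      have e2 : (range L).image (fun s => σ * s) ⊆ range (σ * L) := by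
        intro w hw
        obtain ⟨s, hs, rfl⟩ := mem_image.1 hw
        rw [mem_range] at hs ⊢
        exact Nat.mul_lt_mul_of_pos_left hs (by omega)
      refine le_trans (le_of_eq ?_) (sum_le_sum_of_subset_of_nonneg e2 fun _ _ _ => by positivity)
      rw [sum_image (fun a _ b _ h => Nat.eq_of_mul_eq_mul_left (by omega) h)]
      refine sum_congr rfl fun s _ => ?_
      rw [sum_Ico_range]
      congr 2
      refine sum_congr rfl fun t _ => ?_
      have a1 : (zc M (r.val + q * (t:ℤ))) + q * σ * (s - t0) = (zc M (r.val + q * ((t + σ * s : ℕ):ℤ))) - q * σ * t0 := by push_cast; ring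
      rw [a1, Int.cast_natCast]; ring
    have e3 : ‖∑ t ∈ range L, conj (D (zc M (r.val + q * (t:ℤ)))) * ee (γ r * t) * ee (θ * t)‖ =
        ‖∑ t ∈ IZ L, D (zc M (r.val + q * t)) * ee (-(γ r + θ) * t)‖ := by
      rw [sum_Ico_range, ← RCLike.norm_conj, map_sum]
      congr 1
      refine sum_congr rfl fun t _ => ?_
      rw [mul_assoc, ← ee_add, map_mul, Complex.conj_conj, ← ee_neg, Int.cast_natCast]
      congr 2; ring
    have e4 : ∑ u ∈ range (L + σ * L), ‖D ((zc M (r.val + q * (u:ℤ))) - q * σ * t0)‖ ^ 2 ≤ 2 * Q * L := by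
      refine (slc _ _ 1 fun u _ => pow_le_one₀ (norm_nonneg _) (hDb _)).trans ?_
      rw [card_range, nsmul_eq_mul, mul_one]; push_cast; nlinarith
    rw [e3] at hθ
    exact e1.trans (hθ.trans (mL e4 (by positivity)))
  choose β hβ using h1
  set m' : ZMod q → ℂ := fun r => ∑ t ∈ IZ L, D (zc M (r.val + q * t)) * ee (β r * t) with hm'
  have hm'L : ∀ r, ‖m' r‖ ≤ L := fun r =>
    (norm_sum_le _ _).trans ((slc _ _ 1 fun t _ => bd_mul (hDb _) (norm_ee _).le).trans (by simp))
  have h2 : (q:ℝ) * L ≤ (Q ^ 4 : ℕ) * ‖∑ r, phs (m' r) * m' r‖ := by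
    have e1 : ∑ r, phs (m' r) * m' r = ((∑ r, ‖m' r‖ : ℝ) : ℂ) := by
      rw [Complex.ofReal_sum]; exact sum_congr rfl fun r _ => phs_mul _
    rw [e1, Complex.norm_real, Real.norm_of_nonneg (by positivity)]
    have e2 : (q:ℝ) * L ^ 3 ≤ Q * ∑ r, (L * ‖m' r‖) * (2 * Q * L) := by
      refine H.trans (mL ?_ (by linarith))
      rw [sum_comm]
      refine sum_le_sum fun r _ => (hβ r).trans (mR ?_ (by positivity))
      rw [sq]; exact mR (hm'L r) (norm_nonneg _)
    rw [← sum_mul, ← mul_sum] at e2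
    have e3 : (L:ℝ) ^ 2 * (q * L) ≤ L ^ 2 * ((2 * Q ^ 2) * ∑ r, ‖m' r‖) := by
      calc (L:ℝ) ^ 2 * (q * L) = q * L ^ 3 := by ring
        _ ≤ _ := e2
        _ = _ := by ring
    refine (cL e3 (by positivity)).trans (mR ?_ (by positivity))
    push_cast; exact cpow hQ 1 (by norm_num) (by norm_num)
  obtain ⟨α, h3, -⟩ := hn (Q ^ 4) K M l q L (cx.mono (nsp (by norm_num) _)) (by rw [← pow_mul]; exact hKa _ (by omega)) f g hf hg
    (fun r => phs (m' r)) β (fun r => phs_bd _) h2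
  set X := ‖∑ n ∈ IZ (q * L), D (n : ZMod M) * ee (α * n)‖ with hX
  have h4 : (M:ℝ) ≤ (Q ^ m : ℕ) * X := by
    rw [← pow_mul] at h3
    push_cast at h3 ⊢
    calc (M:ℝ) ≤ 100 * (Q * (q * L)) := by rw [hM]; linarith
      _ ≤ 100 * (Q * ((Q:ℝ) ^ (4 * n) * X)) := by gcongr
      _ = (100 * (Q:ℝ) ^ (4 * n + 1)) * X := by ring
      _ ≤ _ := mR (cpow hQ 7 (by norm_num) (by omega)) (norm_nonneg _)
  have hKK : K ≤ K ^ 2 := nsp (by norm_num) _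
  obtain ⟨j, hj⟩ := Smooth (Q ^ m) M (q * L) (hQ2.trans (nsp (by omega) _)) (cx.hqL.trans (by have := cx.hM; omega))
    (by have := cx.hM; have := hKa m (by omega); omega) D hDb α (by push_cast at h4 hX ⊢; rw [← hX]; exact h4)
  refine ⟨j, ?_⟩
  rw [pow_mul, Nat.cast_pow]; exact hj

lemma PropA : ∃ n : ℕ, 1 ≤ n ∧ ∀ (Q K M : ℕ) [NeZero M] (_ : 2 ≤ Q) (_ : 100 * K ^ 2 = M) (_ : Q ^ n ≤ K)
    (f g h : ZMod M → ℂ) (_ : ∀ x, ‖f x‖ ≤ 1) (_ : ∀ x, ‖g x‖ ≤ 1) (_ : ∀ x, ‖h x‖ ≤ 1)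
    (_ : (M:ℝ) * K ≤ Q * ‖Lam K f g h‖),
    ∃ j : ZMod M, (M:ℝ) * K ≤ (Q ^ n : ℕ) * ‖Lam K f g (ch j)‖ := by
  obtain ⟨n2, hn2, A2⟩ := AStep2
  obtain ⟨n3, hn3, A3⟩ := AStep3
  refine ⟨260 * (n2 * n3), by nlinarith, ?_⟩
  intro Q K M _ hQ hM hK f g h hf hg hh H
  have hQ1 : 0 < Q := by omega
  have hQr : (2:ℝ) ≤ Q := by exact_mod_cast hQ
  have hnn : 1 ≤ n2 * n3 := Nat.mul_pos hn2 hn3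
  have hKa : ∀ a, a ≤ 260 * (n2 * n3) → Q ^ a ≤ K := fun a ha => (npR hQ1 ha).trans hK
  have hKp : 0 < K := lt_of_lt_of_le (Nat.pow_pos hQ1) hK
  have hKr : (0:ℝ) < K := by exact_mod_cast hKp
  have hMr : (0:ℝ) < M := by exact_mod_cast NeZero.pos M
  set D := Dl K f g with hD
  have hDb : ∀ x, ‖D x‖ ≤ 1 := Dl_bd K hKp f g hf hg
  have h1 : (M:ℝ) / Q ≤ ∑ x, ‖D x‖ := by
    rw [Lam_Dl K hKp, norm_mul, Complex.norm_natCast] at H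
    rw [div_le_iff₀ (by linarith)]
    have e : ‖∑ x, D x * h x‖ ≤ ∑ x, ‖D x‖ := (norm_sum_le _ _).trans (sum_le_sum fun x _ => by
      rw [norm_mul]; exact mul_le_of_le_one_right (norm_nonneg _) (hh x))
    have e2 : K * (M:ℝ) ≤ K * (Q * ‖∑ x, D x * h x‖) := by linarith
    have e3 := cL e2 hKr
    nlinarith
  have h2 := cs_card _ _ _ (M:ℝ) h1 (by positivity) (by rw [card_univ, ZMod.card])
  have h3 : (M:ℝ) * K ≤ (Q ^ 2 : ℕ) * ‖Lam K f g (fun x => conj (D x))‖ := by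
    have e1 : ∑ x, D x * conj (D x) = ((∑ x, ‖D x‖ ^ 2 : ℝ) : ℂ) := by
      rw [Complex.ofReal_sum]; refine sum_congr rfl fun x _ => ?_
      rw [Complex.mul_conj']; push_cast; rfl
    rw [Lam_Dl K hKp, ← hD, e1, norm_mul, Complex.norm_natCast, Complex.norm_real, Real.norm_of_nonneg (by positivity)]
    rw [div_pow, div_le_iff₀ (by positivity)] at h2
    have e3 : (M:ℝ) * M ≤ M * (Q ^ 2 * ∑ x, ‖D x‖ ^ 2) := by linarith
    have e4 := cL e3 hMr
    push_cast
    nlinarith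
  obtain ⟨l, q, L, σ, t0, hqz, cx, hσ1, hσQ, ht0, x0, θ, h4⟩ := U3 (Q ^ 2) K M (hQ.trans (nsp (by norm_num) _)) hM
    (by rw [← pow_mul]; exact hKa _ (by omega)) f g (fun x => conj (D x)) hf hg (fun x => bd_conj (hDb x)) h3
  rw [← pow_mul] at cx hσQ h4
  set f' : ZMod M → ℂ := fun x => f (x + x0) with hf'
  set g' : ZMod M → ℂ := fun x => g (x + x0) with hg'
  have hDs : ∀ x, Dl K f' g' x = D (x + x0) := fun x => (Dl_shift K f g x x0).symm
  obtain ⟨γ, h5⟩ := A2 (Q ^ (2 * 130)) K M l q L cx (by rw [← pow_mul]; exact hKa _ (by nlinarith)) f' g' (fun x => conj (Dl K f' g' x)) (fun _ => hf _) (fun _ => hg _)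
    (fun x => bd_conj (Dl_bd K hKp _ _ (fun _ => hf _) (fun _ => hg _) x)) (fun s => q * σ * (s - t0)) (fun s r => θ s r) (by
      refine h4.trans (le_of_eq ?_)
      congr 1
      refine sum_congr rfl fun s _ => sum_congr rfl fun r _ => ?_
      rw [sum_Ico_range]
      congr 2
      refine sum_congr rfl fun t _ => ?_
      simp only [hDs, Complex.conj_conj, Int.cast_natCast]
      have a1 : x0 + (r.val : ZMod M) + q * t = (zc M (r.val + q * t)) + x0 := by push_cast; ring
      have a2 : x0 + (r.val : ZMod M) + q * t + q * σ * (s - t0) = (zc M (r.val + q * t)) + q * σ * (s - t0) + x0 := by push_cast; ring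
      rw [a2, a1])
  obtain ⟨j, hj⟩ := A3 ((Q ^ (2 * 130)) ^ n2) K M l q L σ t0 (cx.mono (nsp (by omega) _)) (by rw [← pow_mul, ← pow_mul]; exact hKa _ (by nlinarith))
    hσ1 (hσQ.trans (nsp (by omega) _)) f' g' (fun _ => hf _) (fun _ => hg _) γ h5
  refine ⟨j, ?_⟩
  have e1 : ‖∑ x, Dl K f' g' x * ch j x‖ = ‖∑ x, D x * ch j x‖ := by
    rw [← shiftZ (fun x => D x * ch j x) x0]
    have : ∑ x, D (x + x0) * ch j (x + x0) = (∑ x, Dl K f' g' x * ch j x) * ch j x0 := by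
      rw [sum_mul]
      refine sum_congr rfl fun x _ => ?_
      rw [hDs, ch_add]; ring
    rw [this, norm_mul, norm_ch, mul_one]
  rw [e1] at hj
  rw [Lam_Dl K hKp, norm_mul, Complex.norm_natCast]
  have e2 : (((Q ^ (2 * 130)) ^ n2) ^ n3 : ℕ) = Q ^ (260 * (n2 * n3)) := by rw [← pow_mul, ← pow_mul]
  rw [e2] at hj
  calc (M:ℝ) * K ≤ _ * K := mR hj hKr.le
    _ = _ := by ring

noncomputable def Gp {M : ℕ} (K : ℕ) (g h : ZMod M → ℂ) : ZMod M → ℂ := fun x =>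
  (K:ℂ)⁻¹ * ∑ y ∈ IC K, g (x + (y : ZMod M)) * h (x + (y : ZMod M) ^ 2)

lemma Gp_bd {M : ℕ} (K : ℕ) (hK : 0 < K) (g h : ZMod M → ℂ) (hg : ∀ x, ‖g x‖ ≤ 1) (hh : ∀ x, ‖h x‖ ≤ 1) (x : ZMod M) :
    ‖Gp K g h x‖ ≤ 1 := by
  unfold Gp
  have hK' : (0:ℝ) < K := by exact_mod_cast hK
  rw [norm_mul, norm_inv, Complex.norm_natCast, inv_mul_le_iff₀ hK', mul_one]
  exact (norm_sum_le _ _).trans ((slc _ _ 1 fun y _ => bd_mul (hg _) (hh _)).trans (by simp))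

lemma Lam_Gp {M : ℕ} [NeZero M] (K : ℕ) (hK : 0 < K) (f g h : ZMod M → ℂ) :
    Lam K f g h = K * ∑ x, f x * Gp K g h x := by
  have hK' : (K:ℂ) ≠ 0 := by exact_mod_cast hK.ne'
  unfold Lam Gp
  rw [sum_comm, mul_sum]
  refine sum_congr rfl fun x _ => ?_
  rw [mul_left_comm, mul_inv_cancel_left₀ hK', mul_sum]
  exact sum_congr rfl fun y _ => by ring

lemma Gp_shift (K M v I : ℕ) [NeZero M] (hK : 0 < K) (g : ZMod M → ℂ) (hg : ∀ x, ‖g x‖ ≤ 1) (j : ZMod M) (R : ℝ) (hv : (v:ℝ) ≤ R)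
    (hn : nd (v * (j.val / M : ℝ)) ≤ R / K ^ 2) (hvI : v * I ≤ K) (w : ZMod M) (i : ℤ) (hi : i ∈ IC I) :
    ‖Gp K g (ch j) (w - (zc M (v * i))) - Gp K g (ch j) w‖ ≤ 23 * I * R / K := by
  rw [mem_Icc] at hi
  have hK' : (0:ℝ) < K := by exact_mod_cast hK
  have hi1 : (1:ℝ) ≤ i := by exact_mod_cast hi.1
  have hiI : (i:ℝ) ≤ I := by exact_mod_cast hi.2
  have hR : 0 ≤ R := le_trans (by positivity) hv
  have hvIr : (v:ℝ) * I ≤ K := by exact_mod_cast hvI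
  have hvi : (v:ℝ) * i ≤ K := le_trans (mL hiI (by positivity)) hvIr
  have hvi0 : 0 ≤ (v:ℝ) * i := by positivity
  unfold Gp
  rw [← mul_sub, norm_mul, norm_inv, Complex.norm_natCast, inv_mul_le_iff₀ hK', mul_div_cancel₀ _ hK'.ne']
  have h1 := shift_sum (fun y : ℤ => g (w - (zc M (v * i)) + (y : ZMod M)) * ch j (w - (zc M (v * i)) + (y : ZMod M) ^ 2))
    (fun y => bd_mul (hg _) (norm_ch _ _).le) K (v * i)
  have h2 : ‖∑ y ∈ IC K, g (w - (zc M (v * i)) + (zc M (y + v * i))) * ch j (w - (zc M (v * i)) + (zc M (y + v * i)) ^ 2)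
      - ∑ y ∈ IC K, g (w + (y : ZMod M)) * ch j (w + (y : ZMod M) ^ 2)‖ ≤ 21 * I * R := by
    rw [← sum_sub_distrib]
    refine (norm_sum_le _ _).trans ((slc _ _ (21 * I * R / K) fun y hy => ?_).trans (le_of_eq ?_))
    · rw [mem_Icc] at hy
      have a1 : w - (zc M (v * i)) + (zc M (y + v * i)) = w + (y : ZMod M) := by push_cast; ring
      have a2 : w - (zc M (v * i)) + (zc M (y + v * i)) ^ 2 = w + (y : ZMod M) ^ 2 + (zc M (v * i * (2 * y + v * i - 1))) := by push_cast; ring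
      rw [a1, a2, ch_add, ← mul_assoc, ← mul_sub_one, norm_mul]
      refine (mul_le_of_le_one_left (norm_nonneg _) (bd_mul (hg _) (norm_ch _ _).le)).trans ?_
      rw [ch_int]
      have b1 := ee_sub_le ((j.val / M : ℝ) * ((v * i * (2 * y + v * i - 1) : ℤ) : ℝ)) 0
      rw [ee_zero, sub_zero] at b1
      refine b1.trans ?_
      have b2 := nd_int_mul (i * (2 * y + v * i - 1)) (v * (j.val / M : ℝ))
      have b3 : ((i * (2 * y + v * i - 1) : ℤ) : ℝ) * (v * (j.val / M : ℝ)) = (j.val / M : ℝ) * ((v * i * (2 * y + v * i - 1) : ℤ) : ℝ) := by push_cast; ring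
      rw [b3] at b2
      have hy1 : (1:ℝ) ≤ y := by exact_mod_cast hy.1
      have hy2 : (y:ℝ) ≤ K := by exact_mod_cast hy.2
      have b4 : |((i * (2 * y + v * i - 1) : ℤ) : ℝ)| ≤ I * (3 * K) := by
        push_cast
        rw [abs_of_nonneg (mul_nonneg (by linarith) (by linarith))]
        exact mul_le_mul hiI (by linarith) (by linarith) (by positivity)
      calc 7 * nd _ ≤ 7 * ((I * (3 * K)) * (R / K ^ 2)) := by
            refine mL (b2.trans (mul_le_mul b4 hn (nd_nonneg _) (by positivity))) (by norm_num)
        _ = 21 * I * R / K := by field_simp; ring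
    · rw [Int.card_Icc, nsmul_eq_mul]; simp; field_simp
  have h3 : 2 * |((v * i : ℤ) : ℝ)| ≤ 2 * (I * R) := by
    push_cast; rw [abs_of_nonneg hvi0, mul_comm (v:ℝ)]
    exact mL (mul_le_mul hiI hv (by positivity) (by positivity)) (by norm_num)
  refine (norm_sub_le_norm_sub_add_norm_sub _ _ _).trans (le_trans (add_le_add h1 h2) ?_)
  linarith

lemma Step4 : ∃ n : ℕ, 1 ≤ n ∧ ∀ (Q K M : ℕ) [NeZero M] (_ : 2 ≤ Q) (_ : 100 * K ^ 2 = M) (_ : Q ^ n ≤ K)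
    (f g h : ZMod M → ℂ) (_ : ∀ x, ‖f x‖ ≤ 1) (_ : ∀ x, ‖g x‖ ≤ 1) (_ : ∀ x, ‖h x‖ ≤ 1)
    (_ : (M:ℝ) * K ≤ Q * ‖Lam K f g h‖),
    ∃ (v I : ℕ) (y0 : ℤ), 1 ≤ v ∧ v ≤ Q ^ n ∧ 1 ≤ I ∧ I ≤ K ∧ K ≤ Q ^ n * I ∧
      (M:ℝ) * I ^ 2 ≤ (Q ^ n : ℕ) * ∑ x, ‖∑ i ∈ IC I, h (x + (zc M ((y0 + v * i) ^ 2 - (y0 + v * i))))‖ ^ 2 := by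
  obtain ⟨n, hn, PA⟩ := PropA
  obtain ⟨m, hm⟩ : ∃ m, m = 2 * n * 201 := ⟨_, rfl⟩
  refine ⟨m * 11, by omega, ?_⟩
  intro Q K M _ hQ hM hK f g h hf hg hh H
  have hQ1 : 0 < Q := by omega
  have hQr : (2:ℝ) ≤ Q := by exact_mod_cast hQ
  have hKa : ∀ a, a ≤ m * 11 → Q ^ a ≤ K := fun a ha => (npR hQ1 ha).trans hK
  have hKp : 0 < K := lt_of_lt_of_le (Nat.pow_pos hQ1) hK
  have hKr : (0:ℝ) < K := by exact_mod_cast hKp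
  have hMr : (0:ℝ) < M := by exact_mod_cast NeZero.pos M
  set D := Gp K g h with hD
  have hDb : ∀ x, ‖D x‖ ≤ 1 := Gp_bd K hKp g h hg hh
  have h1 : (M:ℝ) / Q ≤ ∑ x, ‖D x‖ := by
    rw [Lam_Gp K hKp, norm_mul, Complex.norm_natCast] at H
    rw [div_le_iff₀ (by linarith)]
    have e : ‖∑ x, f x * D x‖ ≤ ∑ x, ‖D x‖ := (norm_sum_le _ _).trans (sum_le_sum fun x _ => by
      rw [norm_mul]; exact mul_le_of_le_one_left (norm_nonneg _) (hf x))
    have e2 : K * (M:ℝ) ≤ K * (Q * ‖∑ x, f x * D x‖) := by linarith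
    have e3 := cL e2 hKr
    nlinarith
  have h2 := cs_card _ _ _ (M:ℝ) h1 (by positivity) (by rw [card_univ, ZMod.card])
  have h3 : (M:ℝ) * K ≤ (Q ^ 2 : ℕ) * ‖Lam K (fun x => conj (D x)) g h‖ := by
    have e1 : ∑ x, conj (D x) * D x = ((∑ x, ‖D x‖ ^ 2 : ℝ) : ℂ) := by
      rw [Complex.ofReal_sum]; refine sum_congr rfl fun x _ => ?_
      rw [mul_comm, Complex.mul_conj']; push_cast; rfl
    rw [Lam_Gp K hKp, ← hD, e1, norm_mul, Complex.norm_natCast, Complex.norm_real, Real.norm_of_nonneg (by positivity)]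
    rw [div_pow, div_le_iff₀ (by positivity)] at h2
    have e3 : (M:ℝ) * M ≤ M * (Q ^ 2 * ∑ x, ‖D x‖ ^ 2) := by linarith
    have e4 := cL e3 hMr
    push_cast
    nlinarith
  obtain ⟨j, hj⟩ := PA (Q ^ 2) K M (hQ.trans (nsp (by norm_num) _)) hM (by rw [← pow_mul]; exact hKa _ (by omega))
    (fun x => conj (D x)) g h (fun x => bd_conj (hDb x)) hg hh h3
  rw [← pow_mul] at hj
  obtain ⟨v, hv1, hv2, hv3⟩ := LemM (Q ^ (2 * n)) K M (hQ.trans (nsp (by omega) _)) (by rw [← pow_mul]; exact hKa _ (by omega)) _ g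
    (fun x => bd_conj (hDb x)) hg j hj
  rw [Nat.cast_pow, ← pow_mul, ← hm, ← Nat.cast_pow] at hv3
  rw [← pow_mul, ← hm] at hv2
  set Φ := Gp K g (ch j) with hΦ
  have hΦb : ∀ x, ‖Φ x‖ ≤ 1 := Gp_bd K hKp g _ hg (fun x => (norm_ch _ _).le)
  obtain ⟨R, hR⟩ : ∃ R, R = Q ^ m := ⟨_, rfl⟩
  have hR2 : 2 ≤ R := by rw [hR]; exact hQ.trans (nsp (by omega) _)
  have hRr : (2:ℝ) ≤ R := by exact_mod_cast hR2
  have h4 : (M:ℝ) * K ≤ R * ‖Lam K (fun x => conj (Φ x)) g h‖ := by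
    have e : ‖Lam K (fun x => conj (Φ x)) g h‖ = ‖Lam K (fun x => conj (D x)) g (ch j)‖ := by
      rw [Lam_Gp K hKp, Lam_Gp K hKp, norm_mul, norm_mul, ← RCLike.norm_conj (∑ x, _), map_sum]
      congr 2
      refine sum_congr rfl fun x _ => ?_
      rw [map_mul, Complex.conj_conj, mul_comm]
    rw [e]
    refine hj.trans (mR ?_ (norm_nonneg _))
    rw [hR]; exact Nat.cast_le.2 (npR hQ1 (by omega))
  rw [← hR] at hv2 hv3
  rw [pow_mul, ← hR] at hK
  obtain ⟨I, hI1, hI2, -, hI3⟩ := floorL R K 10 hR2 ((npR (by omega) (by norm_num)).trans hK)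
  have hvI : v * I * R ^ 9 ≤ K := by
    calc v * I * R ^ 9 ≤ R * I * R ^ 9 := nmR _ (nmR _ hv2)
      _ = R ^ 10 * I := by ring
      _ ≤ K := hI2
  have hR9 : 1 ≤ R ^ 9 := Nat.pow_pos (by omega)
  have hIr : (0:ℝ) < I := by exact_mod_cast hI1
  have h5 := vdc (X := ZMod M) K R (v * I) ({()} : Finset Unit) (IC I) (fun i => v * i) (by
      intro i hi
      rw [mem_Icc] at hi
      have : (0:ℝ) ≤ i := by exact_mod_cast (by omega : (0:ℤ) ≤ i)
      have hi2 : (i:ℝ) ≤ I := by exact_mod_cast hi.2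
      push_cast
      rw [abs_of_nonneg (by positivity)]; exact mL hi2 (by positivity)) (fun _ x => g x)
    (fun _ x y => conj (Φ (x - (y : ZMod M))) * h (x + (zc M (y ^ 2 - y))))
    (fun _ x => hg x) (fun _ x y => bd_mul (bd_conj (hΦb _)) (hh _))
    (by linarith) (by
      have : 4 * (v * I) * R ≤ K := by
        refine le_trans ?_ hvI
        have a : 4 * R ≤ R ^ 9 := by
          calc 4 * R ≤ 2 ^ 8 * R := by omega
            _ ≤ R ^ 8 * R := nmR _ (npL hR2 8)
            _ = R ^ 9 := by ring
        calc 4 * (v * I) * R = v * I * (4 * R) := by ring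
          _ ≤ _ := nmL _ a
      exact_mod_cast this) (by
      simp only [card_singleton, sum_singleton, ZMod.card]
      rw [Nat.cast_one, mul_one]
      refine h4.trans (le_of_eq ?_)
      congr 2
      unfold Lam
      refine sum_congr rfl fun y _ => ?_
      rw [← shiftZ (fun x => g x * (conj (Φ (x - (y : ZMod M))) * h (x + (zc M (y ^ 2 - y))))) (y : ZMod M)]
      refine sum_congr rfl fun x _ => ?_
      have a1 : x + (y : ZMod M) - (y : ZMod M) = x := by ring
      have a2 : x + (y : ZMod M) + (zc M (y ^ 2 - y)) = x + (y : ZMod M) ^ 2 := by push_cast; ring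
      rw [a1, a2]; ring)
  simp only [card_singleton, sum_singleton, ZMod.card, Int.card_Icc, Nat.cast_one, mul_one, add_sub_cancel_right, Int.toNat_natCast] at h5
  set η : ℝ := 23 * I * R / K with hη
  have hη0 : 0 ≤ η := by positivity
  have hηs : 16 * (R:ℝ) ^ 2 * η ^ 2 ≤ 1 := by
    have e1 : η ≤ 23 / (R:ℝ) ^ 9 := by
      rw [hη, div_le_div_iff₀ hKr (by positivity)]
      have : (R:ℝ) ^ 10 * I ≤ K := by exact_mod_cast hI2
      calc 23 * I * R * (R:ℝ) ^ 9 = 23 * ((R:ℝ) ^ 10 * I) := by ring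
        _ ≤ _ := by linarith
    have e2 : (2:ℝ) ^ 16 ≤ (R:ℝ) ^ 16 := pL (by norm_num) hRr 16
    calc 16 * (R:ℝ) ^ 2 * η ^ 2 ≤ 16 * (R:ℝ) ^ 2 * (23 / (R:ℝ) ^ 9) ^ 2 := by gcongr
      _ = 8464 / (R:ℝ) ^ 16 := by field_simp; norm_num
      _ ≤ 1 := by rw [div_le_one (by positivity)]; linarith
  have h6 : ∀ (y : ℤ) (x : ZMod M), ‖∑ i ∈ IC I, conj (Φ (x - (zc M (y + v * i)))) * h (x + (zc M ((y + v * i) ^ 2 - (y + v * i))))‖ ^ 2 ≤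
      2 * ‖∑ i ∈ IC I, h (x + (zc M ((y + v * i) ^ 2 - (y + v * i))))‖ ^ 2 + 2 * (I * η) ^ 2 := by
    intro y x
    set S := ∑ i ∈ IC I, h (x + (zc M ((y + v * i) ^ 2 - (y + v * i)))) with hS
    have e1 : ‖∑ i ∈ IC I, conj (Φ (x - (zc M (y + v * i)))) * h (x + (zc M ((y + v * i) ^ 2 - (y + v * i)))) -
        conj (Φ (x - (y : ZMod M))) * S‖ ≤ I * η := by
      rw [hS, mul_sum, ← sum_sub_distrib]
      refine (norm_sum_le _ _).trans ((slc _ _ η fun i hi => ?_).trans (le_of_eq ?_))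
      · rw [← sub_mul, norm_mul, ← map_sub, RCLike.norm_conj]
        refine (mul_le_of_le_one_right (norm_nonneg _) (hh _)).trans ?_
        have := Gp_shift K M v I hKp g hg j R (by exact_mod_cast hv2) hv3 ((Nat.le_mul_of_pos_right _ hR9).trans hvI) (x - (y : ZMod M)) i hi
        have a1 : x - (zc M (y + v * i)) = x - (y : ZMod M) - (zc M (v * i)) := by push_cast; ring
        rw [a1]; exact this
      · rw [Int.card_Icc, nsmul_eq_mul]; simp
    have e2 : ‖conj (Φ (x - (y : ZMod M))) * S‖ ≤ ‖S‖ := by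
      rw [norm_mul]; exact mul_le_of_le_one_left (norm_nonneg _) (bd_conj (hΦb _))
    have e3 := norm_sub_norm_le (∑ i ∈ IC I, conj (Φ (x - (zc M (y + v * i)))) * h (x + (zc M ((y + v * i) ^ 2 - (y + v * i))))) (conj (Φ (x - (y : ZMod M))) * S)
    have e4 := (sub_le_iff_le_add.1 (e3.trans e1)).trans (add_le_add_right e2 _)
    have e5 := pL (norm_nonneg _) e4 2
    nlinarith [sq_nonneg (I * η - ‖S‖)]
  set Y : ℤ → ℝ := fun y => ∑ x, ‖∑ i ∈ IC I, h (x + (zc M ((y + v * i) ^ 2 - (y + v * i))))‖ ^ 2 with hY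
  obtain ⟨y0, -, hy0⟩ := pigs (IC K) (nonempty_Icc.2 (by omega)) Y
  refine ⟨v, I, y0, hv1, ?_, hI1, ?_, ?_, ?_⟩
  · refine hv2.trans ?_; rw [pow_mul, ← hR]; exact nsp (by norm_num) _
  · exact (Nat.le_mul_of_pos_left _ (Nat.pow_pos (by omega))).trans hI2
  · rw [pow_mul, ← hR]; exact hI3
  · have h7 : (M:ℝ) * K * I ^ 2 ≤ 4 * R ^ 2 * (2 * ∑ y ∈ IC K, Y y + K * (M * (2 * (I * η) ^ 2))) := by
      refine h5.trans (mL ?_ (by positivity))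
      refine (sum_le_sum fun y _ => sum_le_sum fun x _ => h6 y x).trans (le_of_eq ?_)
      simp only [sum_add_distrib, ← mul_sum, sum_const, card_univ, ZMod.card, Int.card_Icc, nsmul_eq_mul]
      simp [hY]; ring
    rw [Int.card_Icc, add_sub_cancel_right, Int.toNat_natCast] at hy0
    have e1 : 4 * (R:ℝ) ^ 2 * (K * (M * (2 * (I * η) ^ 2))) ≤ M * K * I ^ 2 / 2 := by
      calc 4 * (R:ℝ) ^ 2 * (K * (M * (2 * (I * η) ^ 2))) = (M * K * I ^ 2 / 2) * (16 * (R:ℝ) ^ 2 * η ^ 2) := by ring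
        _ ≤ _ := mul_le_of_le_one_right (by positivity) hηs
    have e2 : 4 * (R:ℝ) ^ 2 * (2 * ∑ y ∈ IC K, Y y) ≤ 4 * (R:ℝ) ^ 2 * (2 * (K * Y y0)) := by gcongr
    have e3 : (K:ℝ) * (M * I ^ 2) ≤ K * (16 * R ^ 2 * Y y0) := by nlinarith
    refine (cL e3 hKr).trans ?_
    have hY0 : 0 ≤ Y y0 := by positivity
    refine mR ?_ hY0
    rw [pow_mul, ← hR, Nat.cast_pow]; exact cpow hRr 4 (by norm_num) (by norm_num)

lemma WeylS (Q K M v : ℕ) [NeZero M] (hQ : 2 ≤ Q) (hK : Q ^ 200 ≤ K) (hv : 1 ≤ v) (j : ZMod M) (y0 : ℤ)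
    (H : (K:ℝ) ≤ Q * ‖∑ i ∈ IC K, ch j (zc M ((y0 + v * i) ^ 2 - (y0 + v * i)))‖) :
    ∃ w : ℕ, 1 ≤ w ∧ w ≤ 2 * v ^ 2 * Q ^ 200 ∧ nd (w * (j.val / M : ℝ)) ≤ Q ^ 200 / K ^ 2 := by
  obtain ⟨A, hA1, hAK, hKA, hAQ⟩ := Aexists K Q hQ hK
  have hQr : (2:ℝ) ≤ Q := by exact_mod_cast hQ
  have h1 := vdc_pair (X := Unit) K Q A ({()} : Finset Unit) (range A) (fun i => (i:ℤ)) (by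
      intro i hi
      rw [mem_range] at hi
      push_cast
      rw [abs_of_nonneg (by positivity)]; exact_mod_cast hi.le) (fun _ x => 1)
    (fun _ x y => ch j (zc M ((y0 + v * y) ^ 2 - (y0 + v * y))))
    (fun _ x => by simp) (fun _ x y => (norm_ch j _).le)
    (by linarith) (by exact_mod_cast hAQ) (by
      simp only [card_singleton, sum_singleton, Fintype.card_unit, univ_unique, one_mul, Nat.cast_one, mul_one]
      exact H)
  set φ : ℝ := (2 * v ^ 2 : ℕ) * (j.val / M : ℝ) with hφ
  set l : ℕ → ℕ → ℝ := fun a a' => (j.val / M : ℝ) * (v * (a - a') * (2 * y0 + v * (a + a') - 1)) with hl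
  set b : ℕ → ℕ → ℝ := fun a a' => ‖∑ y ∈ Ico (1:ℤ) (K + 1), ee (-(φ * (a' - a)) * y + l a a')‖ with hb
  have hIc : IC K = Ico (1:ℤ) (K + 1) := by ext; simp [Int.lt_add_one_iff]
  have h2 : ∀ (a a' : ℕ) (y : ℤ), ch j (zc M ((y0 + v * (y + a)) ^ 2 - (y0 + v * (y + a)))) *
      conj (ch j (zc M ((y0 + v * (y + a')) ^ 2 - (y0 + v * (y + a'))))) = ee (-(φ * (a' - a)) * y + l a a') := by
    intro a a' y
    rw [← ch_neg, ← ch_add, ← Int.cast_neg, ← Int.cast_add, ch_int]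
    congr 1; rw [hφ, hl]; push_cast; ring
  simp only [card_product, card_singleton, card_range, sum_product, sum_singleton, Fintype.card_unit, univ_unique, h2] at h1
  have h3 : (K:ℝ) * A ^ 2 ≤ (Q ^ 4 : ℕ) * ∑ a ∈ range A, ∑ a' ∈ range A, b a a' := by
    rw [hIc] at h1
    push_cast at h1 ⊢
    calc (K:ℝ) * A ^ 2 = 1 * K * (1 * (A * A)) := by ring
      _ ≤ _ := h1
      _ ≤ _ := mR (cpow hQr 2 (by norm_num) (by norm_num)) (by positivity)
  obtain ⟨w, hv1, hv2, hv3⟩ := AL2 K A (Q ^ 4) (hQ.trans (nsp (by norm_num) _)) (by rw [← pow_mul]; exact hK) hKA hAK φ b (by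
      intro a a'
      refine (norm_sum_le _ _).trans ((slc _ _ 1 fun x _ => (norm_ee _).le).trans ?_)
      simp) (by
      intro a a'
      have := geo_Ico (-(φ * (a' - a))) (l a a') 1 (K + 1)
      rw [nd_neg] at this; exact this) h3
  rw [← pow_mul] at hv2
  refine ⟨2 * v ^ 2 * w, Nat.mul_pos (by positivity) hv1, nmL _ hv2, ?_⟩
  have e : ((2 * v ^ 2 * w : ℕ) : ℝ) * (j.val / M : ℝ) = w * φ := by rw [hφ]; push_cast; ring
  rw [e]
  refine hv3.trans (le_of_eq ?_)
  rw [Nat.cast_pow, ← pow_mul]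

lemma count_maj (M K R : ℕ) [NeZero M] (hM : 100 * K ^ 2 = M) (hK : 0 < K) (hR : 2 ≤ R) (S : Finset (ZMod M))
    (hS : ∀ j ∈ S, ∃ w : ℕ, 1 ≤ w ∧ w ≤ R ∧ nd (w * (j.val / M : ℝ)) ≤ R / K ^ 2) : (S.card : ℝ) ≤ R ^ 13 := by
  have hMr : (0:ℝ) < M := by exact_mod_cast NeZero.pos M
  have hKr : (0:ℝ) < K := by exact_mod_cast hK
  have hRr : (2:ℝ) ≤ R := by exact_mod_cast hR
  have hM' : (100:ℝ) * K ^ 2 = M := by exact_mod_cast hM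
  have hS' : ∀ j : ZMod M, ∃ w : ℕ, j ∈ S → 1 ≤ w ∧ w ≤ R ∧ nd (w * (j.val / M : ℝ)) ≤ R / K ^ 2 := by
    intro j
    by_cases h : j ∈ S
    · obtain ⟨w, hw⟩ := hS j h; exact ⟨w, fun _ => hw⟩
    · exact ⟨0, fun h' => absurd h' h⟩
  choose w hw using hS'
  set u : ZMod M → ℤ := fun j => round ((w j : ℝ) * (j.val / M : ℝ)) with hu
  set e : ZMod M → ℤ := fun j => w j * j.val - M * u j with he
  have h1 : S.card ≤ (range (R + 1) ×ˢ (Icc (0:ℤ) (R + 1) ×ˢ Icc (-(100 * R):ℤ) (100 * R))).card := by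
    refine card_le_card_of_injOn (fun j => (w j, u j, e j)) ?_ ?_
    · intro j hj
      obtain ⟨w1, w2, w3⟩ := hw j hj
      have hjM : (j.val : ℝ) / M ≤ 1 := by rw [div_le_one hMr]; exact_mod_cast (ZMod.val_lt j).le
      have hj0 : 0 ≤ (j.val : ℝ) / M := by positivity
      have w2r : (w j : ℝ) ≤ R := by exact_mod_cast w2
      have a1 : (w j : ℝ) * (j.val / M : ℝ) ≤ R := by nlinarith
      have a0 : 0 ≤ (w j : ℝ) * (j.val / M : ℝ) := by positivity
      have hr := abs_le.1 (abs_sub_round ((w j : ℝ) * (j.val / M : ℝ)))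
      have hu0 : (0:ℤ) ≤ u j := by
        have : (-1:ℝ) < u j := by rw [hu]; linarith [hr.1, hr.2]
        have : (-1:ℤ) < u j := by exact_mod_cast this
        omega
      have hu1 : u j ≤ R + 1 := by
        have : (u j : ℝ) ≤ R + 1 := by rw [hu]; linarith [hr.1, hr.2]
        exact_mod_cast this
      have he1 : |(e j : ℝ)| ≤ 100 * R := by
        have : (e j : ℝ) = M * ((w j : ℝ) * (j.val / M : ℝ) - u j) := by rw [he]; push_cast; field_simp
        rw [this, abs_mul, abs_of_pos hMr]
        have w3' : |(w j : ℝ) * (j.val / M : ℝ) - u j| ≤ R / K ^ 2 := w3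
        calc (M:ℝ) * _ ≤ M * (R / K ^ 2) := mL w3' hMr.le
          _ = 100 * R := by rw [← hM']; field_simp
      have he2 : |e j| ≤ 100 * R := by exact_mod_cast he1
      rw [abs_le] at he2
      simp only [coe_product, Set.mem_prod, mem_coe, mem_range, mem_Icc]
      omega
    · intro j hj j' hj' hE
      simp only [Prod.mk.injEq] at hE
      obtain ⟨w1, -, -⟩ := hw j hj
      have a1 : (w j : ℤ) * j.val = w j' * j'.val := by
        have b1 : (w j : ℤ) * j.val = e j + M * u j := by simp [he]
        have b2 : (w j' : ℤ) * j'.val = e j' + M * u j' := by simp [he]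
        rw [b1, b2, hE.2.1, hE.2.2]
      rw [← hE.1] at a1
      have a2 := mul_left_cancel₀ (by positivity : (w j : ℤ) ≠ 0) a1
      exact ZMod.val_injective M (by exact_mod_cast a2)
  rw [card_product, card_product, card_range, Int.card_Icc, Int.card_Icc] at h1
  have h2 : S.card ≤ (R + 1) * ((R + 2) * (200 * R + 1)) := by
    refine h1.trans (le_of_eq ?_)
    congr 2
    omega
  have h3 : (S.card : ℝ) ≤ (R + 1) * ((R + 2) * (200 * R + 1)) := by exact_mod_cast h2
  refine h3.trans ?_
  calc ((R:ℝ) + 1) * ((R + 2) * (200 * R + 1)) ≤ (2 * R) * ((2 * R) * (201 * R)) := by gcongr <;> linarith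
    _ = 804 * (R:ℝ) ^ 3 := by ring
    _ ≤ _ := cpow hRr 10 (by norm_num) (by norm_num)

lemma Step5 : ∃ n : ℕ, 1 ≤ n ∧ ∀ (Q K M : ℕ) [NeZero M] (_ : 2 ≤ Q) (_ : 100 * K ^ 2 = M) (_ : Q ^ n ≤ K)
    (f g h : ZMod M → ℂ) (_ : ∀ x, ‖f x‖ ≤ 1) (_ : ∀ x, ‖g x‖ ≤ 1) (_ : ∀ x, ‖h x‖ ≤ 1)
    (_ : (M:ℝ) * K ≤ Q * ‖Lam K f g h‖),
    ∃ (j : ZMod M) (w : ℕ), 1 ≤ w ∧ w ≤ Q ^ n ∧ nd (w * (j.val / M : ℝ)) ≤ (Q ^ n : ℕ) / K ^ 2 ∧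
      (M:ℝ) ≤ (Q ^ n : ℕ) * ‖∑ x, h x * ch j x‖ := by
  obtain ⟨n, hn, S4⟩ := Step4
  refine ⟨n * 10000, by omega, ?_⟩
  intro Q K M _ hQ hM hK f g h hf hg hh H
  have hQ1 : 0 < Q := by omega
  have hKp : 0 < K := lt_of_lt_of_le (Nat.pow_pos hQ1) hK
  have hKr : (0:ℝ) < K := by exact_mod_cast hKp
  have hMr : (0:ℝ) < M := by exact_mod_cast NeZero.pos M
  obtain ⟨v, I, y0, hv1, hv2, hI1, hI2, hI3, h1⟩ := S4 Q K M hQ hM ((npR hQ1 (by omega)).trans hK) f g h hf hg hh H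
  obtain ⟨R, hR⟩ : ∃ R, R = Q ^ n := ⟨_, rfl⟩
  rw [← hR] at hv2 hI3 h1
  rw [pow_mul, ← hR] at hK ⊢
  have hR2 : 2 ≤ R := by rw [hR]; exact hQ.trans (nsp (by omega) _)
  have hRr : (2:ℝ) ≤ R := by exact_mod_cast hR2
  have hIr : (0:ℝ) < I := by exact_mod_cast hI1
  have hI3r : (K:ℝ) ≤ R * I := by exact_mod_cast hI3
  set s : ZMod M → ℂ := fun j => ∑ i ∈ IC I, ch j (zc M ((y0 + v * i) ^ 2 - (y0 + v * i))) with hs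
  set F : ZMod M → ℂ := fun j => ∑ x, h x * ch j x with hF
  have h2 : ∀ j, ‖∑ x, (∑ i ∈ IC I, h (x + (zc M ((y0 + v * i) ^ 2 - (y0 + v * i))))) * ch j x‖ = ‖s j‖ * ‖F j‖ := by
    intro j
    rw [← RCLike.norm_conj (s j), ← norm_mul]
    congr 1
    rw [hs, map_sum, sum_mul]
    simp only [sum_mul]
    rw [sum_comm]
    refine sum_congr rfl fun i _ => ?_
    simp only [hF]; rw [← shiftZ (fun x => h x * ch j x) (zc M ((y0 + v * i) ^ 2 - (y0 + v * i))), mul_sum]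
    refine sum_congr rfl fun x _ => ?_
    rw [ch_add]
    have := Complex.mul_conj' (ch j (zc M ((y0 + v * i) ^ 2 - (y0 + v * i))))
    rw [norm_ch, Complex.ofReal_one] at this
    linear_combination (-(h (x + (zc M ((y0 + v * i) ^ 2 - (y0 + v * i)))) * ch j x)) * this
  have h3 := parseval (fun x => ∑ i ∈ IC I, h (x + (zc M ((y0 + v * i) ^ 2 - (y0 + v * i)))))
  simp only [h2, mul_pow] at h3
  have h4 : (M:ℝ) ^ 2 * I ^ 2 ≤ R * ∑ j, ‖s j‖ ^ 2 * ‖F j‖ ^ 2 := by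
    rw [h3]
    calc (M:ℝ) ^ 2 * I ^ 2 = (M:ℝ) * (M * I ^ 2) := by ring
      _ ≤ (M:ℝ) * _ := mL h1 hMr.le
      _ = _ := by ring
  have h5 : ∑ j, ‖F j‖ ^ 2 ≤ (M:ℝ) ^ 2 := by
    rw [hF, parseval, sq]
    refine mL ((slc _ _ 1 fun x _ => pow_le_one₀ (norm_nonneg _) (hh x)).trans ?_) hMr.le
    simp [ZMod.card]
  set S := univ.filter (fun j : ZMod M => (I:ℝ) ≤ R * ‖s j‖) with hS
  have hsI : ∀ j, ‖s j‖ ≤ I := fun j =>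
    (norm_sum_le _ _).trans ((slc _ _ 1 fun t _ => (norm_ch _ _).le).trans (by simp))
  have h6 : ∑ j, ‖s j‖ ^ 2 * ‖F j‖ ^ 2 ≤ I ^ 2 * ∑ j ∈ S, ‖F j‖ ^ 2 + (I ^ 2 / R ^ 2) * (M:ℝ) ^ 2 := by
    rw [← sum_filter_add_sum_filter_not univ (fun j : ZMod M => (I:ℝ) ≤ R * ‖s j‖), ← hS]
    refine add_le_add ?_ ?_
    · rw [mul_sum]
      exact sum_le_sum fun j _ => mR (pL (norm_nonneg _) (hsI j) 2) (by positivity)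
    · refine le_trans (b := ∑ j, (I ^ 2 / R ^ 2 : ℝ) * ‖F j‖ ^ 2) ?_ ?_
      · refine (sum_le_sum fun j hj => ?_).trans (sum_le_sum_of_subset_of_nonneg (filter_subset _ _) fun _ _ _ => by positivity)
        refine mR ?_ (by positivity)
        rw [mem_filter, not_le] at hj
        rw [← div_pow]
        exact pL (norm_nonneg _) (by rw [le_div_iff₀ (by linarith)]; linarith [hj.2]) 2
      · rw [← mul_sum]; exact mL h5 (by positivity)
  have h7 : (M:ℝ) ^ 2 ≤ 2 * R * ∑ j ∈ S, ‖F j‖ ^ 2 := by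
    have e1 : (R:ℝ) * ((I ^ 2 / R ^ 2) * (M:ℝ) ^ 2) ≤ (M:ℝ) ^ 2 * I ^ 2 / 2 := by
      rw [show (R:ℝ) * ((I ^ 2 / R ^ 2) * (M:ℝ) ^ 2) = (M:ℝ) ^ 2 * I ^ 2 / R by field_simp]
      exact div_le_div_of_nonneg_left (by positivity) (by norm_num) hRr
    have e2 := mL h6 (by linarith : (0:ℝ) ≤ R)
    have e3 : (I:ℝ) ^ 2 * (M:ℝ) ^ 2 ≤ I ^ 2 * (2 * R * ∑ j ∈ S, ‖F j‖ ^ 2) := by nlinarith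
    exact cL e3 (by positivity)
  have hI200 : R ^ 200 ≤ I := by
    have : R * R ^ 200 ≤ R * I := by
      refine le_trans ?_ (hK.trans hI3)
      rw [← pow_succ']; exact npR (by omega) (by norm_num)
    exact cL this (by omega)
  obtain ⟨W, hW⟩ : ∃ W, W = R ^ 203 := ⟨_, rfl⟩
  have hmaj : ∀ j ∈ S, ∃ w : ℕ, 1 ≤ w ∧ w ≤ W ∧ nd (w * (j.val / M : ℝ)) ≤ W / K ^ 2 := by
    intro j hj
    rw [mem_filter] at hj
    obtain ⟨w, w1, w2, w3⟩ := WeylS R I M v hR2 hI200 hv1 j y0 hj.2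
    refine ⟨w, w1, w2.trans ?_, w3.trans ?_⟩
    · rw [hW]
      calc 2 * v ^ 2 * R ^ 200 ≤ R * R ^ 2 * R ^ 200 := nmR _ (Nat.mul_le_mul hR2 (npL hv2 2))
        _ = R ^ 203 := by ring
    · rw [div_le_div_iff₀ (by positivity) (by positivity), hW, Nat.cast_pow]
      calc (R:ℝ) ^ 200 * K ^ 2 ≤ (R:ℝ) ^ 200 * (R * I) ^ 2 := by gcongr
        _ = (R:ℝ) ^ 202 * I ^ 2 := by ring
        _ ≤ (R:ℝ) ^ 203 * I ^ 2 := mR (pow_le_pow_right₀ (by linarith) (by norm_num)) (by positivity)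
  have hW2 : 2 ≤ W := by rw [hW]; exact hR2.trans (nsp (by norm_num) _)
  have hWr : (2:ℝ) ≤ W := by exact_mod_cast hW2
  have hRW : (R:ℝ) ≤ W := by rw [hW]; exact Nat.cast_le.2 (nsp (by norm_num) _)
  have hc := count_maj M K W hM hKp hW2 S hmaj
  have hSn : S.Nonempty := by
    rw [nonempty_iff_ne_empty]; intro h0
    rw [h0, sum_empty, mul_zero] at h7
    have : 0 < (M:ℝ) ^ 2 := by positivity
    linarith
  obtain ⟨j, hjS, hj⟩ := pigs S hSn (fun j => ‖F j‖ ^ 2)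
  have h8 : (M:ℝ) ^ 2 ≤ W ^ 15 * ‖F j‖ ^ 2 := by
    calc (M:ℝ) ^ 2 ≤ 2 * R * ∑ j ∈ S, ‖F j‖ ^ 2 := h7
      _ ≤ W * W * ((W:ℝ) ^ 13 * ‖F j‖ ^ 2) :=
        mul_le_mul (mul_le_mul hWr hRW (by positivity) (by positivity)) (hj.trans (mR hc (by positivity))) (by positivity) (by positivity)
      _ = _ := by ring
  have h9 : (M:ℝ) ≤ W ^ 15 * ‖F j‖ := by
    refine abs_le_of_sq_le_sq' ?_ (by positivity) |>.2
    refine h8.trans ?_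
    rw [mul_pow, ← pow_mul]
    exact mR (pow_le_pow_right₀ (by linarith) (by norm_num)) (by positivity)
  have hWR : W ^ 15 ≤ R ^ 10000 := by rw [hW, ← pow_mul]; exact npR (by omega) (by norm_num)
  have hWR1 : W ≤ R ^ 10000 := (nsp (by norm_num) _).trans hWR
  obtain ⟨w, w1, w2, w3⟩ := hmaj j hjS
  refine ⟨j, w, w1, w2.trans hWR1, w3.trans (div_le_div_of_nonneg_right (Nat.cast_le.2 hWR1) (by positivity)), ?_⟩
  refine h9.trans (mR ?_ (norm_nonneg _))
  rw [← Nat.cast_pow]; exact Nat.cast_le.2 hWR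

lemma sqrt_facts (N K : ℕ) (hK : K = Nat.sqrt N) (hK1 : 1 ≤ K) : K ^ 2 ≤ N ∧ N < (K + 1) ^ 2 ∧ N ≤ 4 * K ^ 2 ∧ K ≤ N := by
  have h1 : K * K ≤ N := by rw [hK]; exact Nat.sqrt_le N
  have h2 : N < (K + 1) * (K + 1) := by rw [hK]; exact Nat.lt_succ_sqrt N
  refine ⟨by nlinarith, by nlinarith, by nlinarith, by nlinarith⟩

lemma lift_Lam (N K M : ℕ) [NeZero M] (hK : K = Nat.sqrt N) (hK1 : 1 ≤ K) (hM : 100 * K ^ 2 = M) (f g h : ℤ → ℂ)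
    (hf : ∀ x, f x ≠ 0 → x ∈ IC N) (hg : ∀ x, g x ≠ 0 → x ∈ IC N) (hh : ∀ x, h x ≠ 0 → x ∈ IC N) :
    ∑ x ∈ IC N, ∑ y ∈ IC N, f x * g (x + y) * h (x + y ^ 2) =
      Lam K (cyc M f) (cyc M g) (cyc M h) := by
  obtain ⟨k1, k2, k3, k4⟩ := sqrt_facts N K hK hK1
  have hKK : K ≤ K ^ 2 := nsp (by norm_num) _
  have sp : ∀ F : ℤ → ℂ, (∀ x, F x ≠ 0 → x ∈ IC N) → ∀ x, F x ≠ 0 → 0 ≤ x ∧ x < (N + 1 : ℤ) := by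
    intro F hF x hx; have := mem_Icc.1 (hF x hx); omega
  unfold Lam
  rw [sum_comm, ← sum_subset (s₁ := IC K) (Icc_subset_Icc_right (by exact_mod_cast k4))]
  · refine sum_congr rfl fun y hy => ?_
    rw [mem_Icc] at hy
    have hy2 : y ^ 2 ≤ (K:ℤ) ^ 2 := pL (by omega) hy.2 2
    have hy0 : 0 ≤ y ^ 2 := sq_nonneg y
    have e : ∀ x : ZMod M, cyc M f x * cyc M g (x + (y : ZMod M)) * cyc M h (x + (y : ZMod M) ^ 2) =
        (cyc M g (x + (y : ZMod M)) * cyc M h (x + (y : ZMod M) ^ 2)) * cyc M f x := fun x => by ring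
    simp only [e]
    rw [sum_cyc (fun x => cyc M g (x + (y : ZMod M)) * cyc M h (x + (y : ZMod M) ^ 2)) f (N + 1) (by omega) (sp f hf)]
    have hI : IC N ⊆ IZ (N + 1) := by intro x hx; rw [mem_Icc] at hx; rw [mem_Ico]; omega
    rw [← sum_subset hI]
    · refine sum_congr rfl fun x hx => ?_
      rw [mem_Icc] at hx
      zify at hM k3 hKK
      rw [← Int.cast_pow, ← Int.cast_add, ← Int.cast_add, cyc_int g (N + 1) (sp g hg) (x + y) (by linarith) (by linarith),
        cyc_int h (N + 1) (sp h hh) (x + y ^ 2) (by linarith) (by linarith)]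
      ring
    · intro x _ hx
      have : f x = 0 := by by_contra h0; exact hx (hf x h0)
      simp [this]
  · intro y hy hy'
    rw [mem_Icc] at hy hy'
    refine sum_eq_zero fun x hx => ?_
    rw [mem_Icc] at hx
    have hyK : (K:ℤ) + 1 ≤ y := by omega
    have hy2 : ((K:ℤ) + 1) ^ 2 ≤ y ^ 2 := pL (by omega) hyK 2
    have : h (x + y ^ 2) = 0 := by
      by_contra h0
      have := mem_Icc.1 (hh _ h0)
      zify at k2
      linarith [this.2]
    rw [this, mul_zero]

lemma local_fin (N K w : ℕ) (R θ : ℝ) (hK1 : 1 ≤ K) (hN : N ≤ 4 * K ^ 2) (hR : 1 ≤ R) (hw : 1 ≤ w)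
    (hn : nd (w * θ) ≤ R / K ^ 2) (h : ℤ → ℂ) (hh : ∀ x, ‖h x‖ ≤ 1)
    (H : 100 * (K:ℝ) ^ 2 ≤ R * ‖∑ x ∈ IC N, h x * ee (θ * x)‖) :
    ∃ φ : ℤ → ℂ, (∀ x, ‖φ x‖ ≤ 1) ∧ IsLocalFunction φ (K ^ 2 / R ^ 2) w ∧
      50 * (K:ℝ) ^ 2 ≤ R * ‖∑ x ∈ IC N, h x * φ x‖ := by
  have hKr : (0:ℝ) < K := by exact_mod_cast hK1
  have hwr : (1:ℝ) ≤ w := by exact_mod_cast hw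
  have hNr : (N:ℝ) ≤ 4 * K ^ 2 := by exact_mod_cast hN
  set u : ℤ := round (w * θ) with hu
  set ε : ℝ := θ - u / w with hε
  set m : ℝ := K ^ 2 / R ^ 2 with hm
  have hm0 : 0 < m := by positivity
  have hεb : |ε| ≤ R / K ^ 2 := by
    have e1 : (w:ℝ) * ε = w * θ - u := by rw [hε]; field_simp
    have e2 : |(w:ℝ) * ε| ≤ R / K ^ 2 := by rw [e1]; exact hn
    rw [abs_mul, abs_of_nonneg (by linarith)] at e2
    nlinarith [abs_nonneg ε]
  refine ⟨fun x => ee (u / w * x) * ee (ε * (m * ⌊(x:ℝ) / m⌋)), fun x => bd_mul (norm_ee _).le (norm_ee _).le, ⟨0, ?_⟩, ?_⟩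
  · intro x y h1 h2
    rw [sub_zero, sub_zero] at h1
    simp only [h1]
    congr 1
    obtain ⟨k, hk⟩ : (w:ℤ) ∣ x - y := (show y ≡ x [ZMOD w] from h2.symm).dvd
    have hx : (x:ℝ) = y + w * k := by
      have : x = y + w * k := by linarith
      exact_mod_cast this
    rw [show (u / w * x : ℝ) = u / w * y + ((u * k : ℤ) : ℝ) by rw [hx]; push_cast; field_simp, ee_add_int]
  · have hd : ‖∑ x ∈ IC N, h x * ee (θ * x) - ∑ x ∈ IC N, h x * (ee (u / w * x) * ee (ε * (m * ⌊(x:ℝ) / m⌋)))‖ ≤ N * (7 / R) := by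
      rw [← sum_sub_distrib]
      refine (norm_sum_le _ _).trans ((slc _ _ (7 / R) fun x hx => ?_).trans (le_of_eq ?_))
      · rw [← mul_sub, norm_mul]
        refine (mul_le_of_le_one_left (norm_nonneg _) (hh x)).trans ?_
        have e1 : ee (θ * x) = ee (u / w * x) * ee (ε * x) := by rw [← ee_add, hε]; congr 1; ring
        rw [e1, ← mul_sub, norm_mul, norm_ee, one_mul]
        refine (ee_sub_le _ _).trans ?_
        have f1 := Int.floor_le ((x:ℝ) / m)
        have f2 := (Int.lt_floor_add_one ((x:ℝ) / m)).le
        rw [le_div_iff₀ hm0] at f1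
        rw [div_le_iff₀ hm0] at f2
        have e2 : |(x:ℝ) - m * ⌊(x:ℝ) / m⌋| ≤ m := by rw [abs_le]; constructor <;> nlinarith
        have e3 : nd (ε * x - ε * (m * ⌊(x:ℝ) / m⌋)) ≤ 1 / R := by
          refine (nd_le_abs _).trans ?_
          rw [← mul_sub, abs_mul ε]
          calc |ε| * _ ≤ (R / K ^ 2) * m := mul_le_mul hεb e2 (abs_nonneg _) (by positivity)
            _ = 1 / R := by rw [hm]; field_simp
        calc 7 * _ ≤ 7 * (1 / R) := mL e3 (by norm_num)
          _ = 7 / R := by ring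
      · simp
    have h1 := (norm_sub_norm_le _ _).trans hd
    have h2 : (N:ℝ) * (7 / R) * R ≤ 28 * K ^ 2 := by
      rw [mul_assoc, div_mul_cancel₀ _ (by positivity)]; linarith
    have h3 := mR h1 (by linarith : (0:ℝ) ≤ R)
    nlinarith [sq_nonneg (K:ℝ)]

lemma triv_bd (N K : ℕ) (hK : K = Nat.sqrt N) (hK1 : 1 ≤ K) (f g h : ℤ → ℂ)
    (hf : ∀ x, ‖f x‖ ≤ 1) (hg : ∀ x, ‖g x‖ ≤ 1) (hh : ∀ x, ‖h x‖ ≤ 1) (hs : ∀ x, h x ≠ 0 → x ∈ IC N) :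
    ‖∑ x ∈ IC N, ∑ y ∈ IC N, f x * g (x + y) * h (x + y ^ 2)‖ ≤ N * K := by
  obtain ⟨k1, k2, k3, k4⟩ := sqrt_facts N K hK hK1
  refine (norm_sum_le _ _).trans ((slc _ _ (K:ℝ) fun x hx => ?_).trans (by simp))
  rw [mem_Icc] at hx
  rw [← sum_subset (s₁ := IC K) (Icc_subset_Icc_right (by exact_mod_cast k4))]
  · exact (norm_sum_le _ _).trans ((slc _ _ 1 fun y _ => bd_mul (bd_mul (hf _) (hg _)) (hh _)).trans (by simp))
  · intro y hy hy'
    rw [mem_Icc] at hy hy'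
    have hyK : (K:ℤ) + 1 ≤ y := by omega
    have hy2 : ((K:ℤ) + 1) ^ 2 ≤ y ^ 2 := pL (by omega) hyK 2
    have : h (x + y ^ 2) = 0 := by
      by_contra h0
      have := mem_Icc.1 (hs _ h0)
      zify at k2
      linarith [this.2]
    rw [this, mul_zero]

theorem local_control_of_nonlinear_term :
    ∃ C c : ℝ, 0 < C ∧ 0 < c ∧
      ∀ (N : ℕ) (δ : ℝ) (f g h : ℤ → ℂ), 0 < δ →
        (∀ x, ‖f x‖ ≤ 1) → (∀ x, ‖g x‖ ≤ 1) → (∀ x, ‖h x‖ ≤ 1) →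
        (∀ x, f x ≠ 0 → x ∈ Finset.Icc (1 : ℤ) (N : ℤ)) →
        (∀ x, g x ≠ 0 → x ∈ Finset.Icc (1 : ℤ) (N : ℤ)) →
        (∀ x, h x ≠ 0 → x ∈ Finset.Icc (1 : ℤ) (N : ℤ)) →
        δ * (N : ℝ) ^ ((3 : ℝ) / 2) ≤
          ‖∑ x ∈ Finset.Icc (1 : ℤ) (N : ℤ), ∑ y ∈ Finset.Icc (1 : ℤ) (N : ℤ),
              f x * g (x + y) * h (x + y ^ 2)‖ →
        ((N : ℝ) ≤ C * δ ^ (-C) ∨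
          ∃ (φ : ℤ → ℂ) (M : ℝ) (q : ℕ), (∀ x, ‖φ x‖ ≤ 1) ∧ 0 < q ∧
            IsLocalFunction φ M q ∧
            c * δ ^ C * N ≤ M ∧ (q : ℝ) ≤ C * δ ^ (-C) ∧
            c * δ ^ C * N ≤ ‖∑ x ∈ Finset.Icc (1 : ℤ) (N : ℤ), h x * φ x‖) := by
  obtain ⟨n, hn, S5⟩ := Step5
  refine ⟨101 ^ (2 * n), 1 / (4 * 101 ^ (2 * n)), by positivity, by positivity, ?_⟩
  intro N δ f g h hδ hf hg hh sf sg sh H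
  set C : ℝ := 101 ^ (2 * n) with hC
  have hC0 : 0 < C := by positivity
  have hCn : ((2 * n : ℕ) : ℝ) ≤ C := by
    have := (Nat.lt_pow_self (n := 2 * n) (by norm_num : 1 < 101)).le
    rw [hC]; exact_mod_cast this
  rcases Nat.eq_zero_or_pos N with hN0 | hN0
  · left; rw [hN0]; push_cast; positivity
  obtain ⟨K, hK⟩ : ∃ K, K = Nat.sqrt N := ⟨_, rfl⟩
  have hK1 : 1 ≤ K := by rw [hK]; exact Nat.sqrt_pos.2 hN0
  obtain ⟨k1, k2, k3, k4⟩ := sqrt_facts N K hK hK1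
  have hKr : (1:ℝ) ≤ K := by exact_mod_cast hK1
  have hNr : (1:ℝ) ≤ N := by exact_mod_cast hN0
  have k1r : (K:ℝ) ^ 2 ≤ N := by exact_mod_cast k1
  have k3r : (N:ℝ) ≤ 4 * K ^ 2 := by exact_mod_cast k3
  have hpw : (N:ℝ) * K ≤ (N:ℝ) ^ ((3:ℝ) / 2) := by
    rw [show (3:ℝ) / 2 = 1 + 1 / 2 by norm_num, Real.rpow_add (by linarith), Real.rpow_one, ← Real.sqrt_eq_rpow]
    exact mL (Real.le_sqrt_of_sq_le k1r) (by linarith)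
  have hP : 0 < (N:ℝ) ^ ((3:ℝ) / 2) := by positivity
  have hδ1 : δ ≤ 1 := by
    have := H.trans (triv_bd N K hK hK1 f g h hf hg hh sh)
    by_contra h0
    push Not at h0
    nlinarith
  obtain ⟨Q, hQ⟩ : ∃ Q, Q = ⌈100 / δ⌉₊ := ⟨_, rfl⟩
  have hQ1 : 100 / δ ≤ Q := by rw [hQ]; exact Nat.le_ceil _
  have hQ2 : (Q:ℝ) ≤ 101 / δ := by
    have := (Nat.ceil_lt_add_one (by positivity : 0 ≤ 100 / δ)).le
    rw [← hQ] at this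
    refine this.trans ?_
    rw [le_div_iff₀ hδ, add_mul, div_mul_cancel₀ _ hδ.ne']; linarith
  have hQ3 : (100:ℝ) ≤ Q := le_trans (by rw [le_div_iff₀ hδ]; linarith) hQ1
  have hQ4 : 2 ≤ Q := by
    have : (2:ℝ) ≤ Q := by linarith
    exact_mod_cast this
  obtain ⟨Z, hZ⟩ : ∃ Z : ℝ, Z = (101 / δ) ^ (2 * n) := ⟨_, rfl⟩
  have hZC : Z ≤ C * δ ^ (-C) := by
    rw [hZ, div_pow, ← hC, div_eq_mul_inv, Real.rpow_neg hδ.le]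
    refine mL (inv_anti₀ (by positivity) ?_) hC0.le
    rw [← Real.rpow_natCast]
    exact Real.rpow_le_rpow_of_exponent_ge hδ hδ1 hCn
  have hZ0 : 0 < Z := by rw [hZ]; positivity
  have hcZ : 1 / (4 * C) * δ ^ C ≤ 1 / (4 * Z) := by
    have e1 : δ ^ C ≤ δ ^ (2 * n) := by
      rw [← Real.rpow_natCast]
      exact Real.rpow_le_rpow_of_exponent_ge hδ hδ1 hCn
    calc 1 / (4 * C) * δ ^ C ≤ 1 / (4 * C) * δ ^ (2 * n) := mL e1 (by positivity)
      _ = 1 / (4 * Z) := by rw [hZ, hC, div_pow]; field_simp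
  obtain ⟨R, hR⟩ : ∃ R, R = Q ^ n := ⟨_, rfl⟩
  have hR1 : 1 ≤ R := by rw [hR]; exact Nat.pow_pos (by omega)
  have hR1r : (1:ℝ) ≤ R := by exact_mod_cast hR1
  have hRZ : (R:ℝ) ^ 2 ≤ Z := by
    rw [hR, hZ, Nat.cast_pow, ← pow_mul, mul_comm n 2]
    exact pL (by linarith) hQ2 _
  have hRZ1 : (R:ℝ) ≤ Z := le_trans (by nlinarith) hRZ
  by_cases hKQ : Q ^ n ≤ K
  swap
  · left
    refine le_trans ?_ (hRZ.trans hZC)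
    rw [← hR] at hKQ
    have : N ≤ R ^ 2 := k2.le.trans (npL (by omega) 2)
    exact_mod_cast this
  right
  obtain ⟨M, hM⟩ : ∃ M, 100 * K ^ 2 = M := ⟨_, rfl⟩
  have hMz : NeZero M := ⟨by rw [← hM]; positivity⟩
  have hMr : 100 * (K:ℝ) ^ 2 = M := by exact_mod_cast hM
  rw [lift_Lam N K M hK hK1 hM f g h sf sg sh] at H
  obtain ⟨j, w, w1, w2, w3, h1⟩ := S5 Q K M hQ4 hM hKQ (cyc M f) (cyc M g) (cyc M h) (fun _ => hf _) (fun _ => hg _) (fun _ => hh _) (by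
    have e1 : δ * ((N:ℝ) * K) ≤ ‖Lam K (cyc M f) (cyc M g) (cyc M h)‖ := (mL hpw hδ.le).trans H
    have e2 : (M:ℝ) * K ≤ 100 * (N * K) := by rw [← hMr]; nlinarith
    calc (M:ℝ) * K ≤ 100 * (N * K) := e2
      _ = 100 / δ * (δ * (N * K)) := by field_simp
      _ ≤ Q * _ := mul_le_mul hQ1 e1 (by positivity) (by positivity))
  rw [← hR] at w2 w3 h1
  have h2 : ∑ x, cyc M h x * ch j x = ∑ x ∈ IC N, h x * ee (j.val / M * x) := by
    simp only [mul_comm (cyc M h _)]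
    rw [sum_cyc (ch j) h (N + 1) (by omega) (fun x hx => by have := mem_Icc.1 (sh x hx); omega)]
    have hI : IC N ⊆ IZ (N + 1) := by intro x hx; rw [mem_Icc] at hx; rw [mem_Ico]; omega
    rw [← sum_subset hI]
    · exact sum_congr rfl fun x _ => by rw [ch_int, mul_comm]
    · intro x _ hx
      have : h x = 0 := by by_contra h0; exact hx (sh x h0)
      rw [this, mul_zero]
  rw [h2, ← hMr] at h1
  obtain ⟨φ, p1, p2, p3⟩ := local_fin N K w R (j.val / M) hK1 k3 hR1r w1 w3 h hh (by rw [← hMr]; exact h1)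
  have hfin : 1 / (4 * C) * δ ^ C * N ≤ (N:ℝ) / (4 * Z) := by
    calc 1 / (4 * C) * δ ^ C * N ≤ 1 / (4 * Z) * N := mR hcZ (by linarith)
      _ = _ := by ring
  refine ⟨φ, _, w, p1, w1, p2, hfin.trans ?_, ?_, hfin.trans ?_⟩
  · rw [div_le_div_iff₀ (by positivity) (by positivity)]
    calc (N:ℝ) * R ^ 2 ≤ (4 * K ^ 2) * Z := mul_le_mul k3r hRZ (by positivity) (by positivity)
      _ = _ := by ring
  · exact le_trans (Nat.cast_le.2 w2) (hRZ1.trans hZC)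
  · rw [div_le_iff₀ (by positivity)]
    have e1 := mR hRZ1 (norm_nonneg (∑ x ∈ IC N, h x * φ x))
    nlinarith
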